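/- Let K be any number field. Then unconditionally M_K^+ − M_K^- ≥ 1; precisely, either M_K^+ = +∞, or M_K^- = −∞, or both are finite and M_K^+ − M_K^- ≥ 1. -/

import Mathlib

noncomputable section

open NumberField Filter Topology MeasureTheory Complex

open scoped Classical

/-- The Möbius function on integral ideals of a number field `K`. -/
def moebiusK (K : Type) [Field K] [NumberField K] (I : Ideal (𝓞 K)) : ℤ :=
  if Squarefree I then (-1) ^ (UniqueFactorizationMonoid.factors I).card else 0

/-- The Mertens function of a number field `K`: the sum of `μ_K(𝔞)` over nonzero integral
ideals `𝔞` of norm at most `x`, where ideals of norm exactly `x` count with weight `1/2`. -/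
def mertensK (K : Type) [Field K] [NumberField K] (x : ℝ) : ℝ :=
  ∑' I : Ideal (𝓞 K),
    if I ≠ ⊥ ∧ (Ideal.absNorm I : ℝ) < x then (moebiusK K I : ℝ)
    else if I ≠ ⊥ ∧ (Ideal.absNorm I : ℝ) = x then (moebiusK K I : ℝ) / 2
    else 0

/-- `M_K^- = liminf_{x → ∞} M_K(x) / x^{1/2}`, as an extended real number. -/
def MKminus (K : Type) [Field K] [NumberField K] : EReal :=
  Filter.liminf (fun x : ℝ => ((mertensK K x / Real.sqrt x : ℝ) : EReal)) Filter.atTop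

/-- `M_K^+ = limsup_{x → ∞} M_K(x) / x^{1/2}`, as an extended real number. -/
def MKplus (K : Type) [Field K] [NumberField K] : EReal :=
  Filter.limsup (fun x : ℝ => ((mertensK K x / Real.sqrt x : ℝ) : EReal)) Filter.atTop

/-- The naïve Mertens-type conjecture over `K`: `-1 ≤ M_K^- ≤ M_K^+ ≤ 1`. -/
def NaiveMertensConj (K : Type) [Field K] [NumberField K] : Prop :=
  -1 ≤ MKminus K ∧ MKminus K ≤ MKplus K ∧ MKplus K ≤ 1

/-- A predicate identifying the Dedekind zeta function of `K`: a function analytic away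
from `s = 1` agreeing with the Dirichlet series `∑ N(𝔞)^{-s}` on `Re s > 1`. -/
def IsDedekindZeta (K : Type) [Field K] [NumberField K] (Z : ℂ → ℂ) : Prop :=
  (∀ s : ℂ, s ≠ 1 → DifferentiableAt ℂ Z s) ∧
  ∀ s : ℂ, 1 < s.re →
    Z s = ∑' I : {I : Ideal (𝓞 K) // I ≠ ⊥}, (Ideal.absNorm I.1 : ℂ) ^ (-s)

/-- The Riemann hypothesis for a zeta function `Z`: all nontrivial zeros lie on `Re s = 1/2`. -/
def ZetaRH (Z : ℂ → ℂ) : Prop :=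
  ∀ ρ : ℂ, Z ρ = 0 → 0 < ρ.re → ρ.re < 1 → ρ.re = 1 / 2

section GaussianPoisson

variable {d : Type*} [Fintype d] [DecidableEq d]

/-- The squared Euclidean length of `C x`. -/
def quadForm (C : Matrix d d ℝ) (x : d → ℝ) : ℝ := ∑ i, (C.mulVec x i) ^ 2

lemma continuous_quadForm (C : Matrix d d ℝ) : Continuous (quadForm C) := by
  unfold quadForm Matrix.mulVec dotProduct
  fun_prop

lemma exists_quadForm_ge (C : Matrix d d ℝ) (hC : IsUnit C.det) :
    ∃ c > 0, ∀ x : d → ℝ, c * ‖x‖ ^ 2 ≤ quadForm C x := by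
  let A := LinearMap.toContinuousLinearMap (Matrix.toLin' C⁻¹)
  refine ⟨(‖A‖ ^ 2 + 1)⁻¹, by positivity, fun x => ?_⟩
  have h1 : ‖x‖ ≤ ‖A‖ * ‖C.mulVec x‖ := by
    have := A.le_opNorm (C.mulVec x)
    have h2 : A (C.mulVec x) = x := by
      simp [A, Matrix.mulVec_mulVec, Matrix.nonsing_inv_mul C hC]
    rwa [h2] at this
  have h3 : ‖C.mulVec x‖ ^ 2 ≤ quadForm C x := by
    have h4 : ‖C.mulVec x‖ ≤ Real.sqrt (quadForm C x) := by
      refine (pi_norm_le_iff_of_nonneg (Real.sqrt_nonneg _)).2 fun i => ?_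
      rw [Real.norm_eq_abs, ← Real.sqrt_sq_eq_abs]
      exact Real.sqrt_le_sqrt (Finset.single_le_sum (f := fun i => (C.mulVec x i) ^ 2)
        (fun i _ => sq_nonneg _) (Finset.mem_univ i))
    have h5 : 0 ≤ quadForm C x := Finset.sum_nonneg fun i _ => sq_nonneg _
    calc ‖C.mulVec x‖ ^ 2 ≤ Real.sqrt (quadForm C x) ^ 2 := by gcongr
      _ = _ := Real.sq_sqrt h5
  rw [inv_mul_le_iff₀ (by positivity)]
  have h6 : ‖x‖ ^ 2 ≤ ‖A‖ ^ 2 * ‖C.mulVec x‖ ^ 2 := by rw [← mul_pow]; gcongr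
  nlinarith [sq_nonneg ‖A‖, sq_nonneg ‖C.mulVec x‖]

lemma summable_exp_neg_norm_sq {a : ℝ} (ha : 0 < a) :
    Summable fun m : d → ℤ => Real.exp (-a * ‖(fun i => (m i : ℝ))‖ ^ 2) := by
  let L : Submodule ℤ (d → ℝ) := Submodule.span ℤ (Set.range (Pi.basisFun ℝ d))
  let φ : (d → ℤ) → L := fun m => ⟨fun i => (m i : ℝ), by
    rw [Module.Basis.mem_span_iff_repr_mem]
    intro i
    simp⟩
  have hφ : Function.Injective φ := fun m n h => by
    ext i
    have : (m i : ℝ) = (n i : ℝ) := congrFun (congrArg Subtype.val h) i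
    exact_mod_cast this
  obtain ⟨k, hk⟩ := exists_nat_gt (Module.finrank ℤ L : ℝ)
  have h1 := (ZLattice.summable_norm_rpow L (-(k : ℝ)) (by linarith)).comp_injective hφ
  have h2 := (h1.mul_left ((k.factorial : ℝ) * (1 + a⁻¹ ^ k)))
  refine h2.of_norm_bounded_eventually ?_
  refine (Set.finite_singleton (0 : d → ℤ)).subset fun m hm => ?_
  by_contra hm0
  apply hm
  rw [Set.mem_ofPred_eq]
  simp only [Function.comp_apply, Real.norm_eq_abs, Real.abs_exp]
  set r : ℝ := ‖(fun i => (m i : ℝ))‖ with hr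
  have hφr : ‖φ m‖ = r := rfl
  rw [hφr]
  have hr1 : 1 ≤ r := by
    have : ∃ i, m i ≠ 0 := by
      by_contra hcon
      push Not at hcon
      exact hm0 (funext hcon)
    obtain ⟨i, hi⟩ := this
    calc (1 : ℝ) ≤ |(m i : ℝ)| := by exact_mod_cast Int.one_le_abs hi
      _ ≤ r := norm_le_pi_norm (fun i => (m i : ℝ)) i
  have hr0 : 0 < r := by linarith
  have h3 := Real.pow_div_factorial_le_exp (a * r ^ 2) (by positivity) k
  rw [Real.rpow_neg hr0.le, Real.rpow_natCast, neg_mul, Real.exp_neg]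
  have h4 : Real.exp (a * r ^ 2) ≥ (a ^ k * r ^ k) / k.factorial := by
    refine le_trans ?_ h3
    rw [mul_pow]
    gcongr
    nlinarith
  calc (Real.exp (a * r ^ 2))⁻¹ ≤ ((a ^ k * r ^ k) / k.factorial)⁻¹ := by
        apply inv_anti₀ (by positivity) h4
    _ = k.factorial * a⁻¹ ^ k * (r ^ k)⁻¹ := by rw [inv_pow]; field_simp
    _ ≤ _ := by gcongr; linarith

lemma summable_exp_neg_quadForm_add (C : Matrix d d ℝ) (hC : IsUnit C.det) (R : ℝ) :
    ∃ u : (d → ℤ) → ℝ, Summable u ∧ ∀ (m : d → ℤ) (x : d → ℝ), ‖x‖ ≤ R →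
      Real.exp (-Real.pi * quadForm C (fun i => (m i : ℝ) + x i)) ≤ u m := by
  obtain ⟨c, hc, h⟩ := exists_quadForm_ge C hC
  refine ⟨fun m => Real.exp (Real.pi * c * R ^ 2) *
    Real.exp (-(Real.pi * c / 2) * ‖(fun i => (m i : ℝ))‖ ^ 2),
    (summable_exp_neg_norm_sq (by positivity)).mul_left _, fun m x hx => ?_⟩
  beta_reduce
  rw [← Real.exp_add]
  apply Real.exp_le_exp.2
  set y : d → ℝ := fun i => (m i : ℝ)
  have h1 := h (y + x)
  have h2 : ‖y‖ ≤ ‖y + x‖ + ‖x‖ := by simpa using norm_sub_le (y + x) x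
  have h3 : ‖y‖ ^ 2 ≤ 2 * ‖y + x‖ ^ 2 + 2 * R ^ 2 := by
    have : ‖y‖ ≤ ‖y + x‖ + R := by linarith
    nlinarith [norm_nonneg y, norm_nonneg (y + x), norm_nonneg x, sq_nonneg (‖y + x‖ - R)]
  have h4 : c * ‖y‖ ^ 2 ≤ 2 * quadForm C (y + x) + 2 * c * R ^ 2 := by nlinarith
  have h5 : quadForm C (fun i => (m i : ℝ) + x i) = quadForm C (y + x) := rfl
  rw [h5]
  nlinarith [Real.pi_pos]

lemma summable_exp_neg_quadForm (C : Matrix d d ℝ) (hC : IsUnit C.det) :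
    Summable fun m : d → ℤ => Real.exp (-Real.pi * quadForm C (fun i => (m i : ℝ))) := by
  obtain ⟨u, hu, h⟩ := summable_exp_neg_quadForm_add C hC 0
  refine hu.of_nonneg_of_le (fun m => (Real.exp_pos _).le) fun m => ?_
  simpa using h m 0 (by simp)

/-- The periodization of a Gaussian. -/
def periodicGaussian (C : Matrix d d ℝ) (x : d → ℝ) : ℂ :=
  ∑' m : d → ℤ, (Real.exp (-Real.pi * quadForm C (fun i => (m i : ℝ) + x i)) : ℂ)

lemma continuous_periodicGaussian (C : Matrix d d ℝ) (hC : IsUnit C.det) :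
    Continuous (periodicGaussian C) := by
  rw [continuous_iff_continuousAt]
  intro x
  obtain ⟨u, hu, h⟩ := summable_exp_neg_quadForm_add C hC (‖x‖ + 1)
  have hcont : ContinuousOn (periodicGaussian C) (Metric.ball 0 (‖x‖ + 1)) := by
    refine continuousOn_tsum (u := u) (fun m => ?_) hu fun m y hy => ?_
    · refine (Complex.continuous_ofReal.comp (Real.continuous_exp.comp
        (continuous_const.mul ((continuous_quadForm C).comp ?_)))).continuousOn
      fun_prop
    · rw [Complex.norm_real, Real.norm_eq_abs, Real.abs_exp]
      exact h m y (by simpa using (mem_ball_zero_iff.1 hy).le)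
  exact hcont.continuousAt (Metric.isOpen_ball.mem_nhds (by simp))

lemma periodicGaussian_add_int (C : Matrix d d ℝ) (x : d → ℝ) (n : d → ℤ) :
    periodicGaussian C (fun i => x i + n i) = periodicGaussian C x := by
  unfold periodicGaussian
  rw [← (Equiv.addRight n).tsum_eq (fun m : d → ℤ =>
    (Real.exp (-Real.pi * quadForm C (fun i => (m i : ℝ) + x i)) : ℂ))]
  refine tsum_congr fun m => ?_
  congr 4
  ext i
  simp
  ring

end GaussianPoisson

section GaussianPoisson

variable {d : Type*} [Fintype d] [DecidableEq d]

lemma cexp_mul_exp_neg_quadForm (C : Matrix d d ℝ) (hC : IsUnit C.det) (k v : d → ℝ) :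
    cexp (-2 * Real.pi * I * ∑ i, k i * v i) * (Real.exp (-Real.pi * quadForm C v) : ℂ) =
      cexp (-Real.pi * ∑ i, (C.mulVec v i : ℂ) ^ 2 +
        ∑ i, (-2 * Real.pi * I * (C⁻¹.transpose.mulVec k i : ℝ)) * C.mulVec v i) := by
  rw [Complex.ofReal_exp, ← Complex.exp_add, add_comm]
  congr 1
  unfold quadForm
  push_cast
  congr 1
  have h : ∑ i, k i * v i = ∑ i, (C⁻¹.transpose.mulVec k) i * C.mulVec v i := by
    change k ⬝ᵥ v = (C⁻¹.transpose.mulVec k) ⬝ᵥ C.mulVec v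
    rw [Matrix.mulVec_transpose, ← Matrix.dotProduct_mulVec, Matrix.mulVec_mulVec,
      Matrix.nonsing_inv_mul C hC, Matrix.one_mulVec]
  simp only [mul_assoc, ← Finset.mul_sum]
  simp only [← Complex.ofReal_mul, ← Complex.ofReal_sum, h]

lemma map_mulVec_volume (C : Matrix d d ℝ) (hC : IsUnit C.det) :
    Measure.map (fun v : d → ℝ => C.mulVec v) volume = ENNReal.ofReal |C.det|⁻¹ • volume := by
  rw [← abs_inv, ← Real.map_matrix_volume_pi_eq_smul_volume_pi hC.ne_zero]
  rfl

lemma measurableEmbedding_mulVec (C : Matrix d d ℝ) (hC : IsUnit C.det) :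
    MeasurableEmbedding (fun v : d → ℝ => C.mulVec v) := by
  have : Continuous (fun v : d → ℝ => C.mulVec v) := by fun_prop
  refine this.measurableEmbedding fun x y hxy => ?_
  have := congrArg (C⁻¹.mulVec) hxy
  simpa [Matrix.mulVec_mulVec, Matrix.nonsing_inv_mul C hC] using this

lemma integrable_exp_neg_quadForm_mul (C : Matrix d d ℝ) (hC : IsUnit C.det) (k : d → ℝ) :
    Integrable (fun v : d → ℝ =>
      cexp (-2 * Real.pi * I * ∑ i, k i * v i) * (Real.exp (-Real.pi * quadForm C v) : ℂ)) := by
  simp_rw [cexp_mul_exp_neg_quadForm C hC]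
  have h1 := (GaussianFourier.integrable_cexp_neg_mul_sum_add (ι := d) (b := Real.pi)
      (by simpa using Real.pi_pos) (fun i => -2 * Real.pi * I * (C⁻¹.transpose.mulVec k i : ℝ)))
  have h2 := (h1.smul_measure (c := ENNReal.ofReal |C.det|⁻¹) ENNReal.ofReal_ne_top)
  rw [← map_mulVec_volume C hC, (measurableEmbedding_mulVec C hC).integrable_map_iff] at h2
  exact h2

lemma integral_exp_neg_quadForm_mul (C : Matrix d d ℝ) (hC : IsUnit C.det) (k : d → ℝ) :
    ∫ v : d → ℝ, cexp (-2 * Real.pi * I * ∑ i, k i * v i) *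
      (Real.exp (-Real.pi * quadForm C v) : ℂ) =
      (|C.det|⁻¹ : ℝ) * (Real.exp (-Real.pi * quadForm (C⁻¹).transpose k) : ℂ) := by
  simp_rw [cexp_mul_exp_neg_quadForm C hC]
  have h1 := (GaussianFourier.integral_cexp_neg_mul_sum_add (ι := d) (b := Real.pi)
      (by simpa using Real.pi_pos) (fun i => -2 * Real.pi * I * (C⁻¹.transpose.mulVec k i : ℝ)))
  have h2 := (measurableEmbedding_mulVec C hC).integral_map (μ := volume) (fun v : d → ℝ =>
    cexp (-Real.pi * ∑ i, (v i : ℂ) ^ 2 +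
      ∑ i, -2 * Real.pi * I * (C⁻¹.transpose.mulVec k i : ℝ) * v i))
  rw [map_mulVec_volume C hC, integral_smul_measure, h1] at h2
  rw [← h2, ENNReal.toReal_ofReal (by positivity)]
  have hpi : (Real.pi : ℂ) ≠ 0 := by exact_mod_cast Real.pi_ne_zero
  rw [div_self hpi, one_cpow, one_mul, Complex.real_smul, Complex.ofReal_exp]
  congr 2
  unfold quadForm
  push_cast
  simp_rw [mul_pow, I_sq]
  rw [← Finset.mul_sum]
  field_simp
  ring

lemma exists_periodicGaussian_torus (C : Matrix d d ℝ) (hC : IsUnit C.det) :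
    ∃ f : C(UnitAddTorus d, ℂ), ∀ x : d → ℝ,
      f (fun i => (x i : UnitAddCircle)) = periodicGaussian C x := by
  let q : (d → ℝ) → UnitAddTorus d := fun x i => (x i : UnitAddCircle)
  let g : UnitAddTorus d → ℂ := fun t =>
    periodicGaussian C (fun i => (AddCircle.equivIoc 1 0 (t i)).1)
  have hg : ∀ x, g (q x) = periodicGaussian C x := by
    intro x
    have : ∀ i, ∃ n : ℤ, (AddCircle.equivIoc 1 0 (q x i)).1 = x i + n := by
      intro i
      have h1 : (((AddCircle.equivIoc 1 0 (q x i)).1 : ℝ) : UnitAddCircle) = (x i : UnitAddCircle) :=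
        (AddCircle.equivIoc 1 0).symm_apply_apply (q x i)
      rw [← sub_eq_zero, ← AddCircle.coe_sub, AddCircle.coe_eq_zero_iff] at h1
      obtain ⟨n, hn⟩ := h1
      refine ⟨n, ?_⟩
      simp only [zsmul_eq_mul, mul_one] at hn
      linarith
    choose n hn using this
    rw [← periodicGaussian_add_int C x n]
    simp only [g, hn]
  have hq : IsOpenQuotientMap q := IsOpenQuotientMap.piMap fun i =>
    QuotientAddGroup.isOpenQuotientMap_mk
  exact ⟨⟨g, (hq.isQuotientMap.continuous_iff).2 (by
    convert! continuous_periodicGaussian C hC using 1; exact funext hg)⟩, hg⟩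

lemma mFourier_coe (n : d → ℤ) (x : d → ℝ) :
    UnitAddTorus.mFourier (-n) (fun i => (x i : UnitAddCircle)) =
      cexp (-2 * Real.pi * I * ∑ i, (n i : ℝ) * x i) := by
  simp only [UnitAddTorus.mFourier, ContinuousMap.coe_mk, fourier_coe_apply, ← Complex.exp_sum]
  congr 1
  push_cast
  rw [Finset.mul_sum]
  refine Finset.sum_congr rfl fun i _ => ?_
  simp
  ring

end GaussianPoisson

section GaussianPoisson

variable {d : Type*} [Fintype d] [DecidableEq d]

/-- The half-open unit cube with corner `n`. -/
def unitCube (n : d → ℤ) : Set (d → ℝ) := {x | ∀ i, x i ∈ Set.Ioc (n i : ℝ) (n i + 1)}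

lemma measurableSet_unitCube (n : d → ℤ) : MeasurableSet (unitCube n) :=
  MeasurableSet.univ_pi' fun _ => measurableSet_Ioc

lemma mem_unitCube_iff (n : d → ℤ) (x : d → ℝ) : x ∈ unitCube n ↔ n = fun i => ⌈x i⌉ - 1 := by
  simp only [unitCube, Set.mem_ofPred_eq, Set.mem_Ioc, funext_iff]
  refine forall_congr' fun i => ?_
  rw [eq_sub_iff_add_eq, eq_comm, Int.ceil_eq_iff]
  push_cast
  simp

lemma pairwise_disjoint_unitCube : Pairwise (Function.onFun Disjoint (unitCube (d := d))) := by
  intro m n hmn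
  refine Set.disjoint_left.2 fun x hm hn => hmn ?_
  rw [mem_unitCube_iff] at hm hn
  rw [hm, hn]

lemma iUnion_unitCube : ⋃ n : d → ℤ, unitCube n = Set.univ :=
  Set.eq_univ_of_forall fun x => Set.mem_iUnion.2 ⟨_, (mem_unitCube_iff _ x).2 rfl⟩

lemma setIntegral_unitCube (h : (d → ℝ) → ℂ) (n : d → ℤ) :
    ∫ x in unitCube n, h x = ∫ x in unitCube (0 : d → ℤ), h (fun i => n i + x i) := by
  let c : d → ℝ := fun i => n i
  have h1 := (measurePreserving_add_left (volume : Measure (d → ℝ)) c).setIntegral_preimage_emb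
    (measurableEmbedding_addLeft c) h (unitCube n)
  rw [← h1]
  have h2 : (fun x => c + x) ⁻¹' unitCube n = unitCube 0 := by
    ext x
    simp only [unitCube, Set.mem_preimage, Set.mem_ofPred_eq, Set.mem_Ioc, c, Pi.add_apply]
    refine forall_congr' fun i => ?_
    simp only [Pi.zero_apply, Int.cast_zero, zero_add]
    constructor <;> rintro ⟨h3, h4⟩ <;> constructor <;> linarith
  rw [h2]
  rfl

lemma norm_le_of_mem_unitCube {x : d → ℝ} (hx : x ∈ unitCube (0 : d → ℤ)) : ‖x‖ ≤ 1 := by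
  refine (pi_norm_le_iff_of_nonneg zero_le_one).2 fun i => ?_
  have := hx i
  simp only [Pi.zero_apply, Int.cast_zero, zero_add, Set.mem_Ioc] at this
  rw [Real.norm_eq_abs, abs_le]
  constructor <;> linarith

lemma volume_unitCube_zero : volume (unitCube (0 : d → ℤ)) < ⊤ :=
  lt_of_le_of_lt (measure_mono fun _ hx => mem_closedBall_zero_iff.2 (norm_le_of_mem_unitCube hx))
    measure_closedBall_lt_top

lemma mFourierCoeff_periodicGaussian (C : Matrix d d ℝ) (hC : IsUnit C.det)
    (f : C(UnitAddTorus d, ℂ))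
    (hf : ∀ x : d → ℝ, f (fun i => (x i : UnitAddCircle)) = periodicGaussian C x) (k : d → ℤ) :
    UnitAddTorus.mFourierCoeff f k =
      (|C.det|⁻¹ : ℝ) * (Real.exp (-Real.pi * quadForm (C⁻¹).transpose fun i => k i) : ℂ) := by
  rw [← integral_exp_neg_quadForm_mul C hC]
  set h : (d → ℝ) → ℂ := fun v => cexp (-2 * Real.pi * I * ∑ i, (k i : ℝ) * v i) *
      (Real.exp (-Real.pi * quadForm C v) : ℂ) with hh
  have hint : Integrable h := integrable_exp_neg_quadForm_mul C hC fun i => k i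
  have h1 : ∫ v, h v = ∑' n : d → ℤ, ∫ v in unitCube n, h v := by
    rw [← setIntegral_univ, ← iUnion_unitCube]
    exact integral_iUnion measurableSet_unitCube pairwise_disjoint_unitCube hint.integrableOn
  change _ = ∫ v, h v
  obtain ⟨u, hu, hub⟩ := summable_exp_neg_quadForm_add C hC 1
  have hcont : Continuous h := by
    have := continuous_quadForm C
    fun_prop
  have hnorm : ∀ v, ‖h v‖ = Real.exp (-Real.pi * quadForm C v) := by
    intro v
    rw [hh]
    simp only [norm_mul, Complex.norm_real, Real.norm_eq_abs, Real.abs_exp]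
    rw [Complex.norm_exp]
    simp
  rw [h1, UnitAddTorus.mFourierCoeff_eq_integral f k 0]
  simp_rw [setIntegral_unitCube h]
  have hvol : IsFiniteMeasure (volume.restrict (unitCube (0 : d → ℤ))) :=
    ⟨by rw [Measure.restrict_apply_univ]; exact volume_unitCube_zero⟩
  have hcube : {x : d → ℝ | ∀ i, x i ∈ Set.Ioc ((0 : d → ℝ) i) ((0 : d → ℝ) i + 1)} =
      unitCube (0 : d → ℤ) := by
    ext; simp [unitCube]
  rw [hcube, integral_tsum_of_summable_integral_norm (F := fun (n : d → ℤ) (x : d → ℝ) =>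
    h fun i => n i + x i)]
  · refine setIntegral_congr_fun (measurableSet_unitCube 0) fun x _ => ?_
    beta_reduce
    rw [mFourier_coe, hf, periodicGaussian, smul_eq_mul, ← tsum_mul_left]
    refine tsum_congr fun n => ?_
    rw [hh]
    beta_reduce
    congr 1
    rw [Complex.exp_eq_exp_iff_exists_int]
    refine ⟨∑ i, k i * n i, ?_⟩
    push_cast
    simp only [mul_add, Finset.sum_add_distrib]
    ring
  · intro n
    refine Integrable.mono' (integrable_const (u n))
      (hcont.comp (by fun_prop)).aestronglyMeasurable ?_
    refine (ae_restrict_iff' (measurableSet_unitCube 0)).2 (Eventually.of_forall fun x hx => ?_)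
    rw [hnorm]
    exact hub n x (norm_le_of_mem_unitCube hx)
  · refine Summable.of_nonneg_of_le (fun n => integral_nonneg fun _ => norm_nonneg _) (fun n => ?_)
      (hu.mul_left (volume.real (unitCube (0 : d → ℤ))))
    have := norm_setIntegral_le_of_norm_le_const (f := fun x => ‖h fun i => (n i : ℝ) + x i‖)
      volume_unitCube_zero (C := u n) fun x hx => by
        rw [norm_norm, hnorm]; exact hub n x (norm_le_of_mem_unitCube hx)
    rw [mul_comm]
    exact (le_abs_self _).trans this

/-- Poisson summation for Gaussians on `ℤ^d`. -/
theorem tsum_exp_neg_quadForm (C : Matrix d d ℝ) (hC : IsUnit C.det) :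
    ∑' m : d → ℤ, Real.exp (-Real.pi * quadForm C (fun i => (m i : ℝ))) =
      |C.det|⁻¹ * ∑' k : d → ℤ, Real.exp (-Real.pi * quadForm (C⁻¹).transpose (fun i => (k i : ℝ))) := by
  obtain ⟨f, hf⟩ := exists_periodicGaussian_torus C hC
  have hC' : IsUnit (C⁻¹).transpose.det := by
    rw [Matrix.det_transpose]; exact Matrix.isUnit_nonsing_inv_det C hC
  have hs := summable_exp_neg_quadForm _ hC'
  have hcoef : UnitAddTorus.mFourierCoeff f = fun k : d → ℤ =>
      (((|C.det|⁻¹ : ℝ) * Real.exp (-Real.pi * quadForm (C⁻¹).transpose fun i => k i) : ℝ) : ℂ) := by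
    funext k
    rw [mFourierCoeff_periodicGaussian C hC f hf]
    push_cast
    rfl
  have hsum : Summable (UnitAddTorus.mFourierCoeff f) := by
    rw [hcoef]
    exact Complex.summable_ofReal.2 (hs.mul_left _)
  have h0 := (UnitAddTorus.hasSum_mFourier_series_apply_of_summable hsum
    (fun i => ((0 : ℝ) : UnitAddCircle))).tsum_eq
  have h1 := hf 0
  simp only [Pi.zero_apply] at h1
  rw [h1, hcoef] at h0
  have h2 : ∀ k : d → ℤ, UnitAddTorus.mFourier k (fun i => ((0 : ℝ) : UnitAddCircle)) = 1 := by
    intro k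
    simp [UnitAddTorus.mFourier]
  simp only [h2, smul_eq_mul, mul_one] at h0
  rw [periodicGaussian, ← Complex.ofReal_tsum, ← Complex.ofReal_tsum, Complex.ofReal_inj,
    tsum_mul_left] at h0
  simpa using h0.symm

end GaussianPoisson

section Theta

variable {K : Type} [Field K] [NumberField K]

open NumberField.mixedEmbedding in
/-- The place underlying a standard real coordinate of the mixed space. -/
def indexPlace : index K → InfinitePlace K
  | .inl w => w.1
  | .inr (w, _) => w.1

open NumberField.mixedEmbedding in
/-- The sign of a standard real coordinate in the trace form. -/
def indexSign : index K → ℝ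
  | .inl _ => 1
  | .inr (_, j) => if j = 0 then 1 else -1

open NumberField.mixedEmbedding in
/-- The standard real coordinates of an element of a number field. -/
def realCoord (j : index K) (α : K) : ℝ := (stdBasis K).repr (mixedEmbedding K α) j

open NumberField.mixedEmbedding in
lemma realCoord_sum_smul (j : index K) {ι : Type*} [Fintype ι] (c : ι → ℚ) (b : ι → K) :
    realCoord j (∑ i, c i • b i) = ∑ i, (c i : ℝ) * realCoord j (b i) := by
  have h : ∀ (q : ℚ) (α : K), mixedEmbedding K (q • α) = (q : ℝ) • mixedEmbedding K α := by
    intro q α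
    rw [Algebra.smul_def, map_mul]
    ext w <;> simp
  simp [realCoord, h]

open NumberField.mixedEmbedding in
lemma sum_index {M : Type*} [AddCommMonoid M] (F : index K → M) :
    ∑ j, F j = ∑ w : {w : InfinitePlace K // w.IsReal}, F (.inl w) +
      ∑ w : {w : InfinitePlace K // w.IsComplex}, (F (.inr (w, 0)) + F (.inr (w, 1))) := by
  rw [Fintype.sum_sum_type, Fintype.sum_prod_type]
  simp

open NumberField.mixedEmbedding in
lemma prod_index {M : Type*} [CommMonoid M] (F : index K → M) :
    ∏ j, F j = (∏ w : {w : InfinitePlace K // w.IsReal}, F (.inl w)) *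
      ∏ w : {w : InfinitePlace K // w.IsComplex}, (F (.inr (w, 0)) * F (.inr (w, 1))) := by
  rw [Fintype.prod_sum_type, Fintype.prod_prod_type]
  simp

/-- The Hermitian form `∑ y_w [K_w : ℝ] |α|_w²`. -/
def placeForm (y : InfinitePlace K → ℝ) (α : K) : ℝ := ∑ w, w.mult * y w * w α ^ 2

open NumberField.mixedEmbedding in
lemma placeForm_eq (y : InfinitePlace K → ℝ) (α : K) :
    placeForm y α = ∑ j : index K, (indexPlace j).mult * y (indexPlace j) * realCoord j α ^ 2 := by
  rw [placeForm, InfinitePlace.sum_eq_sum_add_sum, sum_index]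
  congr 1
  · refine Finset.sum_congr rfl fun w _ => ?_
    congr 1
    rw [← normAtPlace_apply, normAtPlace_apply_of_isReal w.2]
    simp [realCoord, indexPlace]
  · refine Finset.sum_congr rfl fun w _ => ?_
    rw [← normAtPlace_apply, normAtPlace_apply_of_isComplex w.2, Complex.sq_norm,
      Complex.normSq_apply]
    simp [realCoord, indexPlace]
    ring

open NumberField.mixedEmbedding in
lemma trace_mul_eq_sum_index (α β : K) :
    ((Algebra.trace ℚ K (α * β) : ℚ) : ℝ) =
      ∑ j : index K, indexSign j * (indexPlace j).mult * (realCoord j α * realCoord j β) := by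
  have h := trace_eq_sum_embeddings (K := ℚ) (L := K) ℂ (x := α * β)
  have h2 : ∑ σ : K →ₐ[ℚ] ℂ, σ (α * β) = ∑ σ : K →+* ℂ, σ (α * β) :=
    Fintype.sum_equiv (RingHom.equivRatAlgHom K ℂ).symm _ _ fun σ => rfl
  rw [h2, ← (indexEquiv K).sum_comp, sum_index] at h
  apply Complex.ofReal_injective
  rw [sum_index]
  have h3 : (((Algebra.trace ℚ K (α * β) : ℚ) : ℝ) : ℂ) =
    algebraMap ℚ ℂ (Algebra.trace ℚ K (α * β)) := by simp
  rw [h3, h, Complex.ofReal_add, Complex.ofReal_sum, Complex.ofReal_sum]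
  congr 1
  · refine Finset.sum_congr rfl fun w _ => ?_
    have := InfinitePlace.embedding_of_isReal_apply w.2
    simp [realCoord, indexPlace, indexSign, InfinitePlace.embedding_of_isReal_apply]
  · refine Finset.sum_congr rfl fun w _ => ?_
    simp [realCoord, indexPlace, indexSign, w.2.mult_eq_two]
    apply Complex.ext <;> simp <;> ring

end Theta

section Theta

variable {K : Type} [Field K] [NumberField K]

open NumberField.mixedEmbedding
open scoped nonZeroDivisors

/-- The matrix of the form `placeForm y` in a rational basis, as a sum of squares. -/
def placeMatrix (b : Module.Basis (index K) ℚ K) (y : InfinitePlace K → ℝ) :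
    Matrix (index K) (index K) ℝ :=
  fun j i => Real.sqrt ((indexPlace j).mult * y (indexPlace j)) * realCoord j (b i)

lemma quadForm_placeMatrix (b : Module.Basis (index K) ℚ K) {y : InfinitePlace K → ℝ}
    (hy : ∀ w, 0 < y w) (m : index K → ℤ) :
    quadForm (placeMatrix b y) (fun i => (m i : ℝ)) = placeForm y (∑ i, (m i : ℚ) • b i) := by
  rw [placeForm_eq, quadForm]
  refine Finset.sum_congr rfl fun j _ => ?_
  rw [realCoord_sum_smul]
  have : (placeMatrix b y).mulVec (fun i => (m i : ℝ)) j =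
      Real.sqrt ((indexPlace j).mult * y (indexPlace j)) *
        ∑ i, ((m i : ℚ) : ℝ) * realCoord j (b i) := by
    simp only [Matrix.mulVec, dotProduct, placeMatrix, Finset.mul_sum]
    refine Finset.sum_congr rfl fun i _ => ?_
    push_cast
    ring
  rw [this, mul_pow, Real.sq_sqrt (mul_nonneg (by positivity) (hy _).le)]

lemma placeMatrix_traceDual (b : Module.Basis (index K) ℚ K) {y : InfinitePlace K → ℝ}
    (hy : ∀ w, 0 < y w) :
    (placeMatrix b.traceDual y⁻¹).transpose * Matrix.diagonal indexSign * placeMatrix b y = 1 := by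
  ext i k
  rw [Matrix.mul_apply]
  simp only [Matrix.mul_diagonal, Matrix.transpose_apply, placeMatrix, Pi.inv_apply]
  have h := trace_mul_eq_sum_index (b.traceDual i) (b k)
  rw [b.trace_traceDual_mul] at h
  have h1 : (1 : Matrix (index K) (index K) ℝ) i k = (((if k = i then 1 else 0 : ℚ)) : ℝ) := by
    rw [Matrix.one_apply]
    simp only [eq_comm]
    split_ifs <;> simp
  rw [h1, h]
  refine Finset.sum_congr rfl fun j _ => ?_
  have hp := hy (indexPlace j)
  have hs : Real.sqrt ((indexPlace j).mult * (y (indexPlace j))⁻¹) *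
      Real.sqrt ((indexPlace j).mult * y (indexPlace j)) = (indexPlace j).mult := by
    rw [← Real.sqrt_mul (by positivity)]
    rw [show ((indexPlace j).mult * (y (indexPlace j))⁻¹ * ((indexPlace j).mult *
      y (indexPlace j)) : ℝ) = ((indexPlace j).mult : ℝ) ^ 2 by field_simp]
    exact Real.sqrt_sq (by positivity)
  calc _ = indexSign j * (Real.sqrt ((indexPlace j).mult * (y (indexPlace j))⁻¹) *
      Real.sqrt ((indexPlace j).mult * y (indexPlace j))) *
      (realCoord j (b.traceDual i) * realCoord j (b k)) := by ring
    _ = _ := by rw [hs]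

lemma isUnit_det_placeMatrix (b : Module.Basis (index K) ℚ K) {y : InfinitePlace K → ℝ}
    (hy : ∀ w, 0 < y w) : IsUnit (placeMatrix b y).det :=
  Matrix.isUnit_det_of_left_inverse (placeMatrix_traceDual b hy)

lemma quadForm_placeMatrix_inv (b : Module.Basis (index K) ℚ K) {y : InfinitePlace K → ℝ}
    (hy : ∀ w, 0 < y w) (x : index K → ℝ) :
    quadForm ((placeMatrix b y)⁻¹).transpose x = quadForm (placeMatrix b.traceDual y⁻¹) x := by
  rw [Matrix.inv_eq_left_inv (placeMatrix_traceDual b hy), Matrix.transpose_mul,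
    Matrix.diagonal_transpose, Matrix.transpose_transpose]
  simp only [quadForm, ← Matrix.mulVec_mulVec, Matrix.mulVec_diagonal, mul_pow]
  refine Finset.sum_congr rfl fun j _ => ?_
  have : indexSign j ^ 2 = 1 := by
    rcases j with w | ⟨w, j⟩
    · simp [indexSign]
    · simp only [indexSign]; split_ifs <;> norm_num
  rw [this, one_mul]

lemma abs_det_placeMatrix (b : Module.Basis (index K) ℚ K) {y : InfinitePlace K → ℝ}
    (hy : ∀ w, 0 < y w) :
    |(placeMatrix b y).det| = |(placeMatrix b 1).det| * ∏ w, Real.sqrt (y w) ^ w.mult := by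
  have h : placeMatrix b y = Matrix.diagonal (fun j : index K => Real.sqrt (y (indexPlace j))) *
      placeMatrix b 1 := by
    ext j i
    rw [Matrix.diagonal_mul]
    simp only [placeMatrix, Pi.one_apply, mul_one]
    rw [Real.sqrt_mul (by positivity)]
    ring
  have h2 : ∏ j : index K, Real.sqrt (y (indexPlace j)) = ∏ w, Real.sqrt (y w) ^ w.mult := by
    rw [InfinitePlace.prod_eq_prod_mul_prod, prod_index]
    congr 1
    · exact Finset.prod_congr rfl fun w _ => by simp [indexPlace]
    · exact Finset.prod_congr rfl fun w _ => by
        simp [indexPlace]; rw [Real.mul_self_sqrt (hy _).le, Real.sq_sqrt (hy _).le]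
  have h3 : 0 < ∏ w, Real.sqrt (y w) ^ w.mult :=
    Finset.prod_pos fun w _ => pow_pos (Real.sqrt_pos.2 (hy w)) _
  rw [h, Matrix.det_mul, Matrix.det_diagonal, h2, abs_mul, mul_comm, abs_of_pos h3]

lemma placeMatrix_eq_mul (b b' : Module.Basis (index K) ℚ K) (y : InfinitePlace K → ℝ) :
    placeMatrix b' y = placeMatrix b y * (b.toMatrix b').map (fun q : ℚ => (q : ℝ)) := by
  ext j i
  rw [Matrix.mul_apply]
  simp only [placeMatrix, Matrix.map_apply]
  have : b' i = ∑ k, b.toMatrix b' k i • b k := by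
    simp only [Module.Basis.toMatrix_apply]; exact (b.sum_repr (b' i)).symm
  conv_lhs => rw [this, realCoord_sum_smul, Finset.mul_sum]
  exact Finset.sum_congr rfl fun k _ => by ring

lemma abs_det_placeMatrix_eq_mul (b b' : Module.Basis (index K) ℚ K) (y : InfinitePlace K → ℝ) :
    |(placeMatrix b' y).det| = |(placeMatrix b y).det| * ((|b.det b'| : ℚ) : ℝ) := by
  rw [placeMatrix_eq_mul b b', Matrix.det_mul, abs_mul, Module.Basis.det_apply]
  congr 1
  rw [Rat.cast_abs]
  congr 1
  exact (RingHom.map_det (Rat.castHom ℝ) (b.toMatrix b')).symm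

/-- A rational basis of the field spans a fractional ideal over the integers. -/
def IsIntegralBasis (b : Module.Basis (index K) ℚ K) (I : FractionalIdeal (𝓞 K)⁰ K) : Prop :=
  (I : Submodule (𝓞 K) K).restrictScalars ℤ = Submodule.span ℤ (Set.range b)

/-- The theta series of a fractional ideal. -/
def idealTheta (I : FractionalIdeal (𝓞 K)⁰ K) (y : InfinitePlace K → ℝ) : ℝ :=
  ∑' α : (I : Submodule (𝓞 K) K), Real.exp (-Real.pi * placeForm y α)

/-- The coordinates of a fractional ideal in an integral basis. -/
def IsIntegralBasis.equiv {b : Module.Basis (index K) ℚ K} {I : FractionalIdeal (𝓞 K)⁰ K}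
    (h : IsIntegralBasis b I) : (index K → ℤ) ≃ (I : Submodule (𝓞 K) K) :=
  (b.restrictScalars ℤ).equivFun.symm.toEquiv.trans
    (Equiv.subtypeEquivRight fun x => by
      rw [← h]; rfl)

lemma IsIntegralBasis.equiv_apply {b : Module.Basis (index K) ℚ K}
    {I : FractionalIdeal (𝓞 K)⁰ K} (h : IsIntegralBasis b I) (m : index K → ℤ) :
    (h.equiv m : K) = ∑ i, (m i : ℚ) • b i := by
  simp only [IsIntegralBasis.equiv, Equiv.trans_apply, Equiv.subtypeEquivRight_apply_coe]
  change (((b.restrictScalars ℤ).equivFun.symm m : Submodule.span ℤ (Set.range b)) : K) = _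
  rw [Module.Basis.equivFun_symm_apply, Submodule.coe_sum]
  refine Finset.sum_congr rfl fun i _ => ?_
  rw [Submodule.coe_smul, Module.Basis.restrictScalars_apply, Algebra.smul_def, Algebra.smul_def]
  simp

lemma IsIntegralBasis.summable {b : Module.Basis (index K) ℚ K}
    {I : FractionalIdeal (𝓞 K)⁰ K} (h : IsIntegralBasis b I) {y : InfinitePlace K → ℝ}
    (hy : ∀ w, 0 < y w) :
    Summable fun α : (I : Submodule (𝓞 K) K) => Real.exp (-Real.pi * placeForm y α) := by
  rw [← h.equiv.summable_iff]
  refine (summable_exp_neg_quadForm _ (isUnit_det_placeMatrix b hy)).congr fun m => ?_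
  rw [Function.comp_apply, h.equiv_apply, quadForm_placeMatrix b hy]

lemma IsIntegralBasis.idealTheta_eq {b : Module.Basis (index K) ℚ K}
    {I : FractionalIdeal (𝓞 K)⁰ K} (h : IsIntegralBasis b I) {y : InfinitePlace K → ℝ}
    (hy : ∀ w, 0 < y w) :
    idealTheta I y =
      ∑' m : index K → ℤ, Real.exp (-Real.pi * quadForm (placeMatrix b y) fun i => (m i : ℝ)) := by
  rw [idealTheta, ← h.equiv.tsum_eq]
  refine tsum_congr fun m => ?_
  rw [h.equiv_apply, quadForm_placeMatrix b hy]

lemma IsIntegralBasis.traceDual {b : Module.Basis (index K) ℚ K}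
    {I : FractionalIdeal (𝓞 K)⁰ K} (h : IsIntegralBasis b I) (hI : I ≠ 0) :
    IsIntegralBasis b.traceDual (FractionalIdeal.dual ℤ ℚ I) := by
  rw [IsIntegralBasis, FractionalIdeal.coe_dual ℤ ℚ hI]
  exact Submodule.traceDual_span_of_basis ℤ _ b h

lemma IsIntegralBasis.idealTheta_dual {b : Module.Basis (index K) ℚ K}
    {I : FractionalIdeal (𝓞 K)⁰ K} (h : IsIntegralBasis b I) (hI : I ≠ 0)
    {y : InfinitePlace K → ℝ} (hy : ∀ w, 0 < y w) :
    idealTheta I y = (|(placeMatrix b 1).det| * ∏ w, Real.sqrt (y w) ^ w.mult)⁻¹ *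
      idealTheta (FractionalIdeal.dual ℤ ℚ I) y⁻¹ := by
  have hy' : ∀ w, 0 < y⁻¹ w := fun w => inv_pos.2 (hy w)
  have h1 := tsum_exp_neg_quadForm _ (isUnit_det_placeMatrix b hy)
  have h2 : ∀ x : index K → ℝ, quadForm ((placeMatrix b y)⁻¹).transpose x =
      quadForm (placeMatrix b.traceDual y⁻¹) x := quadForm_placeMatrix_inv b hy
  simp only [h2] at h1
  rw [h.idealTheta_eq hy, (h.traceDual hI).idealTheta_eq hy', h1, abs_det_placeMatrix b hy]

end Theta

section Theta

variable {K : Type} [Field K] [NumberField K]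

open NumberField.mixedEmbedding
open scoped nonZeroDivisors

/-- The integral basis indexed by the real coordinates. -/
def coordEquiv (K : Type) [Field K] [NumberField K] :
    Module.Free.ChooseBasisIndex ℤ (𝓞 K) ≃ index K :=
  Fintype.equivOfCardEq (by
    rw [← Module.finrank_eq_card_chooseBasisIndex, RingOfIntegers.rank,
      ← Module.finrank_eq_card_basis (stdBasis K), mixedEmbedding.finrank])

/-- The covolume of the ring of integers with respect to `placeForm 1`. -/
def thetaCovolume (K : Type) [Field K] [NumberField K] : ℝ :=
  |(placeMatrix ((integralBasis K).reindex (coordEquiv K)) 1).det|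

lemma thetaCovolume_pos : 0 < thetaCovolume K :=
  abs_pos.2 (isUnit_det_placeMatrix _ fun _ => one_pos).ne_zero

lemma exists_isIntegralBasis (I : (FractionalIdeal (𝓞 K)⁰ K)ˣ) :
    ∃ b : Module.Basis (index K) ℚ K, IsIntegralBasis b I ∧
      |(placeMatrix b 1).det| = thetaCovolume K * (FractionalIdeal.absNorm I.1 : ℝ) := by
  have e : Module.Free.ChooseBasisIndex ℤ (𝓞 K) ≃ Module.Free.ChooseBasisIndex ℤ I :=
    Fintype.equivOfCardEq (by
      rw [← Module.finrank_eq_card_chooseBasisIndex, ← Module.finrank_eq_card_chooseBasisIndex,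
        fractionalIdeal_rank])
  refine ⟨((basisOfFractionalIdeal K I).reindex e.symm).reindex (coordEquiv K), ?_, ?_⟩
  · rw [IsIntegralBasis, Module.Basis.range_reindex, Module.Basis.range_reindex]
    ext x
    exact (mem_span_basisOfFractionalIdeal K).symm
  · rw [abs_det_placeMatrix_eq_mul ((integralBasis K).reindex (coordEquiv K)), thetaCovolume]
    congr 2
    rw [← det_basisOfFractionalIdeal_eq_absNorm K I e]
    congr 1
    rw [Module.Basis.det_reindex]
    congr 1
    ext i
    simp

lemma summable_idealTheta (I : (FractionalIdeal (𝓞 K)⁰ K)ˣ) {y : InfinitePlace K → ℝ}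
    (hy : ∀ w, 0 < y w) :
    Summable fun α : (I.1 : Submodule (𝓞 K) K) => Real.exp (-Real.pi * placeForm y α) := by
  obtain ⟨b, hb, -⟩ := exists_isIntegralBasis I
  exact hb.summable hy

/-- The dual fractional ideal for the trace form, as a unit. -/
def dualIdeal (I : (FractionalIdeal (𝓞 K)⁰ K)ˣ) : (FractionalIdeal (𝓞 K)⁰ K)ˣ :=
  Units.mk0 (FractionalIdeal.dual ℤ ℚ I.1) (FractionalIdeal.dual_ne_zero ℤ ℚ I.ne_zero)

theorem idealTheta_functional (I : (FractionalIdeal (𝓞 K)⁰ K)ˣ) {y : InfinitePlace K → ℝ}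
    (hy : ∀ w, 0 < y w) :
    idealTheta I.1 y = (thetaCovolume K * FractionalIdeal.absNorm I.1 *
      ∏ w, Real.sqrt (y w) ^ w.mult)⁻¹ * idealTheta (dualIdeal I).1 y⁻¹ := by
  obtain ⟨b, hb, h⟩ := exists_isIntegralBasis I
  rw [hb.idealTheta_dual I.ne_zero hy, h]
  rfl

lemma one_le_idealTheta (I : (FractionalIdeal (𝓞 K)⁰ K)ˣ) {y : InfinitePlace K → ℝ}
    (hy : ∀ w, 0 < y w) : 1 ≤ idealTheta I.1 y := by
  have := (summable_idealTheta I hy).le_tsum 0 fun α _ => (Real.exp_pos _).le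
  simpa [placeForm, idealTheta] using this

lemma thetaCovolume_dual (I : (FractionalIdeal (𝓞 K)⁰ K)ˣ) :
    thetaCovolume K * (FractionalIdeal.absNorm I.1 : ℝ) *
      (thetaCovolume K * (FractionalIdeal.absNorm (dualIdeal I).1 : ℝ)) = 1 := by
  have h1 := idealTheta_functional I (y := 1) fun _ => one_pos
  have h2 := idealTheta_functional (dualIdeal I) (y := 1) fun _ => one_pos
  have h3 : dualIdeal (dualIdeal I) = I := Units.ext (FractionalIdeal.dual_dual ℤ ℚ I.1)
  simp only [Pi.one_apply, Real.sqrt_one, one_pow, Finset.prod_const_one, mul_one, inv_one, h3]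
    at h1 h2
  have h4 := one_le_idealTheta I (y := 1) fun _ => one_pos
  rw [h2, ← mul_assoc] at h1
  have h5 := mul_right_cancel₀ (by positivity : idealTheta I.1 1 ≠ 0)
    ((one_mul _).trans h1)
  rw [← mul_inv] at h5
  exact (inv_eq_one.1 h5.symm)

lemma absNorm_unit_pos (I : (FractionalIdeal (𝓞 K)⁰ K)ˣ) :
    0 < (FractionalIdeal.absNorm I.1 : ℝ) := by
  have h : FractionalIdeal.absNorm I.1 ≠ 0 := by
    rw [Ne, FractionalIdeal.absNorm_eq_zero_iff]; exact I.ne_zero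
  exact_mod_cast lt_of_le_of_ne (FractionalIdeal.absNorm_nonneg _) h.symm

end Theta

section Units

variable {K : Type} [Field K] [NumberField K]

open NumberField.Units NumberField.Units.dirichletUnitTheorem
open scoped ENNReal

/-- A fundamental domain for the logarithmic unit lattice. -/
def unitDomain (K : Type) [Field K] [NumberField K] : Set (logSpace K) :=
  ZSpan.fundamentalDomain ((basisUnitLattice K).ofZLatticeBasis ℝ (unitLattice K))

lemma isAddFundamentalDomain_unitDomain :
    IsAddFundamentalDomain (unitLattice K) (unitDomain K) volume :=
  ZLattice.isAddFundamentalDomain (basisUnitLattice K) volume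

lemma volume_unitDomain_ne_top : volume (unitDomain K) ≠ ∞ :=
  (ZSpan.fundamentalDomain_isBounded _).measure_lt_top.ne

/-- The logarithmic embedding of the units, with values in the unit lattice. -/
def unitLog (u : (𝓞 K)ˣ) : unitLattice K :=
  ⟨logEmbedding K (Additive.ofMul u), ⟨Additive.ofMul u, trivial, rfl⟩⟩

lemma unitLog_mul (u v : (𝓞 K)ˣ) : unitLog (u * v) = unitLog u + unitLog v :=
  Subtype.ext (map_add (logEmbedding K) (Additive.ofMul u) (Additive.ofMul v))

lemma unitLog_surjective : Function.Surjective (unitLog (K := K)) := by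
  rintro ⟨_, ⟨u, -, rfl⟩⟩
  exact ⟨u.toMul, rfl⟩

lemma enatCard_unitLog_fiber (l : unitLattice K) :
    ENat.card {u : (𝓞 K)ˣ // unitLog u = l} = torsionOrder K := by
  obtain ⟨v, hv⟩ := unitLog_surjective l
  have e : {u : (𝓞 K)ˣ // unitLog u = l} ≃ torsion K :=
    (Equiv.mulRight v⁻¹).subtypeEquiv fun u => by
      have h0 : ∀ x : (𝓞 K)ˣ, x ∈ torsion K ↔ unitLog x = 0 := fun x => by
        rw [← logEmbedding_eq_zero_iff, ← Subtype.coe_inj]; rfl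
      rw [h0]
      have h1 : unitLog (u * v⁻¹) + unitLog v = unitLog u := by
        rw [← unitLog_mul]; simp
      rw [← h1, hv]
      simp
  rw [ENat.card_congr e, ENat.card_eq_coe_natCard, torsionOrder]

lemma tsum_unitLog (g : logSpace K → ℝ≥0∞) :
    ∑' u : (𝓞 K)ˣ, g (unitLog u : logSpace K) =
      torsionOrder K * ∑' l : unitLattice K, g l := by
  rw [← (Equiv.sigmaFiberEquiv (unitLog (K := K))).tsum_eq, ENNReal.tsum_sigma',
    ← ENNReal.tsum_mul_left]
  refine tsum_congr fun l => ?_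
  rw [← ENat.toENNReal_coe, ← enatCard_unitLog_fiber l, ← ENNReal.tsum_const]
  refine tsum_congr fun u => ?_
  simp only [Equiv.sigmaFiberEquiv_apply, u.2]

lemma lintegral_unitDomain (g : logSpace K → ℝ≥0∞) (hg : Measurable g) :
    ∫⁻ x in unitDomain K, ∑' u : (𝓞 K)ˣ, g (x + (unitLog u : logSpace K)) =
      torsionOrder K * ∫⁻ x, g x := by
  simp_rw [fun x => tsum_unitLog fun l => g (x + l)]
  have : VAddInvariantMeasure (unitLattice K) (logSpace K) volume :=
    inferInstanceAs <| VAddInvariantMeasure (unitLattice K).toAddSubgroup (logSpace K) volume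
  rw [lintegral_const_mul _ (by fun_prop),
    isAddFundamentalDomain_unitDomain.lintegral_eq_tsum'' (fun x => g x),
    lintegral_tsum (fun l => by fun_prop)]
  congr 1
  refine tsum_congr fun l => lintegral_congr fun x => ?_
  rw [add_comm]
  rfl

lemma lintegral_unitDomain_neg (g : logSpace K → ℝ≥0∞) (hg : Measurable g) :
    ∫⁻ x in unitDomain K, ∑' u : (𝓞 K)ˣ, g (-x + (unitLog u : logSpace K)) =
      torsionOrder K * ∫⁻ x, g x := by
  rw [← lintegral_neg_eq_self (fun x => g x), ← lintegral_unitDomain (fun x => g (-x)) (by fun_prop)]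
  refine lintegral_congr fun x => ?_
  rw [← (Equiv.inv (𝓞 K)ˣ).tsum_eq]
  refine tsum_congr fun u => ?_
  have : unitLog u⁻¹ = -unitLog u := by
    rw [eq_neg_iff_add_eq_zero, ← unitLog_mul, inv_mul_cancel]
    exact Subtype.ext (map_zero (logEmbedding K))
  simp [this, add_comm]

/-- The logarithmic coordinate of the trace-zero hyperplane at an arbitrary place. -/
def logCoord (x : logSpace K) (w : InfinitePlace K) : ℝ :=
  if h : w = w₀ then -∑ v, x v else x ⟨w, h⟩

lemma logCoord_add (x y : logSpace K) (w : InfinitePlace K) :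
    logCoord (x + y) w = logCoord x w + logCoord y w := by
  unfold logCoord
  split_ifs
  · simp [Finset.sum_add_distrib, add_comm]
  · rfl

lemma logCoord_neg (x : logSpace K) (w : InfinitePlace K) :
    logCoord (-x) w = -logCoord x w := by
  unfold logCoord
  split_ifs <;> simp

lemma sum_eq_add_sum_ne {M : Type*} [AddCommMonoid M] (f : InfinitePlace K → M) :
    ∑ w, f w = f w₀ + ∑ w : {w : InfinitePlace K // w ≠ w₀}, f w := by
  rw [← Finset.add_sum_erase _ _ (Finset.mem_univ w₀)]
  congr 1
  exact Finset.sum_subtype _ (by simp) f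

lemma sum_logCoord (x : logSpace K) : ∑ w, logCoord x w = 0 := by
  have h : ∀ w : {w : InfinitePlace K // w ≠ w₀}, logCoord x w = x w := fun w => by
    rw [logCoord, dif_neg w.2]
  rw [sum_eq_add_sum_ne, Finset.sum_congr rfl fun w _ => h w, logCoord, dif_pos rfl]
  ring

lemma logCoord_restrict (f : InfinitePlace K → ℝ) (hf : ∑ w, f w = 0) (w : InfinitePlace K) :
    logCoord (fun v : {w : InfinitePlace K // w ≠ w₀} => f v) w = f w := by
  unfold logCoord
  split_ifs with h
  · rw [sum_eq_add_sum_ne] at hf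
    rw [h]
    linarith
  · rfl

/-- The point of norm one with given logarithmic coordinates. -/
def logTorus (x : logSpace K) (w : InfinitePlace K) : ℝ := Real.exp (2 * logCoord x w / w.mult)

lemma logTorus_pos (x : logSpace K) (w : InfinitePlace K) : 0 < logTorus x w := Real.exp_pos _

lemma logTorus_add (x y : logSpace K) (w : InfinitePlace K) :
    logTorus (x + y) w = logTorus x w * logTorus y w := by
  rw [logTorus, logTorus, logTorus, logCoord_add, ← Real.exp_add]
  ring_nf

lemma logTorus_neg (x : logSpace K) : logTorus (-x) = (logTorus x)⁻¹ := by
  ext w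
  rw [Pi.inv_apply, logTorus, logTorus, logCoord_neg, ← Real.exp_neg]
  ring_nf

@[fun_prop]
lemma continuous_logTorus (w : InfinitePlace K) : Continuous fun x => logTorus x w := by
  unfold logTorus logCoord
  split_ifs <;> fun_prop

lemma prod_sqrt_logTorus (x : logSpace K) : ∏ w, Real.sqrt (logTorus x w) ^ w.mult = 1 := by
  have h : ∀ w : InfinitePlace K, Real.sqrt (logTorus x w) ^ w.mult = Real.exp (logCoord x w) := by
    intro w
    have := w.mult_pos
    rw [logTorus, ← Real.exp_half, ← Real.exp_nat_mul]
    congr 1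
    field_simp
  rw [Finset.prod_congr rfl fun w _ => h w, ← Real.exp_sum, sum_logCoord, Real.exp_zero]

lemma finrank_le_sum_logTorus (x : logSpace K) :
    (Module.finrank ℚ K : ℝ) ≤ ∑ w : InfinitePlace K, w.mult * logTorus x w := by
  have h : ∀ w : InfinitePlace K, (w.mult : ℝ) + 2 * logCoord x w ≤ w.mult * logTorus x w := by
    intro w
    have hw : (0 : ℝ) < w.mult := by exact_mod_cast w.mult_pos
    have := Real.add_one_le_exp (2 * logCoord x w / w.mult)
    rw [logTorus]
    calc _ = w.mult * (2 * logCoord x w / w.mult + 1) := by field_simp; ring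
      _ ≤ _ := by gcongr
  calc (Module.finrank ℚ K : ℝ) = ∑ w : InfinitePlace K, ((w.mult : ℝ) + 2 * logCoord x w) := by
        rw [Finset.sum_add_distrib, ← Finset.mul_sum, sum_logCoord, mul_zero, add_zero,
          ← InfinitePlace.sum_mult_eq, Nat.cast_sum]
    _ ≤ _ := Finset.sum_le_sum fun w _ => h w

lemma exists_logTorus {α : K} (hα : α ≠ 0) : ∃ x : logSpace K, ∀ w : InfinitePlace K,
    w α ^ 2 = (|Algebra.norm ℚ α| : ℝ) ^ (2 / Module.finrank ℚ K : ℝ) * logTorus x w := by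
  set n : ℝ := (Module.finrank ℚ K : ℝ) with hn
  have hn0 : 0 < n := by rw [hn]; exact_mod_cast Module.finrank_pos
  have hN : 0 < (|Algebra.norm ℚ α| : ℝ) := by
    have : Algebra.norm ℚ α ≠ 0 := Algebra.norm_ne_zero_iff.2 hα
    exact_mod_cast abs_pos.2 this
  have hpos : ∀ w : InfinitePlace K, 0 < w α := fun w => w.pos_iff.2 hα
  set L := Real.log |(Algebra.norm ℚ α : ℝ)| with hL
  have hsum : ∑ w : InfinitePlace K, (w.mult * Real.log (w α) - w.mult / n * L) = 0 := by
    rw [Finset.sum_sub_distrib, ← Finset.sum_mul, ← Finset.sum_div, ← Nat.cast_sum,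
      InfinitePlace.sum_mult_eq, ← hn, div_self hn0.ne', one_mul, hL]
    have h1 : |(Algebra.norm ℚ α : ℝ)| = ((|Algebra.norm ℚ α| : ℚ) : ℝ) := by push_cast; rfl
    rw [h1, ← InfinitePlace.prod_eq_abs_norm, Real.log_prod (fun w _ => (pow_pos (hpos w) _).ne')]
    simp
  refine ⟨fun v => v.1.mult * Real.log (v.1 α) - v.1.mult / n * L, fun w => ?_⟩
  have hw : (0 : ℝ) < w.mult := by exact_mod_cast w.mult_pos
  rw [logTorus, logCoord_restrict (fun w => w.mult * Real.log (w α) - w.mult / n * L) hsum,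
    Real.rpow_def_of_pos hN, ← hL, ← Real.exp_add, ← Real.exp_log (hpos w), ← Real.exp_nat_mul,
    Real.log_exp]
  congr 1
  push_cast
  field_simp
  ring

lemma logTorus_unitLog (u : (𝓞 K)ˣ) (w : InfinitePlace K) :
    logTorus (unitLog u : logSpace K) w = w (u : K) ^ 2 := by
  have hw : (0 : ℝ) < w.mult := by exact_mod_cast w.mult_pos
  have hpos : 0 < w (u : K) := w.pos_iff.2 (Units.coe_ne_zero u)
  have h := logCoord_restrict (fun w : InfinitePlace K => w.mult * Real.log (w (u : K)))
    (sum_mult_mul_log u) w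
  have h' : logCoord (unitLog u : logSpace K) w = w.mult * Real.log (w (u : K)) := h
  rw [logTorus, h', show 2 * (w.mult * Real.log (w (u : K))) / w.mult =
    ((2 : ℕ) : ℝ) * Real.log (w (u : K)) by push_cast; field_simp, Real.exp_nat_mul,
    Real.exp_log hpos]

end Units

section IdealSums

variable {K : Type} [Field K] [NumberField K]

open FractionalIdeal
open scoped ENNReal nonZeroDivisors

lemma mk0_mul_mk_eq_one_iff (𝔞 : (Ideal (𝓞 K))⁰) (I : (FractionalIdeal (𝓞 K)⁰ K)ˣ) :
    ClassGroup.mk0 𝔞 * ClassGroup.mk K I = 1 ↔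
      ∃ x : K, spanSingleton (𝓞 K)⁰ x = (𝔞.1 : FractionalIdeal (𝓞 K)⁰ K) * I.1 := by
  rw [← ClassGroup.mk_mk0 K, ← map_mul, ClassGroup.mk_eq_one_iff, isPrincipal_iff, Units.val_mul,
    coe_mk0]
  exact exists_congr fun x => eq_comm

/-- The integral ideals in the inverse class of a fractional ideal. -/
abbrev InverseClass (I : (FractionalIdeal (𝓞 K)⁰ K)ˣ) : Type :=
  {𝔞 : (Ideal (𝓞 K))⁰ // ClassGroup.mk0 𝔞 * ClassGroup.mk K I = 1}

/-- A generator of the product of a fractional ideal and an integral ideal of inverse class. -/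
def classGenerator (I : (FractionalIdeal (𝓞 K)⁰ K)ˣ) (𝔞 : InverseClass I) : K :=
  ((mk0_mul_mk_eq_one_iff 𝔞.1 I).1 𝔞.2).choose

lemma spanSingleton_classGenerator (I : (FractionalIdeal (𝓞 K)⁰ K)ˣ) (𝔞 : InverseClass I) :
    spanSingleton (𝓞 K)⁰ (classGenerator I 𝔞) = (𝔞.1.1 : FractionalIdeal (𝓞 K)⁰ K) * I.1 :=
  ((mk0_mul_mk_eq_one_iff 𝔞.1 I).1 𝔞.2).choose_spec

lemma classGenerator_ne_zero (I : (FractionalIdeal (𝓞 K)⁰ K)ˣ) (𝔞 : InverseClass I) :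
    classGenerator I 𝔞 ≠ 0 := by
  intro h
  have h1 := spanSingleton_classGenerator I 𝔞
  rw [h, spanSingleton_zero, eq_comm, mul_eq_zero] at h1
  rcases h1 with h1 | h1
  · exact nonZeroDivisors.ne_zero 𝔞.1.2 (by simpa using h1)
  · exact I.ne_zero h1

lemma abs_norm_classGenerator (I : (FractionalIdeal (𝓞 K)⁰ K)ˣ) (𝔞 : InverseClass I) :
    |Algebra.norm ℚ (classGenerator I 𝔞)| = Ideal.absNorm 𝔞.1.1 * absNorm I.1 := by
  rw [← absNorm_span_singleton (R := 𝓞 K), spanSingleton_classGenerator, map_mul, coeIdeal_absNorm]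

lemma tsum_fractionalIdeal (I : (FractionalIdeal (𝓞 K)⁰ K)ˣ) (φ : K → ℝ≥0∞) :
    ∑' α : (I.1 : Submodule (𝓞 K) K), φ α =
      φ 0 + ∑' (𝔞 : InverseClass I) (u : (𝓞 K)ˣ), φ ((u : K) * classGenerator I 𝔞) := by
  have hmem : ∀ (𝔞 : InverseClass I) (u : (𝓞 K)ˣ),
      (u : K) * classGenerator I 𝔞 ∈ (I.1 : Submodule (𝓞 K) K) := fun 𝔞 u => by
    have h : classGenerator I 𝔞 ∈ I.1 := by
      rw [← spanSingleton_le_iff_mem, spanSingleton_classGenerator]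
      exact mul_le_of_le_one_left' coeIdeal_le_one
    exact (I.1 : Submodule (𝓞 K) K).smul_mem (u : 𝓞 K) h
  let f : (Σ _ : InverseClass I, (𝓞 K)ˣ) → ({0}ᶜ : Set (I.1 : Submodule (𝓞 K) K)) := fun p =>
    ⟨⟨(p.2 : K) * classGenerator I p.1, hmem p.1 p.2⟩, fun h => by
      have : (p.2 : K) * classGenerator I p.1 = 0 := congrArg Subtype.val h
      exact mul_ne_zero (NumberField.Units.coe_ne_zero p.2) (classGenerator_ne_zero I p.1) this⟩
  have hf : Function.Bijective f := by
    constructor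
    · rintro ⟨𝔞, u⟩ ⟨𝔟, v⟩ h
      have h1 : (u : K) * classGenerator I 𝔞 = (v : K) * classGenerator I 𝔟 :=
        congrArg (fun x => (x.1.1 : K)) h
      have h2 : spanSingleton (𝓞 K)⁰ (classGenerator I 𝔞) =
          spanSingleton (𝓞 K)⁰ (classGenerator I 𝔟) := by
        rw [spanSingleton_eq_spanSingleton]
        refine ⟨v⁻¹ * u, ?_⟩
        rw [mul_smul, inv_smul_eq_iff]
        exact h1
      have h3 : 𝔞 = 𝔟 := by
        rw [spanSingleton_classGenerator, spanSingleton_classGenerator] at h2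
        exact Subtype.ext (Subtype.ext (coeIdeal_injective (mul_right_cancel₀ I.ne_zero h2)))
      subst h3
      have h4 := mul_right_cancel₀ (classGenerator_ne_zero I 𝔞) h1
      rw [NumberField.Units.coe_injective K h4]
    · rintro ⟨⟨α, hα⟩, hα0⟩
      have hα0' : α ≠ 0 := fun h => hα0 (Subtype.ext h)
      have h1 : spanSingleton (𝓞 K)⁰ α * (I⁻¹ : (FractionalIdeal (𝓞 K)⁰ K)ˣ).1 ≤ 1 := by
        calc _ ≤ I.1 * (I⁻¹ : (FractionalIdeal (𝓞 K)⁰ K)ˣ).1 :=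
              mul_le_mul_left ((spanSingleton_le_iff_mem).2 hα) _
          _ = 1 := I.mul_inv
      obtain ⟨𝔞, h𝔞⟩ := le_one_iff_exists_coeIdeal.1 h1
      have h2 : spanSingleton (𝓞 K)⁰ α = (𝔞 : FractionalIdeal (𝓞 K)⁰ K) * I.1 := by
        rw [h𝔞, mul_assoc, I.inv_mul, mul_one]
      have h𝔞0 : 𝔞 ∈ (Ideal (𝓞 K))⁰ := by
        refine mem_nonZeroDivisors_of_ne_zero fun h0 => hα0' ?_
        rw [h0, Ideal.zero_eq_bot, coeIdeal_bot, zero_mul, spanSingleton_eq_zero_iff] at h2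
        exact h2
      let A : InverseClass I := ⟨⟨𝔞, h𝔞0⟩, (mk0_mul_mk_eq_one_iff _ I).2 ⟨α, h2⟩⟩
      obtain ⟨u, hu⟩ := spanSingleton_eq_spanSingleton.1
        ((spanSingleton_classGenerator I A).trans h2.symm)
      exact ⟨⟨A, u⟩, Subtype.ext (Subtype.ext hu)⟩
  rw [ENNReal.tsum_eq_add_tsum_ite (0 : (I.1 : Submodule (𝓞 K) K))]
  congr 1
  rw [← ENNReal.tsum_sigma' (fun p : (Σ _ : InverseClass I, (𝓞 K)ˣ) =>
    φ ((p.2 : K) * classGenerator I p.1))]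
  have h1 := (Equiv.ofBijective f hf).tsum_eq fun α => φ α.1.1
  refine Eq.trans ?_ h1.symm
  rw [tsum_subtype ({0}ᶜ : Set (I.1 : Submodule (𝓞 K) K)) fun α => φ α.1]
  refine tsum_congr fun α => ?_
  by_cases h : α = 0 <;> simp [h]

end IdealSums

section ThetaIntegral

variable {K : Type} [Field K] [NumberField K]

open FractionalIdeal NumberField.Units NumberField.Units.dirichletUnitTheorem
open scoped ENNReal nonZeroDivisors

/-- The integral of the Gaussian over the norm-one torus of radius `τ`. -/
def torusKernel (K : Type) [Field K] [NumberField K] (τ : ℝ) : ℝ≥0∞ :=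
  ∫⁻ x : logSpace K,
    ENNReal.ofReal (Real.exp (-Real.pi * (τ * ∑ w : InfinitePlace K, w.mult * logTorus x w)))

/-- The point of the positive cone of radius `τ` and logarithmic coordinates `x`. -/
def conePoint (τ : ℝ) (x : logSpace K) (w : InfinitePlace K) : ℝ := τ * logTorus x w

lemma conePoint_pos {τ : ℝ} (hτ : 0 < τ) (x : logSpace K) (w : InfinitePlace K) :
    0 < conePoint τ x w := mul_pos hτ (logTorus_pos x w)

lemma conePoint_inv (τ : ℝ) (x : logSpace K) : (conePoint τ x)⁻¹ = conePoint τ⁻¹ (-x) := by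
  ext w
  simp [conePoint, logTorus_neg, mul_comm]

@[fun_prop]
lemma continuous_placeForm_conePoint (τ : ℝ) (α : K) :
    Continuous fun x : logSpace K => placeForm (conePoint τ x) α := by
  unfold placeForm conePoint
  fun_prop

lemma measurable_gauss (τ : ℝ) (α : K) : Measurable fun x : logSpace K =>
    ENNReal.ofReal (Real.exp (-Real.pi * placeForm (conePoint τ x) α)) := by
  have := continuous_placeForm_conePoint τ α
  exact (ENNReal.continuous_ofReal.comp (by fun_prop)).measurable

lemma countable_numberField : Countable K :=
  Cardinal.mk_le_aleph0_iff.1 ((Algebra.IsAlgebraic.cardinalMk_le_max ℚ K).trans (by simp))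

lemma countable_units : Countable (𝓞 K)ˣ :=
  have := countable_numberField (K := K)
  (NumberField.Units.coe_injective K).countable

lemma placeForm_conePoint_unit (τ : ℝ) (x : logSpace K) (u : (𝓞 K)ˣ) (α : K) :
    placeForm (conePoint τ x) ((u : K) * α) =
      placeForm (conePoint τ (x + (unitLog u : logSpace K))) α := by
  unfold placeForm conePoint
  refine Finset.sum_congr rfl fun w _ => ?_
  rw [logTorus_add, logTorus_unitLog, map_mul]
  ring

lemma lintegral_placeForm (τ : ℝ) {α : K} (hα : α ≠ 0) :
    ∫⁻ x : logSpace K, ENNReal.ofReal (Real.exp (-Real.pi * placeForm (conePoint τ x) α)) =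
      torusKernel K (τ * (|Algebra.norm ℚ α| : ℝ) ^ (2 / Module.finrank ℚ K : ℝ)) := by
  obtain ⟨a, ha⟩ := exists_logTorus hα
  rw [torusKernel]
  refine Eq.trans ?_ (lintegral_add_right_eq_self _ a)
  refine lintegral_congr fun x => ?_
  congr 4
  unfold placeForm conePoint
  rw [Finset.mul_sum]
  refine Finset.sum_congr rfl fun w _ => ?_
  rw [ha, logTorus_add]
  ring

lemma ofReal_idealTheta (I : (FractionalIdeal (𝓞 K)⁰ K)ˣ) {y : InfinitePlace K → ℝ}
    (hy : ∀ w, 0 < y w) :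
    ENNReal.ofReal (idealTheta I.1 y) = 1 + ∑' (𝔞 : InverseClass I) (u : (𝓞 K)ˣ),
      ENNReal.ofReal (Real.exp (-Real.pi * placeForm y ((u : K) * classGenerator I 𝔞))) := by
  rw [idealTheta, ENNReal.ofReal_tsum_of_nonneg (fun _ => (Real.exp_pos _).le)
    (summable_idealTheta I hy),
    tsum_fractionalIdeal I fun α => ENNReal.ofReal (Real.exp (-Real.pi * placeForm y α))]
  simp [placeForm]

lemma countable_inverseClass (I : (FractionalIdeal (𝓞 K)⁰ K)ˣ) : Countable (InverseClass I) := by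
  have hinj : Function.Injective (classGenerator I) := by
    intro 𝔞 𝔟 h
    have h2 := spanSingleton_classGenerator I 𝔞
    rw [h, spanSingleton_classGenerator] at h2
    exact (Subtype.ext (Subtype.ext (coeIdeal_injective (mul_right_cancel₀ I.ne_zero h2)))).symm
  have := countable_numberField (K := K)
  exact hinj.countable

lemma lintegral_idealTheta (I : (FractionalIdeal (𝓞 K)⁰ K)ˣ) {τ : ℝ} (hτ : 0 < τ) :
    ∫⁻ x in unitDomain K, ENNReal.ofReal (idealTheta I.1 (conePoint τ x)) =
      volume (unitDomain K) + torsionOrder K * ∑' 𝔞 : InverseClass I,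
        torusKernel K (τ * ((Ideal.absNorm 𝔞.1.1 : ℝ) * (absNorm I.1 : ℝ)) ^
          (2 / Module.finrank ℚ K : ℝ)) := by
  have := countable_inverseClass I
  have := countable_units (K := K)
  have hn : ∀ 𝔞 : InverseClass I, (|Algebra.norm ℚ (classGenerator I 𝔞)| : ℝ) =
      (Ideal.absNorm 𝔞.1.1 : ℝ) * (absNorm I.1 : ℝ) := fun 𝔞 => by
    exact_mod_cast congrArg (fun q : ℚ => (q : ℝ)) (abs_norm_classGenerator I 𝔞)
  simp_rw [fun x => ofReal_idealTheta I (conePoint_pos hτ x)]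
  simp_rw [placeForm_conePoint_unit]
  have hm : ∀ 𝔞 : InverseClass I, AEMeasurable (fun x : logSpace K => ∑' u : (𝓞 K)ˣ,
      ENNReal.ofReal (Real.exp (-Real.pi * placeForm (conePoint τ (x + (unitLog u : logSpace K)))
        (classGenerator I 𝔞)))) (volume.restrict (unitDomain K)) := fun 𝔞 =>
    (Measurable.ennreal_tsum fun u => (measurable_gauss τ _).comp (by fun_prop)).aemeasurable
  rw [lintegral_add_left measurable_const, setLIntegral_const, one_mul,
    lintegral_tsum hm, ← ENNReal.tsum_mul_left]
  congr 1
  refine tsum_congr fun 𝔞 => ?_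
  rw [lintegral_unitDomain (fun x => ENNReal.ofReal (Real.exp (-Real.pi *
    placeForm (conePoint τ x) (classGenerator I 𝔞)))) (measurable_gauss τ _),
    lintegral_placeForm τ (classGenerator_ne_zero I 𝔞), hn]

lemma lintegral_idealTheta_neg (I : (FractionalIdeal (𝓞 K)⁰ K)ˣ) {τ : ℝ} (hτ : 0 < τ) :
    ∫⁻ x in unitDomain K, ENNReal.ofReal (idealTheta I.1 (conePoint τ (-x))) =
      volume (unitDomain K) + torsionOrder K * ∑' 𝔞 : InverseClass I,
        torusKernel K (τ * ((Ideal.absNorm 𝔞.1.1 : ℝ) * (absNorm I.1 : ℝ)) ^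
          (2 / Module.finrank ℚ K : ℝ)) := by
  have := countable_inverseClass I
  have := countable_units (K := K)
  have hn : ∀ 𝔞 : InverseClass I, (|Algebra.norm ℚ (classGenerator I 𝔞)| : ℝ) =
      (Ideal.absNorm 𝔞.1.1 : ℝ) * (absNorm I.1 : ℝ) := fun 𝔞 => by
    exact_mod_cast congrArg (fun q : ℚ => (q : ℝ)) (abs_norm_classGenerator I 𝔞)
  simp_rw [fun x : logSpace K => ofReal_idealTheta I (conePoint_pos hτ (-x))]
  simp_rw [placeForm_conePoint_unit]
  have hm : ∀ 𝔞 : InverseClass I, AEMeasurable (fun x : logSpace K => ∑' u : (𝓞 K)ˣ,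
      ENNReal.ofReal (Real.exp (-Real.pi * placeForm (conePoint τ (-x + (unitLog u : logSpace K)))
        (classGenerator I 𝔞)))) (volume.restrict (unitDomain K)) := fun 𝔞 =>
    (Measurable.ennreal_tsum fun u => (measurable_gauss τ _).comp (by fun_prop)).aemeasurable
  rw [lintegral_add_left measurable_const, setLIntegral_const, one_mul,
    lintegral_tsum hm, ← ENNReal.tsum_mul_left]
  congr 1
  refine tsum_congr fun 𝔞 => ?_
  rw [lintegral_unitDomain_neg (fun x => ENNReal.ofReal (Real.exp (-Real.pi *
    placeForm (conePoint τ x) (classGenerator I 𝔞)))) (measurable_gauss τ _),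
    lintegral_placeForm τ (classGenerator_ne_zero I 𝔞), hn]

lemma idealTheta_conePoint (I : (FractionalIdeal (𝓞 K)⁰ K)ˣ) {τ : ℝ} (hτ : 0 < τ)
    (x : logSpace K) :
    idealTheta I.1 (conePoint τ x) = (thetaCovolume K * absNorm I.1 *
      Real.sqrt τ ^ Module.finrank ℚ K)⁻¹ * idealTheta (dualIdeal I).1 (conePoint τ⁻¹ (-x)) := by
  rw [idealTheta_functional I (conePoint_pos hτ x), conePoint_inv]
  congr 3
  simp_rw [conePoint, Real.sqrt_mul hτ.le, mul_pow]
  rw [Finset.prod_mul_distrib, prod_sqrt_logTorus, mul_one, Finset.prod_pow_eq_pow_sum,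
    InfinitePlace.sum_mult_eq]

/-- The radius `τ (N / V)^(2/n)` at which an ideal of norm `N` contributes. -/
def idealRadius (K : Type) [Field K] [NumberField K] (N : ℝ) : ℝ :=
  (N / thetaCovolume K) ^ (2 / Module.finrank ℚ K : ℝ)

lemma finrank_pos_real : (0 : ℝ) < Module.finrank ℚ K := by
  exact_mod_cast Module.finrank_pos

lemma torusKernel_sum_functional (I : (FractionalIdeal (𝓞 K)⁰ K)ˣ) {τ : ℝ} (hτ : 0 < τ) :
    volume (unitDomain K) + torsionOrder K * ∑' 𝔞 : InverseClass I,
        torusKernel K (τ * idealRadius K (Ideal.absNorm 𝔞.1.1)) =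
    ENNReal.ofReal (Real.sqrt τ ^ Module.finrank ℚ K)⁻¹ * (volume (unitDomain K) +
      torsionOrder K * ∑' 𝔞 : InverseClass (dualIdeal I),
        torusKernel K (τ⁻¹ * idealRadius K (Ideal.absNorm 𝔞.1.1))) := by
  have hV := thetaCovolume_pos (K := K)
  have hI := absNorm_unit_pos I
  have hJ := absNorm_unit_pos (dualIdeal I)
  have hn := finrank_pos_real (K := K)
  have hdual := thetaCovolume_dual I
  set V := thetaCovolume K
  set a : ℝ := ((absNorm I.1 : ℚ) : ℝ)
  set b : ℝ := ((absNorm (dualIdeal I).1 : ℚ) : ℝ)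
  set n : ℝ := (Module.finrank ℚ K : ℝ) with hn_def
  have hVa : 0 < V * a := mul_pos hV hI
  set σ : ℝ := τ * (V * a) ^ (-(2 / n)) with hσ
  have hσ0 : 0 < σ := by positivity
  have h1 : ∫⁻ x in unitDomain K, ENNReal.ofReal (idealTheta I.1 (conePoint σ x)) =
      volume (unitDomain K) + torsionOrder K * ∑' 𝔞 : InverseClass I,
        torusKernel K (σ * ((Ideal.absNorm 𝔞.1.1 : ℝ) * a) ^ (2 / n)) :=
    lintegral_idealTheta I hσ0
  have h2 : ∫⁻ x in unitDomain K, ENNReal.ofReal (idealTheta (dualIdeal I).1 (conePoint σ⁻¹ (-x))) =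
      volume (unitDomain K) + torsionOrder K * ∑' 𝔞 : InverseClass (dualIdeal I),
        torusKernel K (σ⁻¹ * ((Ideal.absNorm 𝔞.1.1 : ℝ) * b) ^ (2 / n)) :=
    lintegral_idealTheta_neg (dualIdeal I) (inv_pos.2 hσ0)
  have hb : b = (V * a)⁻¹ / V := by field_simp; linarith
  have e1 : ∀ N : ℝ, 0 ≤ N → σ * (N * a) ^ (2 / n) = τ * idealRadius K N := fun N hN => by
    rw [hσ, idealRadius, mul_assoc, Real.rpow_neg hVa.le, ← Real.inv_rpow hVa.le,
      ← Real.mul_rpow (by positivity) (by positivity)]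
    congr 2
    change _ = N / V
    field_simp
  have e2 : ∀ N : ℝ, 0 ≤ N → σ⁻¹ * (N * b) ^ (2 / n) = τ⁻¹ * idealRadius K N := fun N hN => by
    rw [hσ, idealRadius, mul_inv, mul_assoc, ← Real.rpow_neg hVa.le, neg_neg,
      ← Real.mul_rpow (by positivity) (by positivity)]
    congr 2
    change _ = N / V
    rw [hb]
    field_simp
  simp_rw [fun 𝔞 : InverseClass I => e1 (Ideal.absNorm 𝔞.1.1) (by positivity)] at h1
  simp_rw [fun 𝔞 : InverseClass (dualIdeal I) => e2 (Ideal.absNorm 𝔞.1.1) (by positivity)] at h2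
  have e3 : Real.sqrt σ ^ Module.finrank ℚ K =
      Real.sqrt τ ^ Module.finrank ℚ K * (V * a)⁻¹ := by
    rw [hσ, Real.sqrt_mul hτ.le, mul_pow]
    congr 1
    rw [Real.sqrt_eq_rpow, ← Real.rpow_mul hVa.le, ← Real.rpow_natCast, ← Real.rpow_mul hVa.le,
      ← hn_def, show -(2 / n) * (1 / 2) * n = -1 by field_simp, Real.rpow_neg_one]
  rw [← h1, ← h2]
  simp_rw [idealTheta_conePoint I hσ0, e3]
  have e4 : (V * a * (Real.sqrt τ ^ Module.finrank ℚ K * (V * a)⁻¹))⁻¹ =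
      (Real.sqrt τ ^ Module.finrank ℚ K)⁻¹ := by
    congr 1
    field_simp
  change ∫⁻ x in unitDomain K, ENNReal.ofReal ((V * a * (Real.sqrt τ ^ Module.finrank ℚ K *
    (V * a)⁻¹))⁻¹ * _) = _
  rw [e4]
  simp_rw [ENNReal.ofReal_mul (by positivity : 0 ≤ (Real.sqrt τ ^ Module.finrank ℚ K)⁻¹)]
  rw [lintegral_const_mul' _ _ ENNReal.ofReal_ne_top]

/-- The non-constant part of the theta function of a number field. -/
def thetaTail (K : Type) [Field K] [NumberField K] (τ : ℝ) : ℝ≥0∞ :=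
  torsionOrder K * ∑' 𝔞 : (Ideal (𝓞 K))⁰, torusKernel K (τ * idealRadius K (Ideal.absNorm 𝔞.1))

/-- The constant term of the theta function of a number field. -/
def thetaConst (K : Type) [Field K] [NumberField K] : ℝ≥0∞ :=
  Fintype.card (ClassGroup (𝓞 K)) * volume (unitDomain K)

lemma mk_dualIdeal (I : (FractionalIdeal (𝓞 K)⁰ K)ˣ) :
    ClassGroup.mk K (dualIdeal I) = ClassGroup.mk K (dualIdeal 1) * (ClassGroup.mk K I)⁻¹ := by
  rw [← map_inv, ← map_mul]
  congr 1
  refine Units.ext ?_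
  have h := dual_eq_mul_inv ℤ ℚ (I := I.1)
  rw [Units.val_mul, Units.val_inv_eq_inv_val]
  exact h

theorem thetaTail_functional {τ : ℝ} (hτ : 0 < τ) :
    thetaConst K + thetaTail K τ = ENNReal.ofReal (Real.sqrt τ ^ Module.finrank ℚ K)⁻¹ *
      (thetaConst K + thetaTail K τ⁻¹) := by
  let S : ClassGroup (𝓞 K) → ℝ → ℝ≥0∞ := fun C τ => volume (unitDomain K) +
    torsionOrder K * ∑' 𝔞 : {𝔞 : (Ideal (𝓞 K))⁰ // ClassGroup.mk0 𝔞 * C = 1},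
      torusKernel K (τ * idealRadius K (Ideal.absNorm 𝔞.1.1))
  have hS : ∀ τ, ∑ C, S C τ = thetaConst K + thetaTail K τ := by
    intro τ
    rw [Finset.sum_add_distrib, Finset.sum_const, Finset.card_univ, nsmul_eq_mul, ← Finset.mul_sum,
      ← tsum_fintype (L := .unconditional _), ← ENNReal.tsum_sigma' (fun p : (Σ C : ClassGroup (𝓞 K),
        {𝔞 : (Ideal (𝓞 K))⁰ // ClassGroup.mk0 𝔞 * C = 1}) =>
          torusKernel K (τ * idealRadius K (Ideal.absNorm p.2.1.1)))]
    rw [thetaConst, thetaTail]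
    congr 2
    let e : (Σ C : ClassGroup (𝓞 K), {𝔞 : (Ideal (𝓞 K))⁰ // ClassGroup.mk0 𝔞 * C = 1}) ≃
        (Ideal (𝓞 K))⁰ :=
      { toFun := fun p => p.2.1
        invFun := fun 𝔞 => ⟨(ClassGroup.mk0 𝔞)⁻¹, 𝔞, mul_inv_cancel _⟩
        left_inv := fun ⟨C, 𝔞, h⟩ => by
          obtain rfl : (ClassGroup.mk0 𝔞)⁻¹ = C := inv_eq_of_mul_eq_one_right h
          rfl
        right_inv := fun _ => rfl }
    exact e.tsum_eq fun 𝔞 => torusKernel K (τ * idealRadius K (Ideal.absNorm 𝔞.1))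
  have hfe : ∀ C, S C τ = ENNReal.ofReal (Real.sqrt τ ^ Module.finrank ℚ K)⁻¹ *
      S (ClassGroup.mk K (dualIdeal 1) * C⁻¹) τ⁻¹ := by
    intro C
    refine ClassGroup.induction K (fun I => ?_) C
    rw [← mk_dualIdeal]
    exact torusKernel_sum_functional I hτ
  rw [← hS, ← hS, Finset.mul_sum, Finset.sum_congr rfl fun C _ => hfe C]
  exact Fintype.sum_equiv ((Equiv.inv _).trans (Equiv.mulLeft (ClassGroup.mk K (dualIdeal 1)))) _ _
    fun C => rfl

end ThetaIntegral

section ArchimedeanFactor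

variable {K : Type} [Field K] [NumberField K]

open NumberField.Units NumberField.Units.dirichletUnitTheorem
open scoped ENNReal nonZeroDivisors

lemma image_exp_mul {c : ℝ} (hc : 0 < c) :
    (fun v : ℝ => Real.exp (c * v)) '' Set.univ = Set.Ioi 0 := by
  ext t
  simp only [Set.image_univ, Set.mem_range, Set.mem_Ioi]
  constructor
  · rintro ⟨v, rfl⟩
    exact Real.exp_pos _
  · intro ht
    exact ⟨Real.log t / c, by rw [mul_div_cancel₀ _ hc.ne', Real.exp_log ht]⟩

lemma hasDerivAt_exp_mul (c v : ℝ) :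
    HasDerivAt (fun v : ℝ => Real.exp (c * v)) (c * Real.exp (c * v)) v := by
  simpa [mul_comm] using ((hasDerivAt_id v).const_mul c).exp

lemma injective_exp_mul {c : ℝ} (hc : 0 < c) :
    Set.InjOn (fun v : ℝ => Real.exp (c * v)) Set.univ := fun _ _ _ _ h =>
  mul_left_cancel₀ hc.ne' (Real.exp_injective h)

lemma lintegral_Ioi_exp (h : ℝ → ℝ≥0∞) :
    ∫⁻ t in Set.Ioi (0 : ℝ), h t = ∫⁻ v : ℝ, ENNReal.ofReal (Real.exp v) * h (Real.exp v) := by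
  rw [← image_exp_mul one_pos, lintegral_image_eq_lintegral_abs_deriv_mul MeasurableSet.univ
    (fun v _ => (hasDerivAt_exp_mul 1 v).hasDerivWithinAt) (injective_exp_mul one_pos),
    Measure.restrict_univ]
  simp [abs_of_pos, Real.exp_pos]

lemma exp_gauss_eq {c : ℝ} (hc : 0 < c) (s a v : ℝ) :
    |c * Real.exp (c * v)| • (Real.exp (c * v) ^ (s / c - 1) * Real.exp (-(a * Real.exp (c * v)))) =
      c * Real.exp (s * v - a * Real.exp (c * v)) := by
  rw [abs_of_pos (by positivity), smul_eq_mul, ← Real.exp_mul, mul_assoc, ← mul_assoc (Real.exp _),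
    ← Real.exp_add, ← Real.exp_add]
  congr 2
  field_simp
  ring

lemma integrable_exp_gauss {c s a : ℝ} (hc : 0 < c) (hs : 0 < s) (ha : 0 < a) :
    Integrable fun v : ℝ => Real.exp (s * v - a * Real.exp (c * v)) := by
  have h1 : IntegrableOn (fun t : ℝ => t ^ (s / c - 1) * Real.exp (-(a * t))) (Set.Ioi 0) := by
    refine .of_integral_ne_zero ?_
    rw [Real.integral_rpow_mul_exp_neg_mul_Ioi (by positivity) ha]
    have := Real.Gamma_pos_of_pos (div_pos hs hc)
    positivity
  rw [← image_exp_mul hc, integrableOn_image_iff_integrableOn_abs_deriv_smul MeasurableSet.univ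
    (fun v _ => (hasDerivAt_exp_mul c v).hasDerivWithinAt) (injective_exp_mul hc)] at h1
  simp_rw [exp_gauss_eq hc] at h1
  rw [integrableOn_univ, integrable_const_mul_iff hc.ne'.isUnit] at h1
  exact h1

lemma integral_exp_gauss {c s a : ℝ} (hc : 0 < c) (hs : 0 < s) (ha : 0 < a) :
    ∫ v : ℝ, Real.exp (s * v - a * Real.exp (c * v)) =
      c⁻¹ * ((1 / a) ^ (s / c) * Real.Gamma (s / c)) := by
  rw [← Real.integral_rpow_mul_exp_neg_mul_Ioi (by positivity) ha, ← image_exp_mul hc,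
    integral_image_eq_integral_abs_deriv_smul MeasurableSet.univ
    (fun v _ => (hasDerivAt_exp_mul c v).hasDerivWithinAt) (injective_exp_mul hc)]
  simp_rw [exp_gauss_eq hc]
  rw [Measure.restrict_univ, integral_const_mul, inv_mul_cancel_left₀ hc.ne']

/-- The Archimedean Euler factor, up to constants. -/
def archFactor (K : Type) [Field K] [NumberField K] (s : ℝ) : ℝ :=
  ∏ w : InfinitePlace K, ((2 / w.mult : ℝ)⁻¹ * ((1 / (Real.pi * w.mult)) ^ (s / (2 / w.mult : ℝ)) *
    Real.Gamma (s / (2 / w.mult : ℝ))))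

lemma lintegral_arch {s : ℝ} (hs : 0 < s) :
    ∫⁻ v : InfinitePlace K → ℝ, ENNReal.ofReal (∏ w : InfinitePlace K,
      Real.exp (s * v w - Real.pi * w.mult * Real.exp (2 / w.mult * v w))) =
        ENNReal.ofReal (archFactor K s) := by
  have hm : ∀ w : InfinitePlace K, (0 : ℝ) < w.mult := fun w => by exact_mod_cast w.mult_pos
  rw [← ofReal_integral_eq_lintegral_ofReal]
  · rw [integral_fintype_prod_volume_eq_prod (fun (w : InfinitePlace K) (v : ℝ) =>
      Real.exp (s * v - Real.pi * w.mult * Real.exp (2 / w.mult * v)))]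
    congr 1
    refine Finset.prod_congr rfl fun w _ => ?_
    have := hm w
    rw [integral_exp_gauss (by positivity) hs (by positivity)]
  · refine Integrable.fintype_prod (f := fun (w : InfinitePlace K) (v : ℝ) =>
      Real.exp (s * v - Real.pi * w.mult * Real.exp (2 / w.mult * v))) fun w => ?_
    have := hm w
    exact integrable_exp_gauss (by positivity) hs (by positivity)
  · exact ae_of_all _ fun v => Finset.prod_nonneg fun w _ => (Real.exp_pos _).le

lemma logCoord_smul (c : ℝ) (x : logSpace K) (w : InfinitePlace K) :
    logCoord (c • x) w = c * logCoord x w := by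
  unfold logCoord
  split_ifs <;> simp [Finset.mul_sum]

lemma sum_mult_real : ∑ w : InfinitePlace K, (w.mult : ℝ) = Module.finrank ℚ K := by
  exact_mod_cast InfinitePlace.sum_mult_eq (K := K)

/-- Logarithmic coordinates on the positive cone, split into radius and torus parts. -/
def coneCoord (K : Type) [Field K] [NumberField K] :
    (ℝ × logSpace K) ≃ₗ[ℝ] (InfinitePlace K → ℝ) where
  toFun p w := w.mult * p.1 / 2 + logCoord p.2 w
  map_add' p q := by
    ext w
    simp only [Prod.fst_add, Prod.snd_add, logCoord_add, Pi.add_apply]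
    ring
  map_smul' c p := by
    ext w
    simp only [Prod.smul_fst, Prod.smul_snd, logCoord_smul, Pi.smul_apply, smul_eq_mul,
      RingHom.id_apply]
    ring
  invFun v := (2 * (∑ w, v w) / Module.finrank ℚ K,
    fun w => v w - w.1.mult * ((∑ w, v w) / Module.finrank ℚ K))
  left_inv p := by
    have hn := finrank_pos_real (K := K)
    have h : ∑ w : InfinitePlace K, (w.mult * p.1 / 2 + logCoord p.2 w) =
        Module.finrank ℚ K * p.1 / 2 := by
      rw [Finset.sum_add_distrib, sum_logCoord, add_zero, ← Finset.sum_div, ← Finset.sum_mul,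
        sum_mult_real]
    refine Prod.ext ?_ ?_
    · simp only [h]
      field_simp
    · ext w
      simp only [h]
      rw [logCoord, dif_neg w.2]
      field_simp
      ring
  right_inv v := by
    have hn := finrank_pos_real (K := K)
    ext w
    have h := logCoord_restrict
      (fun w : InfinitePlace K => v w - w.mult * ((∑ w, v w) / Module.finrank ℚ K)) (by
        rw [Finset.sum_sub_distrib, ← Finset.sum_mul, sum_mult_real]
        field_simp
        ring) w
    simp only [h]
    field_simp
    ring

lemma exists_coneCoord_volume : ∃ c : ℝ≥0∞, c ≠ 0 ∧ c ≠ ∞ ∧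
    (volume : Measure (ℝ × logSpace K)).map (coneCoord K) = c • volume := by
  have : (volume : Measure (ℝ × logSpace K)).IsAddHaarMeasure :=
    Measure.prod.instIsAddHaarMeasure (volume : Measure ℝ) (volume : Measure (logSpace K))
  have : ((volume : Measure (ℝ × logSpace K)).map (coneCoord K)).IsAddHaarMeasure :=
    (coneCoord K).toContinuousLinearEquiv.isAddHaarMeasure_map volume
  refine ⟨Measure.addHaarScalarFactor ((volume : Measure (ℝ × logSpace K)).map (coneCoord K)) volume,
    ?_, ENNReal.coe_ne_top, Measure.isAddLeftInvariant_eq_smul _ _⟩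
  simpa only [ne_eq, ENNReal.coe_eq_zero] using
    (Measure.addHaarScalarFactor_pos_of_isAddHaarMeasure _ _).ne'

lemma measurable_torusIntegrand : Measurable fun p : ℝ × logSpace K =>
    ENNReal.ofReal (Real.exp (-Real.pi * (p.1 * ∑ w : InfinitePlace K, w.mult * logTorus p.2 w))) := by
  refine (ENNReal.continuous_ofReal.comp ?_).measurable
  have := fun w => continuous_logTorus (K := K) w
  fun_prop

lemma measurable_torusKernel : Measurable (torusKernel K) :=
  measurable_torusIntegrand.lintegral_prod_right'

theorem lintegral_torusKernel : ∃ c : ℝ≥0∞, c ≠ 0 ∧ c ≠ ∞ ∧ ∀ s : ℝ, 0 < s →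
    ∫⁻ τ in Set.Ioi (0 : ℝ), torusKernel K τ *
      ENNReal.ofReal (τ ^ ((Module.finrank ℚ K : ℝ) * s / 2 - 1)) =
        c * ENNReal.ofReal (archFactor K s) := by
  obtain ⟨c, h0, ht, hc⟩ := exists_coneCoord_volume (K := K)
  refine ⟨c, h0, ht, fun s hs => ?_⟩
  have hm : ∀ w : InfinitePlace K, (0 : ℝ) < w.mult := fun w => by exact_mod_cast w.mult_pos
  let F : (InfinitePlace K → ℝ) → ℝ≥0∞ := fun v => ENNReal.ofReal (∏ w : InfinitePlace K,
      Real.exp (s * v w - Real.pi * w.mult * Real.exp (2 / w.mult * v w)))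
  have hF : Measurable F := (ENNReal.continuous_ofReal.comp (by fun_prop)).measurable
  have hcont : Continuous (coneCoord K) := (coneCoord K).toContinuousLinearEquiv.continuous
  have key : ∀ T : ℝ, ∀ x : logSpace K, F (coneCoord K (T, x)) =
      ENNReal.ofReal (Real.exp T) * (ENNReal.ofReal (Real.exp (-Real.pi * (Real.exp T *
        ∑ w : InfinitePlace K, w.mult * logTorus x w))) *
        ENNReal.ofReal (Real.exp T ^ ((Module.finrank ℚ K : ℝ) * s / 2 - 1))) := by
    intro T x
    have e1 : ∀ w : InfinitePlace K, coneCoord K (T, x) w = w.mult * T / 2 + logCoord x w :=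
      fun w => rfl
    rw [← ENNReal.ofReal_mul (by positivity), ← ENNReal.ofReal_mul (by positivity)]
    simp only [F, e1]
    congr 1
    rw [← Real.exp_sum, ← Real.exp_mul, ← Real.exp_add, ← Real.exp_add]
    congr 1
    have e2 : ∀ w : InfinitePlace K, Real.pi * w.mult * Real.exp (2 / w.mult *
        (w.mult * T / 2 + logCoord x w)) = Real.pi * (Real.exp T * (w.mult * logTorus x w)) := by
      intro w
      have := hm w
      rw [show 2 / (w.mult : ℝ) * (w.mult * T / 2 + logCoord x w) = T + 2 * logCoord x w / w.mult by
        field_simp, Real.exp_add, logTorus]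
      ring
    simp_rw [e2]
    rw [Finset.sum_sub_distrib, ← Finset.mul_sum, ← Finset.mul_sum, ← Finset.mul_sum,
      Finset.sum_add_distrib, sum_logCoord, ← Finset.sum_div, ← Finset.sum_mul, sum_mult_real]
    ring
  calc _ = ∫⁻ T : ℝ, ∫⁻ x : logSpace K, F (coneCoord K (T, x)) := by
        rw [lintegral_Ioi_exp]
        refine lintegral_congr fun T => ?_
        simp_rw [key]
        rw [lintegral_const_mul' _ _ ENNReal.ofReal_ne_top, lintegral_mul_const' _ _
          ENNReal.ofReal_ne_top]
        rfl
    _ = ∫⁻ p : ℝ × logSpace K, F (coneCoord K p) :=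
        (lintegral_prod _ (hF.comp hcont.measurable).aemeasurable).symm
    _ = ∫⁻ v, F v ∂(volume : Measure (ℝ × logSpace K)).map (coneCoord K) :=
        (lintegral_map hF hcont.measurable).symm
    _ = c * ENNReal.ofReal (archFactor K s) := by
        rw [hc, lintegral_smul_measure, lintegral_arch hs, smul_eq_mul]

end ArchimedeanFactor

section ThetaMellin

variable {K : Type} [Field K] [NumberField K]

open NumberField.Units
open scoped ENNReal nonZeroDivisors

lemma absNorm_pos_real (𝔞 : (Ideal (𝓞 K))⁰) : (1 : ℝ) ≤ Ideal.absNorm 𝔞.1 := by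
  have : 0 < Ideal.absNorm 𝔞.1 :=
    Nat.pos_of_ne_zero fun h => nonZeroDivisors.ne_zero 𝔞.2 (Ideal.absNorm_eq_zero_iff.1 h)
  exact_mod_cast this

lemma finite_absNorm_fiber (n : ℕ) :
    Finite {𝔞 : (Ideal (𝓞 K))⁰ // Ideal.absNorm 𝔞.1 = n} := by
  have := (Ideal.finite_setOfPred_absNorm_eq (S := 𝓞 K) n).to_subtype
  exact Finite.of_injective
    (fun 𝔞 => (⟨𝔞.1.1, 𝔞.2⟩ : {I : Ideal (𝓞 K) | Ideal.absNorm I = n}))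
    fun 𝔞 𝔟 h => Subtype.ext (Subtype.ext (congrArg (fun I => I.1) h))

lemma countable_ideals : Countable (Ideal (𝓞 K))⁰ := by
  have := fun n => finite_absNorm_fiber (K := K) n
  exact (Equiv.sigmaFiberEquiv fun 𝔞 : (Ideal (𝓞 K))⁰ => Ideal.absNorm 𝔞.1).symm.injective.countable

lemma sum_card_absNorm (n : ℕ) :
    ∑ k ∈ Finset.Icc 1 n, Nat.card {𝔞 : (Ideal (𝓞 K))⁰ // Ideal.absNorm 𝔞.1 = k} =
      Nat.card {𝔞 : (Ideal (𝓞 K))⁰ // (Ideal.absNorm 𝔞.1 : ℝ) ≤ n} := by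
  have := fun n => finite_absNorm_fiber (K := K) n
  let e : {𝔞 : (Ideal (𝓞 K))⁰ // (Ideal.absNorm 𝔞.1 : ℝ) ≤ n} ≃
      Σ k : Finset.Icc 1 n, {𝔞 : (Ideal (𝓞 K))⁰ // Ideal.absNorm 𝔞.1 = k} :=
    { toFun := fun 𝔞 => ⟨⟨Ideal.absNorm 𝔞.1.1, Finset.mem_Icc.2
        ⟨by exact_mod_cast absNorm_pos_real 𝔞.1, by exact_mod_cast 𝔞.2⟩⟩, 𝔞.1, rfl⟩
      invFun := fun p => ⟨p.2.1, by
        rw [p.2.2]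
        exact_mod_cast (Finset.mem_Icc.1 p.1.2).2⟩
      left_inv := fun 𝔞 => rfl
      right_inv := by
        rintro ⟨⟨k, hk⟩, ⟨𝔞, h⟩⟩
        simp only at h
        subst h
        rfl }
  rw [Nat.card_congr e, Nat.card_sigma, Finset.univ_eq_attach]
  exact (Finset.sum_attach (Finset.Icc 1 n)
    fun k => Nat.card {𝔞 : (Ideal (𝓞 K))⁰ // Ideal.absNorm 𝔞.1 = k}).symm

theorem summable_absNorm_rpow {s : ℝ} (hs : 1 < s) :
    Summable fun 𝔞 : (Ideal (𝓞 K))⁰ => (Ideal.absNorm 𝔞.1 : ℝ) ^ (-s) := by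
  have := fun n => finite_absNorm_fiber (K := K) n
  have hO : (fun n : ℕ => ∑ k ∈ Finset.Icc 1 n,
      (Nat.card {𝔞 : (Ideal (𝓞 K))⁰ // Ideal.absNorm 𝔞.1 = k} : ℝ)) =O[atTop]
        fun n => (n : ℝ) ^ (1 : ℝ) := by
    have h := ((Ideal.tendsto_norm_le_div_atTop₀ K).comp
      tendsto_natCast_atTop_atTop).isBigO_one ℝ
    have h2 := h.mul (Asymptotics.isBigO_refl (fun n : ℕ => (n : ℝ)) atTop)
    refine h2.congr' ?_ ?_
    · filter_upwards [eventually_gt_atTop 0] with n hn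
      have hn' : (n : ℝ) ≠ 0 := by positivity
      simp only [Function.comp_apply]
      rw [div_mul_cancel₀ _ hn', ← sum_card_absNorm]
      push_cast
      rfl
    · filter_upwards with n
      simp
  have h1 := (LSeriesSummable_of_sum_norm_bigO_and_nonneg hO (fun _ => Nat.cast_nonneg _)
    zero_le_one (s := (s : ℂ)) (by simpa using hs)).norm
  rw [← (Equiv.sigmaFiberEquiv fun 𝔞 : (Ideal (𝓞 K))⁰ => Ideal.absNorm 𝔞.1).summable_iff]
  refine (summable_sigma_of_nonneg fun _ => Real.rpow_nonneg (Nat.cast_nonneg _) _).2 ?_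
  refine ⟨fun n => Summable.of_finite, h1.congr fun n => ?_⟩
  have h2 : ∀ y : {𝔞 : (Ideal (𝓞 K))⁰ // Ideal.absNorm 𝔞.1 = n},
      (Ideal.absNorm y.1.1 : ℝ) ^ (-s) = (n : ℝ) ^ (-s) := fun y => by rw [y.2]
  have h3 := tsum_congr (L := .unconditional _) h2
  refine Eq.trans ?_ h3.symm
  rw [tsum_const, nsmul_eq_mul]
  rcases Nat.eq_zero_or_pos n with rfl | hn
  · rw [LSeries.term_zero, norm_zero, Nat.cast_zero, Real.zero_rpow (by linarith), mul_zero]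
  · rw [LSeries.term_of_ne_zero hn.ne', norm_div, Complex.norm_natCast_cpow_of_pos hn,
      Real.rpow_neg (by positivity)]
    simp [div_eq_mul_inv]

/-- The Dirichlet series of the Dedekind zeta function at a real argument. -/
def idealZeta (K : Type) [Field K] [NumberField K] (s : ℝ) : ℝ :=
  ∑' 𝔞 : (Ideal (𝓞 K))⁰, (Ideal.absNorm 𝔞.1 : ℝ) ^ (-s)

lemma lintegral_Ioi_scale (h : ℝ → ℝ≥0∞) {r : ℝ} (hr : 0 < r) (a : ℝ) :
    ∫⁻ τ in Set.Ioi (0 : ℝ), h (τ * r) * ENNReal.ofReal (τ ^ (a - 1)) =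
      ENNReal.ofReal (r ^ (-a)) * ∫⁻ τ in Set.Ioi (0 : ℝ), h τ * ENNReal.ofReal (τ ^ (a - 1)) := by
  rw [lintegral_Ioi_exp, lintegral_Ioi_exp, ← lintegral_const_mul' _ _ ENNReal.ofReal_ne_top,
    ← lintegral_add_right_eq_self (fun v => ENNReal.ofReal (r ^ (-a)) * (ENNReal.ofReal (Real.exp v) *
      (h (Real.exp v) * ENNReal.ofReal (Real.exp v ^ (a - 1))))) (Real.log r)]
  refine lintegral_congr fun v => ?_
  have e : Real.exp (v + Real.log r) = Real.exp v * r := by rw [Real.exp_add, Real.exp_log hr]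
  have e2 : Real.exp v * Real.exp v ^ (a - 1) =
      r ^ (-a) * (Real.exp v * r * (Real.exp v * r) ^ (a - 1)) := by
    rw [Real.mul_rpow (Real.exp_pos _).le hr.le, Real.rpow_neg hr.le, Real.rpow_sub_one hr.ne']
    field_simp
  rw [e, mul_left_comm (ENNReal.ofReal (Real.exp v)), ← ENNReal.ofReal_mul (Real.exp_pos _).le, e2,
    ENNReal.ofReal_mul (by positivity), ENNReal.ofReal_mul (by positivity)]
  ring

lemma idealRadius_pos {N : ℝ} (hN : 0 < N) : 0 < idealRadius K N :=
  Real.rpow_pos_of_pos (div_pos hN thetaCovolume_pos) _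

lemma idealRadius_rpow {N : ℝ} (hN : 0 < N) (s : ℝ) :
    idealRadius K N ^ (-((Module.finrank ℚ K : ℝ) * s / 2)) = thetaCovolume K ^ s * N ^ (-s) := by
  have hV := thetaCovolume_pos (K := K)
  have hn := finrank_pos_real (K := K)
  rw [idealRadius, ← Real.rpow_mul (by positivity),
    show 2 / (Module.finrank ℚ K : ℝ) * -((Module.finrank ℚ K : ℝ) * s / 2) = -s by field_simp,
    Real.div_rpow hN.le hV.le, Real.rpow_neg hV.le, div_inv_eq_mul, mul_comm]

lemma measurable_thetaTail : Measurable (thetaTail K) := by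
  have := countable_ideals (K := K)
  exact (Measurable.ennreal_tsum fun 𝔞 => measurable_torusKernel.comp (by fun_prop)).const_mul _

theorem lintegral_thetaTail : ∃ c : ℝ≥0∞, c ≠ 0 ∧ c ≠ ∞ ∧ ∀ s : ℝ, 1 < s →
    ∫⁻ τ in Set.Ioi (0 : ℝ), thetaTail K τ *
      ENNReal.ofReal (τ ^ ((Module.finrank ℚ K : ℝ) * s / 2 - 1)) =
        c * ENNReal.ofReal (thetaCovolume K ^ s * archFactor K s * idealZeta K s) := by
  have := countable_ideals (K := K)
  have hV := thetaCovolume_pos (K := K)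
  obtain ⟨c, h0, ht, hc⟩ := lintegral_torusKernel (K := K)
  have htor : (torsionOrder K : ℝ≥0∞) ≠ 0 := by
    exact_mod_cast (torsionOrder_pos K).ne'
  refine ⟨torsionOrder K * c, mul_ne_zero htor h0, ENNReal.mul_ne_top (by simp) ht, fun s hs => ?_⟩
  have hpos : ∀ 𝔞 : (Ideal (𝓞 K))⁰, (0 : ℝ) < Ideal.absNorm 𝔞.1 :=
    fun 𝔞 => one_pos.trans_le (absNorm_pos_real 𝔞)
  have harch : 0 ≤ archFactor K s := by
    refine Finset.prod_nonneg fun w _ => ?_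
    have : (0 : ℝ) < w.mult := by exact_mod_cast w.mult_pos
    have := Real.Gamma_pos_of_pos (div_pos (by linarith : 0 < s) (by positivity : (0 : ℝ) < 2 / w.mult))
    positivity
  simp_rw [thetaTail, mul_assoc, ← ENNReal.tsum_mul_right]
  have hm : ∀ 𝔞 : (Ideal (𝓞 K))⁰, AEMeasurable (fun τ : ℝ =>
      torusKernel K (τ * idealRadius K (Ideal.absNorm 𝔞.1)) *
        ENNReal.ofReal (τ ^ ((Module.finrank ℚ K : ℝ) * s / 2 - 1)))
        (volume.restrict (Set.Ioi 0)) := fun 𝔞 =>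
    ((measurable_torusKernel.comp (by fun_prop)).mul (by fun_prop)).aemeasurable
  rw [lintegral_const_mul' _ _ (by simp), lintegral_tsum hm]
  have e : ∀ 𝔞 : (Ideal (𝓞 K))⁰, ∫⁻ τ in Set.Ioi (0 : ℝ),
      torusKernel K (τ * idealRadius K (Ideal.absNorm 𝔞.1)) *
        ENNReal.ofReal (τ ^ ((Module.finrank ℚ K : ℝ) * s / 2 - 1)) =
      c * ENNReal.ofReal (thetaCovolume K ^ s * archFactor K s) *
        ENNReal.ofReal ((Ideal.absNorm 𝔞.1 : ℝ) ^ (-s)) := fun 𝔞 => by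
    rw [lintegral_Ioi_scale _ (idealRadius_pos (hpos 𝔞)), idealRadius_rpow (hpos 𝔞),
      hc s (by linarith), ENNReal.ofReal_mul (by positivity), ENNReal.ofReal_mul (by positivity)]
    ring
  rw [tsum_congr e, ENNReal.tsum_mul_left, idealZeta, ← mul_assoc (thetaCovolume K ^ s),
    ENNReal.ofReal_mul (p := thetaCovolume K ^ s * archFactor K s) (by positivity),
    ← ENNReal.ofReal_tsum_of_nonneg (fun _ => by positivity)
    (summable_absNorm_rpow hs)]
  ring

lemma thetaTail_antitone : Antitone (thetaTail K) := by
  intro a b hab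
  refine mul_le_mul_right ?_ _
  refine ENNReal.tsum_le_tsum fun 𝔞 => lintegral_mono fun x => ENNReal.ofReal_le_ofReal ?_
  have h1 := idealRadius_pos (K := K) (one_pos.trans_le (absNorm_pos_real 𝔞))
  have h2 : 0 ≤ ∑ w : InfinitePlace K, w.mult * logTorus x w :=
    finrank_pos_real.le.trans (finrank_le_sum_logTorus x)
  rw [Real.exp_le_exp, neg_mul, neg_mul, neg_le_neg_iff]
  gcongr

lemma thetaTail_lt_top {τ : ℝ} (hτ : 0 < τ) : thetaTail K τ < ∞ := by
  obtain ⟨c, h0, ht, hc⟩ := lintegral_thetaTail (K := K)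
  have h2 := hc 2 one_lt_two
  have hfin : ∫⁻ τ in Set.Ioi (0 : ℝ), thetaTail K τ *
      ENNReal.ofReal (τ ^ ((Module.finrank ℚ K : ℝ) * 2 / 2 - 1)) ≠ ∞ := by
    rw [h2]
    exact ENNReal.mul_ne_top ht ENNReal.ofReal_ne_top
  have hae := ae_lt_top (measurable_thetaTail.mul (by fun_prop)) hfin
  rw [ae_restrict_iff' measurableSet_Ioi] at hae
  have hpos : volume (Set.Ioo 0 τ) ≠ 0 := by simp [hτ]
  obtain ⟨t, ht1, ht2⟩ := (frequently_ae_mem_iff.2 hpos).and_eventually hae |>.exists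
  have h3 := ht2 ht1.1
  refine (thetaTail_antitone ht1.2.le).trans_lt (lt_top_iff_ne_top.2 fun h => ?_)
  simp only [Pi.mul_apply, h] at h3
  rw [ENNReal.top_mul] at h3
  · exact lt_irrefl _ h3
  · have := Real.rpow_pos_of_pos ht1.1 ((Module.finrank ℚ K : ℝ) * 2 / 2 - 1)
    simpa using this

lemma thetaTail_le {τ : ℝ} (hτ : 1 ≤ τ) : thetaTail K τ ≤
    ENNReal.ofReal (Real.exp (-(Real.pi * idealRadius K 1 * Module.finrank ℚ K) * (τ - 1))) *
      thetaTail K 1 := by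
  have hV := thetaCovolume_pos (K := K)
  have hn := finrank_pos_real (K := K)
  rw [thetaTail, thetaTail, mul_left_comm, ← ENNReal.tsum_mul_left (a := ENNReal.ofReal _)]
  refine mul_le_mul_right (ENNReal.tsum_le_tsum fun 𝔞 => ?_) _
  rw [torusKernel, torusKernel, ← lintegral_const_mul' _ _ ENNReal.ofReal_ne_top]
  refine lintegral_mono fun x => ?_
  rw [← ENNReal.ofReal_mul (Real.exp_pos _).le, ← Real.exp_add]
  refine ENNReal.ofReal_le_ofReal (Real.exp_le_exp.2 ?_)
  have h1 : idealRadius K 1 ≤ idealRadius K (Ideal.absNorm 𝔞.1) := by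
    refine Real.rpow_le_rpow (by positivity) ?_ (by positivity)
    exact div_le_div_of_nonneg_right (absNorm_pos_real 𝔞) hV.le
  have h0 := idealRadius_pos (K := K) one_pos
  have h2 := finrank_le_sum_logTorus x
  have h3 : idealRadius K 1 * Module.finrank ℚ K ≤ idealRadius K (Ideal.absNorm 𝔞.1) *
      ∑ w : InfinitePlace K, w.mult * logTorus x w := by
    gcongr
    exact h0.le.trans h1
  have h4 := mul_le_mul_of_nonneg_left h3 (mul_nonneg Real.pi_pos.le (sub_nonneg.2 hτ))
  linarith

end ThetaMellin

section CompletedZeta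

variable {K : Type} [Field K] [NumberField K]

open NumberField.Units
open scoped ENNReal nonZeroDivisors

lemma thetaConst_ne_top : thetaConst K ≠ ∞ :=
  ENNReal.mul_ne_top (by simp) volume_unitDomain_ne_top

/-- The theta function of a number field, as a complex-valued function. -/
def thetaK (K : Type) [Field K] [NumberField K] (τ : ℝ) : ℂ :=
  ((thetaConst K + thetaTail K τ).toReal : ℂ)

lemma thetaK_sub_const {τ : ℝ} (hτ : 0 < τ) :
    thetaK K τ - (thetaConst K).toReal = ((thetaTail K τ).toReal : ℂ) := by
  rw [thetaK, ENNReal.toReal_add thetaConst_ne_top (thetaTail_lt_top hτ).ne]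
  push_cast
  ring

lemma thetaK_functional {x : ℝ} (hx : 0 < x) :
    thetaK K (1 / x) = (x ^ ((Module.finrank ℚ K : ℝ) / 2) : ℝ) * thetaK K x := by
  have h := thetaTail_functional (K := K) (inv_pos.2 hx)
  rw [inv_inv] at h
  rw [thetaK, thetaK, one_div, h, ENNReal.toReal_mul, ENNReal.toReal_ofReal (by positivity),
    Real.sqrt_inv, inv_pow, inv_inv, Real.sqrt_eq_rpow, ← Real.rpow_natCast, ← Real.rpow_mul hx.le]
  push_cast
  congr 3
  ring

lemma locallyIntegrableOn_thetaK : LocallyIntegrableOn (thetaK K) (Set.Ioi 0) := by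
  have h : LocallyIntegrableOn (fun τ => ((thetaConst K + thetaTail K τ).toReal : ℝ)) (Set.Ioi 0) := by
    rw [locallyIntegrableOn_iff isOpen_Ioi.isLocallyClosed]
    intro k hk hkc
    refine AntitoneOn.integrableOn_isCompact hkc fun a ha b hb hab => ?_
    refine ENNReal.toReal_mono
      (ENNReal.add_ne_top.2 ⟨thetaConst_ne_top, (thetaTail_lt_top (hk ha)).ne⟩) ?_
    exact add_le_add_right (thetaTail_antitone hab) _
  intro x hx
  obtain ⟨u, hu, hi⟩ := h x hx
  exact ⟨u, hu, hi.ofReal⟩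

lemma thetaK_isBigO (r : ℝ) :
    (fun τ => thetaK K τ - (thetaConst K).toReal) =O[atTop] fun τ => τ ^ r := by
  set c := Real.pi * idealRadius K 1 * Module.finrank ℚ K with hc
  have hc0 : 0 < c := mul_pos (mul_pos Real.pi_pos (idealRadius_pos one_pos)) finrank_pos_real
  refine Asymptotics.IsBigO.trans ?_ (isLittleO_exp_neg_mul_rpow_atTop hc0 r).isBigO
  refine Asymptotics.IsBigO.of_bound (Real.exp c * (thetaTail K 1).toReal) ?_
  filter_upwards [eventually_ge_atTop 1] with τ hτ
  have hτ0 : 0 < τ := one_pos.trans_le hτ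
  rw [thetaK_sub_const hτ0, Complex.norm_real, Real.norm_of_nonneg ENNReal.toReal_nonneg,
    Real.norm_of_nonneg (Real.exp_pos _).le]
  have h := ENNReal.toReal_mono
    (ENNReal.mul_ne_top ENNReal.ofReal_ne_top (thetaTail_lt_top one_pos).ne) (thetaTail_le (K := K) hτ)
  rw [ENNReal.toReal_mul, ENNReal.toReal_ofReal (Real.exp_pos _).le, ← hc] at h
  refine h.trans (le_of_eq ?_)
  rw [show -c * (τ - 1) = c + -c * τ by ring, Real.exp_add]
  ring

/-- The functional equation of the theta function as a weak FE-pair. -/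
def thetaPair (K : Type) [Field K] [NumberField K] : WeakFEPair ℂ where
  f := thetaK K
  g := thetaK K
  k := (Module.finrank ℚ K : ℝ) / 2
  ε := 1
  f₀ := (thetaConst K).toReal
  g₀ := (thetaConst K).toReal
  hf_int := locallyIntegrableOn_thetaK
  hg_int := locallyIntegrableOn_thetaK
  hk := half_pos finrank_pos_real
  hε := one_ne_zero
  h_feq x hx := by rw [one_mul, thetaK_functional hx, smul_eq_mul]
  hf_top := thetaK_isBigO
  hg_top := thetaK_isBigO

/-- The completed, pole-free zeta function of a number field. -/
def xiK (K : Type) [Field K] [NumberField K] (s : ℂ) : ℂ :=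
  s * (s - 1) * (thetaPair K).Λ₀ (Module.finrank ℚ K / 2 * s) +
    2 * (thetaConst K).toReal / Module.finrank ℚ K

lemma differentiable_xiK : Differentiable ℂ (xiK K) := by
  have := (thetaPair K).differentiable_Λ₀
  unfold xiK
  fun_prop

lemma xiK_one_sub (s : ℂ) : xiK K (1 - s) = xiK K s := by
  have h := (thetaPair K).functional_equation₀ (Module.finrank ℚ K / 2 * s)
  have hs : (thetaPair K).symm.Λ₀ = (thetaPair K).Λ₀ := by
    have : (thetaPair K).symm = thetaPair K := by
      simp [WeakFEPair.symm, thetaPair]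
    rw [this]
  rw [hs] at h
  have hk : ((thetaPair K).k : ℂ) = Module.finrank ℚ K / 2 := by
    simp [thetaPair]
  have hε : (thetaPair K).ε = 1 := rfl
  rw [hk, hε, one_smul] at h
  rw [xiK, xiK, ← h]
  ring_nf

lemma xiK_eq_mellin {s : ℝ} (hs : 1 < s) : xiK K s = s * (s - 1) *
    ((∫⁻ τ in Set.Ioi (0 : ℝ), thetaTail K τ *
      ENNReal.ofReal (τ ^ ((Module.finrank ℚ K : ℝ) * s / 2 - 1))).toReal : ℂ) := by
  have hn := finrank_pos_real (K := K)
  set n : ℝ := (Module.finrank ℚ K : ℝ) with hn_def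
  have hre : (thetaPair K).k < ((n / 2 * s : ℝ) : ℂ).re := by
    rw [Complex.ofReal_re]
    change n / 2 < _
    nlinarith
  have hM := ((thetaPair K).hasMellin hre).2
  have h0 : mellin (fun τ => (thetaPair K).f τ - (thetaPair K).f₀) ((n / 2 * s : ℝ) : ℂ) =
      ((∫⁻ τ in Set.Ioi (0 : ℝ), thetaTail K τ * ENNReal.ofReal (τ ^ (n * s / 2 - 1))).toReal : ℂ) := by
    have e : Set.EqOn (fun τ : ℝ => (τ : ℂ) ^ (((n / 2 * s : ℝ) : ℂ) - 1) •
        ((thetaPair K).f τ - (thetaPair K).f₀))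
        (fun τ => (((thetaTail K τ * ENNReal.ofReal (τ ^ (n * s / 2 - 1))).toReal : ℝ) : ℂ))
        (Set.Ioi 0) := by
      intro τ hτ
      have hτ' : 0 < τ := hτ
      have h1 : (thetaPair K).f τ - (thetaPair K).f₀ = ((thetaTail K τ).toReal : ℂ) :=
        thetaK_sub_const hτ'
      simp only [h1]
      rw [ENNReal.toReal_mul, ENNReal.toReal_ofReal (by positivity), smul_eq_mul, mul_comm,
        Complex.ofReal_mul (thetaTail K τ).toReal, Complex.ofReal_cpow hτ'.le]
      congr 2
      push_cast
      ring
    rw [mellin, setIntegral_congr_fun measurableSet_Ioi e, integral_complex_ofReal, integral_toReal]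
    · exact (measurable_thetaTail.mul (by fun_prop)).aemeasurable
    · refine (ae_restrict_iff' measurableSet_Ioi).2 (ae_of_all _ fun τ hτ => ?_)
      exact ENNReal.mul_lt_top (thetaTail_lt_top hτ) ENNReal.ofReal_lt_top
  rw [← h0, hM, xiK]
  have h2 := (thetaPair K).Λ₀_eq ((n / 2 * s : ℝ) : ℂ)
  have e3 : ((n / 2 * s : ℝ) : ℂ) = Module.finrank ℚ K / 2 * s := by
    push_cast [hn_def]
    ring
  rw [e3] at h2 ⊢
  rw [h2]
  have hk : ((thetaPair K).k : ℂ) = Module.finrank ℚ K / 2 := by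
    simp [thetaPair]
  have hε : (thetaPair K).ε = 1 := rfl
  have hf₀ : (thetaPair K).f₀ = (thetaConst K).toReal := rfl
  have hg₀ : (thetaPair K).g₀ = (thetaConst K).toReal := rfl
  rw [hk, hε, hf₀, hg₀]
  have hs0 : (s : ℂ) ≠ 0 := by exact_mod_cast (by linarith : s ≠ 0)
  have hs1 : (1 - s : ℂ) ≠ 0 := by exact_mod_cast (by linarith : 1 - s ≠ 0)
  have hnc : (Module.finrank ℚ K : ℂ) ≠ 0 := by exact_mod_cast Module.finrank_pos.ne'
  rw [show (Module.finrank ℚ K / 2 - Module.finrank ℚ K / 2 * s : ℂ) =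
    Module.finrank ℚ K / 2 * (1 - s) by ring]
  simp only [smul_eq_mul]
  field_simp
  ring

lemma archFactor_eq (s : ℝ) : archFactor K s = (1 / 2) ^ InfinitePlace.nrRealPlaces K *
    (((1 / Real.pi) ^ (1 / 2 : ℝ)) ^ InfinitePlace.nrRealPlaces K *
      (1 / (2 * Real.pi)) ^ InfinitePlace.nrComplexPlaces K) ^ s *
    (Real.Gamma (s / 2) ^ InfinitePlace.nrRealPlaces K *
      Real.Gamma s ^ InfinitePlace.nrComplexPlaces K) := by
  rw [archFactor, InfinitePlace.prod_eq_prod_mul_prod]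
  have e1 : ∀ w : {w : InfinitePlace K // w.IsReal},
      ((2 / w.1.mult : ℝ)⁻¹ * ((1 / (Real.pi * w.1.mult)) ^ (s / (2 / w.1.mult : ℝ)) *
        Real.Gamma (s / (2 / w.1.mult : ℝ)))) =
      1 / 2 * (((1 / Real.pi) ^ (1 / 2 : ℝ)) ^ s * Real.Gamma (s / 2)) := fun w => by
    rw [InfinitePlace.mult_isReal, ← Real.rpow_mul (by positivity)]
    norm_num
    left
    ring_nf
  have e2 : ∀ w : {w : InfinitePlace K // w.IsComplex},
      ((2 / w.1.mult : ℝ)⁻¹ * ((1 / (Real.pi * w.1.mult)) ^ (s / (2 / w.1.mult : ℝ)) *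
        Real.Gamma (s / (2 / w.1.mult : ℝ)))) =
      (1 / (2 * Real.pi)) ^ s * Real.Gamma s := fun w => by
    rw [InfinitePlace.mult_isComplex]
    norm_num
    left
    ring_nf
  simp_rw [e1, e2]
  rw [Finset.prod_const, Finset.prod_const, Finset.card_univ, Finset.card_univ]
  rw [Real.mul_rpow (by positivity) (by positivity), ← Real.rpow_natCast_mul (by positivity),
    ← Real.rpow_natCast_mul (by positivity), mul_comm _ s, Real.rpow_mul_natCast (by positivity),
    mul_comm _ s, Real.rpow_mul_natCast (by positivity)]
  simp only [InfinitePlace.nrRealPlaces, InfinitePlace.nrComplexPlaces]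
  rw [mul_pow, mul_pow, mul_pow]
  ring

theorem exists_completed_zeta : ∃ c A : ℝ, 0 < c ∧ 0 < A ∧ ∀ s : ℝ, 1 < s →
    xiK K s = c * (s * (s - 1)) * (A ^ s * (Real.Gamma (s / 2) ^ InfinitePlace.nrRealPlaces K *
      Real.Gamma s ^ InfinitePlace.nrComplexPlaces K) * idealZeta K s : ℝ) := by
  obtain ⟨c, h0, ht, hc⟩ := lintegral_thetaTail (K := K)
  have hV := thetaCovolume_pos (K := K)
  refine ⟨c.toReal * (1 / 2) ^ InfinitePlace.nrRealPlaces K, thetaCovolume K *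
    (((1 / Real.pi) ^ (1 / 2 : ℝ)) ^ InfinitePlace.nrRealPlaces K *
      (1 / (2 * Real.pi)) ^ InfinitePlace.nrComplexPlaces K),
    mul_pos (ENNReal.toReal_pos h0 ht) (by positivity), by positivity, fun s hs => ?_⟩
  have hG := Real.Gamma_pos_of_pos (by linarith : 0 < s / 2)
  have hG' := Real.Gamma_pos_of_pos (by linarith : 0 < s)
  have hz : 0 ≤ idealZeta K s := tsum_nonneg fun _ => by positivity
  rw [xiK_eq_mellin hs, hc s hs, archFactor_eq, ENNReal.toReal_mul,
    ENNReal.toReal_ofReal (by positivity), Real.mul_rpow (x := thetaCovolume K) hV.le (by positivity)]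
  push_cast
  ring

end CompletedZeta

section RectangleIntegral

/-- The integral of a function over the boundary of the rectangle `[a, b] × [c, d]`. -/
def rectIntegral (F : ℂ → ℂ) (a b c d : ℝ) : ℂ :=
  (∫ x : ℝ in a..b, F (x + c * I)) - (∫ x : ℝ in a..b, F (x + d * I)) +
    I * (∫ y : ℝ in c..d, F (b + y * I)) - I * ∫ y : ℝ in c..d, F (a + y * I)

/-- The boundary of the rectangle `[a, b] × [c, d]`. -/
def rectBoundary (a b c d : ℝ) : Set ℂ :=
  {z | (z.re ∈ Set.Icc a b ∧ (z.im = c ∨ z.im = d)) ∨ (z.im ∈ Set.Icc c d ∧ (z.re = a ∨ z.re = b))}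

lemma rectIntegral_congr {F G : ℂ → ℂ} {a b c d : ℝ} (hab : a ≤ b) (hcd : c ≤ d)
    (h : ∀ z ∈ rectBoundary a b c d, F z = G z) :
    rectIntegral F a b c d = rectIntegral G a b c d := by
  unfold rectIntegral
  congr 1
  · congr 1
    · congr 1
      · refine intervalIntegral.integral_congr fun x hx => h _ ?_
        rw [Set.uIcc_of_le hab] at hx
        exact Or.inl ⟨by simpa using hx, Or.inl (by simp)⟩
      · refine intervalIntegral.integral_congr fun x hx => h _ ?_
        rw [Set.uIcc_of_le hab] at hx
        exact Or.inl ⟨by simpa using hx, Or.inr (by simp)⟩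
    · congr 1
      refine intervalIntegral.integral_congr fun x hx => h _ ?_
      rw [Set.uIcc_of_le hcd] at hx
      exact Or.inr ⟨by simpa using hx, Or.inr (by simp)⟩
  · congr 1
    refine intervalIntegral.integral_congr fun x hx => h _ ?_
    rw [Set.uIcc_of_le hcd] at hx
    exact Or.inr ⟨by simpa using hx, Or.inl (by simp)⟩

lemma intervalIntegrable_of_rectBoundary {F : ℂ → ℂ} {a b c d : ℝ} (hab : a ≤ b) (hcd : c ≤ d)
    (h : ContinuousOn F (rectBoundary a b c d)) :
    (IntervalIntegrable (fun x : ℝ => F (x + c * I)) volume a b ∧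
      IntervalIntegrable (fun x : ℝ => F (x + d * I)) volume a b) ∧
    (IntervalIntegrable (fun y : ℝ => F (b + y * I)) volume c d ∧
      IntervalIntegrable (fun y : ℝ => F (a + y * I)) volume c d) := by
  refine ⟨⟨?_, ?_⟩, ?_, ?_⟩ <;> refine ContinuousOn.intervalIntegrable ?_ <;>
    refine h.comp (by fun_prop) fun x hx => ?_
  · rw [Set.uIcc_of_le hab] at hx
    exact Or.inl ⟨by simpa using hx, Or.inl (by simp)⟩
  · rw [Set.uIcc_of_le hab] at hx
    exact Or.inl ⟨by simpa using hx, Or.inr (by simp)⟩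
  · rw [Set.uIcc_of_le hcd] at hx
    exact Or.inr ⟨by simpa using hx, Or.inr (by simp)⟩
  · rw [Set.uIcc_of_le hcd] at hx
    exact Or.inr ⟨by simpa using hx, Or.inl (by simp)⟩

lemma rectIntegral_sub {F G : ℂ → ℂ} {a b c d : ℝ} (hab : a ≤ b) (hcd : c ≤ d)
    (hF : ContinuousOn F (rectBoundary a b c d)) (hG : ContinuousOn G (rectBoundary a b c d)) :
    rectIntegral (fun z => F z - G z) a b c d = rectIntegral F a b c d - rectIntegral G a b c d := by
  obtain ⟨⟨h1, h2⟩, h3, h4⟩ := intervalIntegrable_of_rectBoundary hab hcd hF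
  obtain ⟨⟨k1, k2⟩, k3, k4⟩ := intervalIntegrable_of_rectBoundary hab hcd hG
  unfold rectIntegral
  rw [intervalIntegral.integral_sub h1 k1, intervalIntegral.integral_sub h2 k2,
    intervalIntegral.integral_sub h3 k3, intervalIntegral.integral_sub h4 k4]
  ring

lemma rectIntegral_const_mul (r : ℂ) (F : ℂ → ℂ) (a b c d : ℝ) :
    rectIntegral (fun z => r * F z) a b c d = r * rectIntegral F a b c d := by
  simp only [rectIntegral, intervalIntegral.integral_const_mul]
  ring

lemma rectIntegral_eq_zero {F : ℂ → ℂ} {a b c d : ℝ} (hab : a ≤ b) (hcd : c ≤ d)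
    (h : DifferentiableOn ℂ F (Set.Icc a b ×ℂ Set.Icc c d)) : rectIntegral F a b c d = 0 := by
  have := Complex.integral_boundary_rect_eq_zero_of_differentiableOn F ⟨a, c⟩ ⟨b, d⟩
    (by simpa only [Set.uIcc_of_le hab, Set.uIcc_of_le hcd] using h)
  simpa only [rectIntegral, smul_eq_mul] using this

lemma rectBoundary_subset {a b c d : ℝ} (hab : a ≤ b) (hcd : c ≤ d) :
    rectBoundary a b c d ⊆ Set.Icc a b ×ℂ Set.Icc c d := by
  rintro z (⟨h1, h2 | h2⟩ | ⟨h1, h2 | h2⟩)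
  · exact ⟨h1, by rw [Set.mem_preimage, h2]; exact ⟨le_rfl, hcd⟩⟩
  · exact ⟨h1, by rw [Set.mem_preimage, h2]; exact ⟨hcd, le_rfl⟩⟩
  · exact ⟨by rw [Set.mem_preimage, h2]; exact ⟨le_rfl, hab⟩, h1⟩
  · exact ⟨by rw [Set.mem_preimage, h2]; exact ⟨hab, le_rfl⟩, h1⟩

lemma notMem_rectBoundary {a b c d : ℝ} {p : ℂ} (hp : p ∈ Set.Ioo a b ×ℂ Set.Ioo c d) :
    p ∉ rectBoundary a b c d := by
  obtain ⟨⟨h1, h2⟩, h3, h4⟩ := hp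
  rintro (⟨-, h | h⟩ | ⟨-, h | h⟩)
  · exact h3.ne' h
  · exact h4.ne h
  · exact h1.ne' h
  · exact h2.ne h

/-- The residue theorem on a rectangle for finitely many simple poles. -/
theorem rectIntegral_eq_sum_residues {a b c d : ℝ} (hab : a ≤ b) (hcd : c ≤ d) {U : Set ℂ}
    (hU : IsOpen U) (hsub : Set.Icc a b ×ℂ Set.Icc c d ⊆ U) (r : ℂ → ℂ) (S : Finset ℂ)
    (hS : ∀ p ∈ S, p ∈ Set.Ioo a b ×ℂ Set.Ioo c d) (F : ℂ → ℂ)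
    (hF : DifferentiableOn ℂ F (U \ S))
    (hr : ∀ p ∈ S, Tendsto (fun z => (z - p) * F z) (𝓝[≠] p) (𝓝 (r p))) :
    rectIntegral F a b c d = ∑ p ∈ S, r p * rectIntegral (fun z => (z - p)⁻¹) a b c d := by
  induction S using Finset.induction_on generalizing F with
  | empty =>
    rw [Finset.sum_empty]
    refine rectIntegral_eq_zero hab hcd (hF.mono ?_)
    simpa using hsub
  | insert p S hpS ih =>
    have hp := hS p (Finset.mem_insert_self p S)
    have hpb := notMem_rectBoundary hp
    have hpU : p ∈ U := hsub ⟨Set.Ioo_subset_Icc_self hp.1, Set.Ioo_subset_Icc_self hp.2⟩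
    have hopen : IsOpen (U \ (S : Set ℂ)) := hU.sdiff S.finite_toSet.isClosed
    have hcinv : ∀ s : Set ℂ, p ∉ s → DifferentiableOn ℂ (fun z => (z - p)⁻¹) s := fun s hs z hz =>
      ((differentiableAt_id.sub_const p).inv (sub_ne_zero.2 fun h => hs (h ▸ hz))).differentiableWithinAt
    set g : ℂ → ℂ := fun z => F z - r p * (z - p)⁻¹ with hg
    have hgd : DifferentiableOn ℂ g ((U \ S) \ {p}) := by
      refine DifferentiableOn.sub (hF.mono fun z hz => ⟨hz.1.1, ?_⟩) ((hcinv _ (by simp)).const_mul _)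
      simpa using ⟨hz.2, hz.1.2⟩
    have ho : (fun z => g z - g p) =o[𝓝[≠] p] fun z => (z - p)⁻¹ := by
      refine (Asymptotics.isLittleO_iff_tendsto' ?_).2 ?_
      · filter_upwards [self_mem_nhdsWithin] with z hz h0
        exact absurd (inv_eq_zero.1 h0) (sub_ne_zero.2 hz)
      · have h1 := hr p (Finset.mem_insert_self p S)
        have h2 : Tendsto (fun z => (z - p) * g p) (𝓝[≠] p) (𝓝 0) := by
          have : Continuous fun z => (z - p) * g p := by fun_prop
          simpa using (this.tendsto p).mono_left nhdsWithin_le_nhds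
        have h3 := (h1.sub_const (r p)).sub h2
        rw [sub_self, sub_zero] at h3
        refine h3.congr' ?_
        filter_upwards [self_mem_nhdsWithin] with z hz
        have : z - p ≠ 0 := sub_ne_zero.2 hz
        simp only [hg]
        field_simp
    set F' := Function.update g p (limUnder (𝓝[≠] p) g) with hF'
    have hF'd : DifferentiableOn ℂ F' (U \ S) :=
      Complex.differentiableOn_update_limUnder_of_isLittleO
        (hopen.mem_nhds ⟨hpU, by simpa using hpS⟩) hgd ho
    have hF'g : ∀ z, z ≠ p → F' z = g z := fun z hz => Function.update_of_ne hz _ _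
    have hres : ∀ q ∈ S, Tendsto (fun z => (z - q) * F' z) (𝓝[≠] q) (𝓝 (r q)) := by
      intro q hq
      have hqp : q ≠ p := fun h => hpS (h ▸ hq)
      have h1 := hr q (Finset.mem_insert_of_mem hq)
      have h2 : Tendsto (fun z => (z - q) * (r p * (z - p)⁻¹)) (𝓝[≠] q) (𝓝 0) := by
        have : ContinuousAt (fun z => (z - q) * (r p * (z - p)⁻¹)) q := by
          have := sub_ne_zero.2 hqp
          fun_prop (disch := assumption)
        simpa [ContinuousAt] using this.tendsto.mono_left nhdsWithin_le_nhds
      have h3 := h1.sub h2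
      rw [sub_zero] at h3
      refine h3.congr' ?_
      filter_upwards [nhdsWithin_le_nhds (isOpen_ne.mem_nhds hqp)] with z hz
      rw [hF'g z hz, hg]
      ring
    have hbd : rectBoundary a b c d ⊆ U \ (insert p S : Finset ℂ) := by
      refine fun z hz => ⟨hsub (rectBoundary_subset hab hcd hz), fun hzS => ?_⟩
      exact notMem_rectBoundary (hS z hzS) hz
    have key := ih (fun q hq => hS q (Finset.mem_insert_of_mem hq)) F' hF'd hres
    rw [rectIntegral_congr hab hcd fun z hz => hF'g z fun h => hpb (h ▸ hz), hg,
      rectIntegral_sub hab hcd (hF.continuousOn.mono hbd)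
        ((hcinv _ hpb).continuousOn.const_mul _), rectIntegral_const_mul] at key
    rw [Finset.sum_insert hpS, ← key]
    ring

end RectangleIntegral

section Recurrence

/-- Simultaneous recurrence: finitely many exponentials `e^{iγT}` are close to `1` at some large
time `T`. -/
theorem exists_recurrence (S : Finset ℝ) {η : ℝ} (hη : 0 < η) (T₀ : ℝ) :
    ∃ T : ℝ, T₀ ≤ T ∧ ∀ γ ∈ S, ‖1 - cexp (γ * I * T)‖ < η := by
  set T₁ := max T₀ 1
  have hT₁ : 0 < T₁ := one_pos.trans_le (le_max_right _ _)
  let x : ℕ → (S → ℂ) := fun n γ => cexp ((γ.1 * (n * T₁) : ℝ) * I)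
  have hx : ∀ n, x n ∈ Set.pi Set.univ fun _ : S => Metric.closedBall (0 : ℂ) 1 := fun n γ _ => by
    simp only [x, mem_closedBall_zero_iff]
    rw [norm_exp_ofReal_mul_I]
  obtain ⟨a, -, φ, hφ, hlim⟩ :=
    (isCompact_univ_pi fun _ : S => isCompact_closedBall (0 : ℂ) 1).tendsto_subseq hx
  obtain ⟨N, hN⟩ := Metric.cauchySeq_iff'.1 hlim.cauchySeq η hη
  have h := hN (N + 1) (Nat.le_succ N)
  have hlt : φ N < φ (N + 1) := hφ (Nat.lt_succ_self N)
  obtain ⟨m, hm⟩ := Nat.exists_eq_add_of_lt hlt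
  refine ⟨(m + 1 : ℕ) * T₁, ?_, fun γ hγ => ?_⟩
  · refine (le_max_left T₀ 1).trans (le_mul_of_one_le_left hT₁.le ?_)
    exact_mod_cast Nat.succ_le_succ (Nat.zero_le m)
  · have h2 := (dist_le_pi_dist _ _ (⟨γ, hγ⟩ : S)).trans_lt h
    simp only [x, Function.comp_apply, dist_eq_norm] at h2
    have e : cexp ((γ * (φ (N + 1) * T₁) : ℝ) * I) - cexp ((γ * (φ N * T₁) : ℝ) * I) =
        -(cexp ((γ * (φ N * T₁) : ℝ) * I) * (1 - cexp (γ * I * ((m + 1 : ℕ) * T₁ : ℝ)))) := by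
      rw [mul_sub, mul_one, ← Complex.exp_add, hm]
      push_cast
      ring_nf
    rwa [e, norm_neg, norm_mul, norm_exp_ofReal_mul_I, one_mul] at h2

end Recurrence

section Laplace

/-- The two-sided Laplace transform. -/
def lap (h : ℝ → ℝ) (z : ℂ) : ℂ := ∫ t : ℝ, (h t : ℂ) * cexp (-z * t)

lemma norm_mul_cexp (h : ℝ → ℝ) (z : ℂ) (t : ℝ) :
    ‖(h t : ℂ) * cexp (-z * t)‖ = |h t| * Real.exp (-z.re * t) := by
  rw [norm_mul, norm_real, Real.norm_eq_abs, Complex.norm_exp]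
  simp

lemma integrable_mul_cexp {h : ℝ → ℝ} (hm : Measurable h) {z : ℂ}
    (hi : Integrable fun t => h t * Real.exp (-z.re * t)) :
    Integrable fun t : ℝ => (h t : ℂ) * cexp (-z * t) := by
  refine Integrable.mono' hi.norm (by fun_prop) (ae_of_all _ fun t => ?_)
  rw [norm_mul_cexp, norm_mul, Real.norm_eq_abs, Real.norm_eq_abs, Real.abs_exp]

lemma norm_lap_le (h : ℝ → ℝ) (z : ℂ) : ‖lap h z‖ ≤ ∫ t, |h t| * Real.exp (-z.re * t) := by
  refine (norm_integral_le_integral_norm _).trans_eq ?_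
  simp only [norm_mul_cexp]

lemma differentiableAt_lap {h : ℝ → ℝ} (hm : Measurable h) {z : ℂ} {r : ℝ} (hr : 0 < r)
    (h₁ : Integrable fun t => h t * Real.exp (-(z.re - 2 * r) * t))
    (h₀ : Integrable fun t => h t * Real.exp (-z.re * t))
    (h₂ : Integrable fun t => h t * Real.exp (-(z.re + 2 * r) * t)) :
    DifferentiableAt ℂ (lap h) z := by
  have hs : {w : ℂ | |w.re - z.re| < r} ∈ 𝓝 z := by
    refine IsOpen.mem_nhds (isOpen_lt (by fun_prop) continuous_const) ?_
    simpa using hr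
  refine (hasDerivAt_integral_of_dominated_loc_of_deriv_le (μ := volume)
    (F := fun w t => (h t : ℂ) * cexp (-w * t))
    (F' := fun w t => (h t : ℂ) * (cexp (-w * t) * (-1 * t)))
    (bound := fun t => r⁻¹ * (‖h t * Real.exp (-(z.re - 2 * r) * t)‖ +
      ‖h t * Real.exp (-(z.re + 2 * r) * t)‖)) hs
    (Eventually.of_forall fun w => by fun_prop) (integrable_mul_cexp hm h₀) (by fun_prop)
    (ae_of_all _ fun t w hw => ?_) ((h₁.norm.add h₂.norm).const_mul _)
    (ae_of_all _ fun t w _ => ?_)).2.differentiableAt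
  · replace hw : |w.re - z.re| < r := hw
    have e1 : ‖(h t : ℂ) * (cexp (-w * t) * (-1 * t))‖ = |h t| * (|t| * Real.exp (-w.re * t)) := by
      rw [norm_mul, norm_real, Real.norm_eq_abs, norm_mul, Complex.norm_exp]
      simp [mul_comm]
    rw [e1]
    simp only [norm_mul, Real.norm_eq_abs, Real.abs_exp]
    rw [← mul_add, mul_left_comm r⁻¹]
    refine mul_le_mul_of_nonneg_left ?_ (abs_nonneg (h t))
    have h3 : |t| ≤ r⁻¹ * Real.exp (r * |t|) := by
      rw [inv_mul_eq_div, le_div_iff₀ hr]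
      linarith [Real.add_one_le_exp (r * |t|), mul_comm r |t|]
    have h4 : -w.re * t ≤ -z.re * t + r * |t| := by
      have : (z.re - w.re) * t ≤ r * |t| := by
        refine (le_abs_self ((z.re - w.re) * t)).trans ?_
        rw [abs_mul, abs_sub_comm]
        exact mul_le_mul_of_nonneg_right hw.le (abs_nonneg t)
      linarith
    calc |t| * Real.exp (-w.re * t) ≤ (r⁻¹ * Real.exp (r * |t|)) * Real.exp (-z.re * t + r * |t|) := by
          gcongr
      _ = r⁻¹ * Real.exp (-z.re * t + 2 * r * |t|) := by
          rw [mul_assoc, ← Real.exp_add]; ring_nf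
      _ ≤ _ := by
          refine mul_le_mul_of_nonneg_left ?_ (inv_nonneg.2 hr.le)
          rcases abs_cases (t : ℝ) with ⟨h5, _⟩ | ⟨h5, _⟩ <;> rw [h5]
          · have : -z.re * t + 2 * r * t = -(z.re - 2 * r) * t := by ring
            rw [this]
            linarith [Real.exp_pos (-(z.re + 2 * r) * t)]
          · have : -z.re * t + 2 * r * -t = -(z.re + 2 * r) * t := by ring
            rw [this]
            linarith [Real.exp_pos (-(z.re - 2 * r) * t)]
  · refine HasDerivAt.const_mul _ (HasDerivAt.cexp ?_)
    exact ((hasDerivAt_id w).neg.mul_const (t : ℂ))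

/-- Gaussian smoothing of a function expressed through its Laplace transform. -/
lemma integral_lap_mul_gaussian {h : ℝ → ℝ} (hm : Measurable h) {c : ℝ}
    (hi : Integrable fun t => h t * Real.exp (-c * t)) {δ : NNReal} (hδ : δ ≠ 0) (p : ℝ) :
    Integrable (fun y : ℝ => lap h (c + y * I) *
      cexp ((δ / 2 : ℝ) * (c + y * I) ^ 2 + p * (c + y * I))) ∧
    ∫ y : ℝ, lap h (c + y * I) * cexp ((δ / 2 : ℝ) * (c + y * I) ^ 2 + p * (c + y * I)) =
      2 * Real.pi * ((∫ t, h t * ProbabilityTheory.gaussianPDFReal p δ t : ℝ) : ℂ) := by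
  have hδ' : 0 < (δ : ℝ) := by positivity
  set F : ℝ → ℝ → ℂ := fun y t => (h t : ℂ) * cexp (-(c + y * I) * t) *
    cexp ((δ / 2 : ℝ) * (c + y * I) ^ 2 + p * (c + y * I)) with hF
  have hg : Integrable fun y : ℝ => Real.exp (-(δ / 2) * y ^ 2) := integrable_exp_neg_mul_sq (by positivity)
  have hFi : Integrable (Function.uncurry F) (volume.prod volume) := by
    have h1 := ((hg.const_mul (Real.exp ((δ / 2) * c ^ 2 + p * c))).mul_prod hi.norm)
    refine Integrable.mono' h1 ?_ (ae_of_all _ fun z => ?_)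
    · refine Measurable.aestronglyMeasurable ?_
      simp only [hF, Function.uncurry_def]
      fun_prop
    · obtain ⟨y, t⟩ := z
      simp only [hF, Function.uncurry]
      rw [norm_mul, norm_mul_cexp, Complex.norm_exp, norm_mul, Real.norm_eq_abs, Real.norm_eq_abs,
        Real.abs_exp, ← Real.exp_add]
      refine le_of_eq ?_
      have e1 : ((δ / 2 : ℝ) * (c + y * I) ^ 2 + p * (c + y * I) : ℂ).re =
          δ / 2 * c ^ 2 + p * c + -(δ / 2) * y ^ 2 := by
        simp [pow_two]
        ring
      rw [e1]
      simp
      ring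
  have e : ∀ y : ℝ, lap h (c + y * I) * cexp ((δ / 2 : ℝ) * (c + y * I) ^ 2 + p * (c + y * I)) =
      ∫ t, F y t := fun y => by
    rw [lap, ← integral_mul_const]
  simp only [e]
  refine ⟨hFi.integral_prod_left, ?_⟩
  rw [integral_integral_swap hFi, ← integral_complex_ofReal, ← integral_const_mul]
  congr 1
  funext t
  have e2 : ∀ y : ℝ, F y t = h t * cexp (-((δ / 2 : ℝ) : ℂ) * y ^ 2 + (δ * c + p - t) * I * y +
      (-c * t + δ / 2 * c ^ 2 + p * c)) := fun y => by
    simp only [hF]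
    rw [mul_assoc, ← Complex.exp_add]
    congr 2
    push_cast
    ring_nf
    rw [I_sq]
    ring
  simp only [e2]
  rw [integral_const_mul, _root_.integral_cexp_quadratic (by simpa using hδ')]
  rw [ProbabilityTheory.gaussianPDFReal]
  have hpi := Real.pi_pos
  have e3 : ((Real.pi : ℂ) / -(-((δ / 2 : ℝ) : ℂ))) ^ (1 / 2 : ℂ) =
      ((2 * Real.pi * (√(2 * Real.pi * δ))⁻¹ : ℝ) : ℂ) := by
    have h5 : (Real.pi : ℂ) / -(-((δ / 2 : ℝ) : ℂ)) = ((Real.pi / (δ / 2) : ℝ) : ℂ) := by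
      push_cast; ring
    have h6 : (1 / 2 : ℂ) = ((1 / 2 : ℝ) : ℂ) := by push_cast; ring
    rw [h5, h6, ← ofReal_cpow (by positivity), ← Real.sqrt_eq_rpow]
    congr 1
    have h7 : Real.pi / (δ / 2) = (2 * Real.pi) ^ 2 / (2 * Real.pi * δ) := by
      field_simp
    rw [h7, Real.sqrt_div (by positivity), Real.sqrt_sq (by positivity)]
    rfl
  rw [e3]
  have e4 : cexp ((-c * t + δ / 2 * c ^ 2 + p * c) - ((δ * c + p - t) * I) ^ 2 / (4 * -((δ / 2 : ℝ) : ℂ))) =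
      ((Real.exp (-(t - p) ^ 2 / (2 * δ)) : ℝ) : ℂ) := by
    rw [ofReal_exp]
    congr 1
    have : (δ : ℂ) ≠ 0 := by exact_mod_cast hδ'.ne'
    push_cast
    rw [mul_pow, I_sq]
    field_simp
    ring
  rw [e4]
  push_cast
  ring

end Laplace

section LaplaceBounds

variable {h : ℝ → ℝ} {C : ℝ}

lemma laplace_integrable_right (hm : Measurable h) (hC : ∀ t, |h t| ≤ C) (h0 : ∀ t ≤ 0, h t = 0)
    {x : ℝ} (hx : 0 < x) :
    Integrable (fun t => h t * Real.exp (-x * t)) ∧ ∫ t, |h t| * Real.exp (-x * t) ≤ C / x := by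
  have hi : IntegrableOn (fun t : ℝ => Real.exp (-x * t)) (Set.Ioi 0) :=
    integrableOn_exp_mul_Ioi (by linarith) 0
  have hb : ∀ t, |h t| * Real.exp (-x * t) ≤
      (Set.Ioi (0 : ℝ)).indicator (fun t => C * Real.exp (-x * t)) t := fun t => by
    by_cases ht : 0 < t
    · rw [Set.indicator_of_mem (by exact ht)]
      exact mul_le_mul_of_nonneg_right (hC t) (Real.exp_pos _).le
    · rw [Set.indicator_of_notMem (by exact ht), h0 t (not_lt.1 ht)]
      simp
  have hbi := (integrable_indicator_iff measurableSet_Ioi).2 (hi.const_mul C)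
  have h1 : Integrable (fun t => h t * Real.exp (-x * t)) := by
    refine hbi.mono' (by fun_prop) (ae_of_all _ fun t => ?_)
    rw [norm_mul, Real.norm_eq_abs, Real.norm_eq_abs, Real.abs_exp]
    exact hb t
  refine ⟨h1, ?_⟩
  have h2 : Integrable (fun t => |h t| * Real.exp (-x * t)) := by
    refine h1.norm.congr (ae_of_all _ fun t => ?_)
    simp only [norm_mul, Real.norm_eq_abs, Real.abs_exp]
  refine (integral_mono h2 hbi hb).trans_eq ?_
  rw [integral_indicator measurableSet_Ioi, integral_const_mul, integral_exp_mul_Ioi (by linarith)]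
  simp
  rfl

lemma laplace_integrable_left (hm : Measurable h) (hC : ∀ t, |h t| ≤ C) (h0 : ∀ t, 0 < t → h t = 0)
    {x : ℝ} (hx : x < 0) :
    Integrable (fun t => h t * Real.exp (-x * t)) ∧ ∫ t, |h t| * Real.exp (-x * t) ≤ C / -x := by
  have hi : IntegrableOn (fun t : ℝ => Real.exp (-x * t)) (Set.Iic 0) :=
    integrableOn_exp_mul_Iic (by linarith) 0
  have hb : ∀ t, |h t| * Real.exp (-x * t) ≤
      (Set.Iic (0 : ℝ)).indicator (fun t => C * Real.exp (-x * t)) t := fun t => by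
    by_cases ht : t ≤ 0
    · rw [Set.indicator_of_mem (by exact ht)]
      exact mul_le_mul_of_nonneg_right (hC t) (Real.exp_pos _).le
    · rw [Set.indicator_of_notMem (by exact ht), h0 t (not_le.1 ht)]
      simp
  have hbi := (integrable_indicator_iff measurableSet_Iic).2 (hi.const_mul C)
  have h1 : Integrable (fun t => h t * Real.exp (-x * t)) := by
    refine hbi.mono' (by fun_prop) (ae_of_all _ fun t => ?_)
    rw [norm_mul, Real.norm_eq_abs, Real.norm_eq_abs, Real.abs_exp]
    exact hb t
  refine ⟨h1, ?_⟩
  have h2 : Integrable (fun t => |h t| * Real.exp (-x * t)) := by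
    refine h1.norm.congr (ae_of_all _ fun t => ?_)
    simp only [norm_mul, Real.norm_eq_abs, Real.abs_exp]
  refine (integral_mono h2 hbi hb).trans_eq ?_
  rw [integral_indicator measurableSet_Iic, integral_const_mul, integral_exp_mul_Iic (by linarith)]
  simp [div_eq_mul_inv]

lemma norm_lap_le_right (hm : Measurable h) (hC : ∀ t, |h t| ≤ C) (h0 : ∀ t ≤ 0, h t = 0)
    {z : ℂ} (hz : 0 < z.re) : ‖lap h z‖ ≤ C / z.re :=
  (norm_lap_le h z).trans (laplace_integrable_right hm hC h0 hz).2

lemma norm_lap_le_left (hm : Measurable h) (hC : ∀ t, |h t| ≤ C) (h0 : ∀ t, 0 < t → h t = 0)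
    {z : ℂ} (hz : z.re < 0) : ‖lap h z‖ ≤ C / -z.re :=
  (norm_lap_le h z).trans (laplace_integrable_left hm hC h0 hz).2

lemma differentiableAt_lap_right (hm : Measurable h) (hC : ∀ t, |h t| ≤ C) (h0 : ∀ t ≤ 0, h t = 0)
    {z : ℂ} (hz : 0 < z.re) : DifferentiableAt ℂ (lap h) z := by
  refine differentiableAt_lap hm (r := z.re / 4) (by linarith) ?_ ?_ ?_ <;>
    exact (laplace_integrable_right hm hC h0 (by linarith)).1

lemma differentiable_lap_of_support (hm : Measurable h) (hC : ∀ t, |h t| ≤ C) {T : ℝ}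
    (h0 : ∀ t, t ∉ Set.Icc (-T) 0 → h t = 0) : Differentiable ℂ (lap h) := by
  have key : ∀ x : ℝ, Integrable fun t => h t * Real.exp (-x * t) := fun x => by
    have h1 : IntegrableOn (fun t => h t * Real.exp (-x * t)) (Set.Icc (-T) 0) := by
      have h2 : IntegrableOn (fun t : ℝ => C * Real.exp (-x * t)) (Set.Icc (-T) 0) :=
        (Continuous.integrableOn_Icc (by fun_prop))
      refine Integrable.mono' h2 (by fun_prop) (ae_of_all _ fun t => ?_)
      rw [norm_mul, Real.norm_eq_abs, Real.norm_eq_abs, Real.abs_exp]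
      exact mul_le_mul_of_nonneg_right (hC t) (Real.exp_pos _).le
    refine (integrableOn_iff_integrable_of_support_subset fun t ht => ?_).1 h1
    by_contra hn
    exact ht (by simp [h0 t hn])
  exact fun z => differentiableAt_lap hm one_pos (key _) (key _) (key _)

end LaplaceBounds

section Shift

variable {f : ℝ → ℝ} {C : ℝ}

/-- The part of `f(t) - f(t + T)` on `t > 0`. -/
def shiftPos (f : ℝ → ℝ) (T t : ℝ) : ℝ := if 0 < t then f t - f (t + T) else 0

/-- The part of `f(t + T)` on `t ≤ 0`. -/
def shiftNeg (f : ℝ → ℝ) (T t : ℝ) : ℝ := if 0 < t then 0 else f (t + T)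

lemma measurable_shiftPos (hm : Measurable f) (T : ℝ) : Measurable (shiftPos f T) :=
  Measurable.ite measurableSet_Ioi (by fun_prop) measurable_const

lemma measurable_shiftNeg (hm : Measurable f) (T : ℝ) : Measurable (shiftNeg f T) :=
  Measurable.ite measurableSet_Ioi measurable_const (by fun_prop)

lemma abs_shiftPos_le (hC : ∀ t, |f t| ≤ C) (T t : ℝ) : |shiftPos f T t| ≤ 2 * C := by
  unfold shiftPos
  split_ifs
  · calc |f t - f (t + T)| ≤ |f t| + |f (t + T)| := abs_sub _ _
      _ ≤ 2 * C := by linarith [hC t, hC (t + T)]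
  · simpa using (abs_nonneg (f 0)).trans (hC 0)

lemma abs_shiftNeg_le (hC : ∀ t, |f t| ≤ C) (T t : ℝ) : |shiftNeg f T t| ≤ C := by
  unfold shiftNeg
  split_ifs
  · simpa using (abs_nonneg (f 0)).trans (hC 0)
  · exact hC _

lemma shiftPos_of_nonpos (T : ℝ) {t : ℝ} (ht : t ≤ 0) : shiftPos f T t = 0 := if_neg (not_lt.2 ht)

lemma shiftNeg_of_pos (T : ℝ) {t : ℝ} (ht : 0 < t) : shiftNeg f T t = 0 := if_pos ht

lemma shiftNeg_of_notMem (h0 : ∀ t ≤ 0, f t = 0) {T t : ℝ} (ht : t ∉ Set.Icc (-T) 0) :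
    shiftNeg f T t = 0 := by
  unfold shiftNeg
  split_ifs with h
  · rfl
  · refine h0 _ ?_
    by_contra h1
    exact ht ⟨by linarith, not_lt.1 h⟩

lemma shiftPos_sub_shiftNeg (h0 : ∀ t ≤ 0, f t = 0) (T t : ℝ) :
    shiftPos f T t - shiftNeg f T t = f t - f (t + T) := by
  unfold shiftPos shiftNeg
  split_ifs with h
  · ring
  · rw [h0 t (not_lt.1 h)]

lemma lap_shift {f : ℝ → ℝ} (T : ℝ) (z : ℂ) :
    lap (fun t => f (t + T)) z = cexp (z * T) * lap f z := by
  unfold lap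
  rw [← integral_const_mul, ← integral_add_right_eq_self
    (fun t : ℝ => cexp (z * T) * ((f t : ℂ) * cexp (-z * t))) T]
  congr 1
  funext t
  rw [mul_left_comm, ← Complex.exp_add]
  push_cast
  ring_nf

lemma lap_shiftPos (hm : Measurable f) (hC : ∀ t, |f t| ≤ C) (h0 : ∀ t ≤ 0, f t = 0) (T : ℝ)
    {z : ℂ} (hz : 0 < z.re) :
    lap (shiftPos f T) z = lap f z * (1 - cexp (z * T)) + lap (shiftNeg f T) z := by
  have i1 := integrable_mul_cexp hm (laplace_integrable_right hm hC h0 hz).1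
  have i2 := integrable_mul_cexp (measurable_shiftPos hm T) (laplace_integrable_right
    (measurable_shiftPos hm T) (abs_shiftPos_le hC T) (fun t => shiftPos_of_nonpos T) hz).1
  have i3 : Integrable fun t : ℝ => (f (t + T) : ℂ) * cexp (-z * t) := by
    have := (i1.comp_add_right T).const_mul (cexp (z * T))
    refine this.congr (ae_of_all _ fun t => ?_)
    simp only
    rw [mul_left_comm, ← Complex.exp_add]
    push_cast
    ring_nf
  have e : ∀ t : ℝ, (shiftNeg f T t : ℂ) * cexp (-z * t) =
      (shiftPos f T t : ℂ) * cexp (-z * t) - (f t : ℂ) * cexp (-z * t) +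
        (f (t + T) : ℂ) * cexp (-z * t) := fun t => by
    have h1 : (shiftPos f T t : ℂ) - shiftNeg f T t = f t - f (t + T) := by
      exact_mod_cast congrArg (fun x : ℝ => (x : ℂ)) (shiftPos_sub_shiftNeg h0 T t)
    linear_combination -cexp (-z * t) * h1
  have h2 : lap (shiftNeg f T) z = lap (shiftPos f T) z - lap f z + lap (fun t => f (t + T)) z := by
    unfold lap
    rw [← integral_sub i2 i1]
    exact (integral_congr_ae (ae_of_all _ e)).trans (integral_add (i2.sub i1) i3)
  rw [h2, lap_shift]
  ring

end Shift

section TestFunction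

lemma norm_sinh_le_exp (w : ℂ) : ‖Complex.sinh w‖ ≤ Real.exp |w.re| := by
  have h1 : Real.exp w.re ≤ Real.exp |w.re| := Real.exp_le_exp.2 (le_abs_self _)
  have h2 : Real.exp (-w.re) ≤ Real.exp |w.re| := Real.exp_le_exp.2 (neg_le_abs _)
  have h3 := norm_sub_le (cexp w) (cexp (-w))
  rw [Complex.norm_exp, Complex.norm_exp, neg_re] at h3
  rw [Complex.sinh, norm_div, Complex.norm_ofNat]
  linarith

lemma norm_cosh_le_exp (w : ℂ) : ‖Complex.cosh w‖ ≤ Real.exp |w.re| := by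
  have h1 : Real.exp w.re ≤ Real.exp |w.re| := Real.exp_le_exp.2 (le_abs_self _)
  have h2 : Real.exp (-w.re) ≤ Real.exp |w.re| := Real.exp_le_exp.2 (neg_le_abs _)
  have h3 := norm_add_le (cexp w) (cexp (-w))
  rw [Complex.norm_exp, Complex.norm_exp, neg_re] at h3
  rw [Complex.cosh, norm_div, Complex.norm_ofNat]
  linarith

lemma norm_sinh_le_two_mul {w : ℂ} (hw : ‖w‖ ≤ 1) : ‖Complex.sinh w‖ ≤ 2 * ‖w‖ := by
  have h1 := Complex.norm_exp_sub_one_le hw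
  have h2 := Complex.norm_exp_sub_one_le (x := -w) (by rwa [norm_neg])
  rw [norm_neg] at h2
  have h3 := norm_sub_le (cexp w - 1) (cexp (-w) - 1)
  rw [sub_sub_sub_cancel_right] at h3
  rw [Complex.sinh, norm_div, Complex.norm_ofNat]
  linarith

lemma norm_sinh_le_sqrt {w : ℂ} (hw : |w.re| ≤ 1) : ‖Complex.sinh w‖ ≤ 3 * √‖w‖ := by
  by_cases h : ‖w‖ ≤ 1
  · have h1 := norm_sinh_le_two_mul h
    have h2 : ‖w‖ ≤ √‖w‖ := Real.le_sqrt_of_sq_le (by nlinarith [norm_nonneg w])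
    linarith [norm_nonneg w]
  · have h1 : 1 ≤ √‖w‖ := by rw [Real.one_le_sqrt]; linarith
    have h2 := (norm_sinh_le_exp w).trans (Real.exp_le_exp.2 hw)
    linarith [Real.exp_one_lt_d9]

/-- The entire test function `e^{δz²/2} (sinh((ε+κ)z) + sinh((ε-κ)z))`. -/
def testFn (δ ε κ : ℝ) (z : ℂ) : ℂ :=
  cexp ((δ / 2 : ℝ) * z ^ 2) * (2 * Complex.sinh (ε * z) * Complex.cosh (κ * z))

lemma differentiable_testFn (δ ε κ : ℝ) : Differentiable ℂ (testFn δ ε κ) := by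
  unfold testFn
  fun_prop

lemma testFn_eq (δ ε κ : ℝ) (z : ℂ) : testFn δ ε κ z =
    (1 / 2) * (cexp ((δ / 2 : ℝ) * z ^ 2 + (ε + κ : ℝ) * z) +
      cexp ((δ / 2 : ℝ) * z ^ 2 + (ε - κ : ℝ) * z) -
      cexp ((δ / 2 : ℝ) * z ^ 2 + (-(ε + κ) : ℝ) * z) -
      cexp ((δ / 2 : ℝ) * z ^ 2 + (-(ε - κ) : ℝ) * z)) := by
  have h1 : ∀ p : ℝ, cexp ((δ / 2 : ℝ) * z ^ 2 + p * z) = cexp ((δ / 2 : ℝ) * z ^ 2) * cexp (p * z) :=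
    fun p => Complex.exp_add _ _
  have h2 : cexp ((ε + κ : ℝ) * z) = cexp (ε * z) * cexp (κ * z) := by
    rw [← Complex.exp_add]; push_cast; ring_nf
  have h3 : cexp ((ε - κ : ℝ) * z) = cexp (ε * z) * cexp (-(κ * z)) := by
    rw [← Complex.exp_add]; push_cast; ring_nf
  have h4 : cexp ((-(ε + κ) : ℝ) * z) = cexp (-(ε * z)) * cexp (-(κ * z)) := by
    rw [← Complex.exp_add]; push_cast; ring_nf
  have h5 : cexp ((-(ε - κ) : ℝ) * z) = cexp (-(ε * z)) * cexp (κ * z) := by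
    rw [← Complex.exp_add]; push_cast; ring_nf
  rw [h1, h1, h1, h1, h2, h3, h4, h5, testFn, Complex.sinh, Complex.cosh]
  ring

variable {δ ε κ : ℝ}

lemma norm_testFn (z : ℂ) : ‖testFn δ ε κ z‖ = Real.exp (δ / 2 * (z.re ^ 2 - z.im ^ 2)) *
    (2 * ‖Complex.sinh (ε * z)‖ * ‖Complex.cosh (κ * z)‖) := by
  rw [testFn, norm_mul, norm_mul, norm_mul, Complex.norm_ofNat, Complex.norm_exp]
  congr 2
  simp [pow_two]

lemma exp_quadratic_le (hδ0 : 0 < δ) (hδ1 : δ ≤ 1) {z : ℂ} (hz : |z.re| ≤ 1) :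
    Real.exp (δ / 2 * (z.re ^ 2 - z.im ^ 2)) ≤ Real.exp 1 * Real.exp (-(δ / 2) * z.im ^ 2) := by
  rw [← Real.exp_add]
  refine Real.exp_le_exp.2 ?_
  have : z.re ^ 2 ≤ 1 := (sq_le_one_iff_abs_le_one _).2 hz
  nlinarith

lemma norm_cosh_mul_le (hκ0 : 0 ≤ κ) (hκ1 : κ ≤ 1) {z : ℂ} (hz : |z.re| ≤ 1) :
    ‖Complex.cosh (κ * z)‖ ≤ Real.exp 1 := by
  refine (norm_cosh_le_exp _).trans (Real.exp_le_exp.2 ?_)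
  rw [re_ofReal_mul, abs_mul, abs_of_nonneg hκ0]
  exact mul_le_one₀ hκ1 (abs_nonneg _) hz

lemma norm_sinh_mul_le (hε0 : 0 ≤ ε) (hε1 : ε ≤ 1) {z : ℂ} (hz : |z.re| ≤ 1) :
    ‖Complex.sinh (ε * z)‖ ≤ Real.exp 1 := by
  refine (norm_sinh_le_exp _).trans (Real.exp_le_exp.2 ?_)
  rw [re_ofReal_mul, abs_mul, abs_of_nonneg hε0]
  exact mul_le_one₀ hε1 (abs_nonneg _) hz

lemma exp_three_eq : Real.exp 3 = Real.exp 1 * Real.exp 1 * Real.exp 1 := by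
  rw [← Real.exp_add, ← Real.exp_add]; norm_num

lemma norm_testFn_le (hδ0 : 0 < δ) (hδ1 : δ ≤ 1) (hε0 : 0 ≤ ε) (hε1 : ε ≤ 1) (hκ0 : 0 ≤ κ)
    (hκ1 : κ ≤ 1) {z : ℂ} (hz : |z.re| ≤ 1) :
    ‖testFn δ ε κ z‖ ≤ 2 * Real.exp 3 * Real.exp (-(δ / 2) * z.im ^ 2) := by
  rw [norm_testFn]
  calc _ ≤ (Real.exp 1 * Real.exp (-(δ / 2) * z.im ^ 2)) * (2 * Real.exp 1 * Real.exp 1) := by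
        gcongr
        · exact exp_quadratic_le hδ0 hδ1 hz
        · exact norm_sinh_mul_le hε0 hε1 hz
        · exact norm_cosh_mul_le hκ0 hκ1 hz
    _ = _ := by rw [exp_three_eq]; ring

lemma norm_testFn_le_of_cos_eq_zero (hδ0 : 0 < δ) (hδ1 : δ ≤ 1) (hε0 : 0 ≤ ε) (hε1 : ε ≤ 1)
    (hκ0 : 0 ≤ κ) (hκ1 : κ ≤ 1 / 2) {z : ℂ} (hz : |z.re| ≤ 1) (hcos : Real.cos (κ * z.im) = 0) :
    ‖testFn δ ε κ z‖ ≤ 2 * Real.exp 3 * Real.exp (-(δ / 2) * z.im ^ 2) * |z.re| := by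
  have hsin : |Real.sin (κ * z.im)| ≤ 1 := Real.abs_sin_le_one _
  have h1 : Complex.cosh (κ * z) = Complex.sinh ((κ * z.re : ℝ)) * (Real.sin (κ * z.im)) * I := by
    have : (κ * z : ℂ) = ((κ * z.re : ℝ) : ℂ) + ((κ * z.im : ℝ) : ℂ) * I := by
      conv_lhs => rw [← re_add_im z]
      push_cast
      ring
    rw [this, Complex.cosh_add, Complex.cosh_mul_I, Complex.sinh_mul_I, ← ofReal_cos, hcos, ofReal_sin]
    simp
    ring
  have h2 : ‖Complex.cosh (κ * z)‖ ≤ |z.re| := by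
    rw [h1, norm_mul, norm_mul, norm_I, mul_one, norm_real, Real.norm_eq_abs]
    have h3 : ‖((κ * z.re : ℝ) : ℂ)‖ = κ * |z.re| := by
      rw [norm_real, Real.norm_eq_abs, abs_mul, abs_of_nonneg hκ0]
    have h4 := norm_sinh_le_two_mul (w := ((κ * z.re : ℝ) : ℂ)) (by
      rw [h3]
      exact mul_le_one₀ (by linarith) (abs_nonneg _) hz)
    rw [h3] at h4
    calc _ ≤ (2 * (κ * |z.re|)) * 1 := by gcongr
      _ ≤ |z.re| := by nlinarith [abs_nonneg z.re]
  rw [norm_testFn]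
  have he : 1 ≤ Real.exp 1 := Real.one_le_exp zero_le_one
  calc _ ≤ (Real.exp 1 * Real.exp (-(δ / 2) * z.im ^ 2)) * (2 * Real.exp 1 * |z.re|) := by
        gcongr
        · exact exp_quadratic_le hδ0 hδ1 hz
        · exact norm_sinh_mul_le hε0 hε1 hz
    _ ≤ (Real.exp 1 * Real.exp (-(δ / 2) * z.im ^ 2)) * (2 * Real.exp 1 * |z.re|) * Real.exp 1 :=
        le_mul_of_one_le_right (by positivity) he
    _ = _ := by rw [exp_three_eq]; ring

lemma norm_testFn_le_aux (hδ0 : 0 < δ) (hδ1 : δ ≤ 1) (hκ0 : 0 ≤ κ) (hκ1 : κ ≤ 1) {z : ℂ}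
    (hz : |z.re| ≤ 1) : ‖testFn δ ε κ z‖ ≤ 2 * Real.exp 3 * ‖Complex.sinh (ε * z)‖ := by
  rw [norm_testFn]
  have he : 1 ≤ Real.exp 1 := Real.one_le_exp zero_le_one
  have h1 : Real.exp (δ / 2 * (z.re ^ 2 - z.im ^ 2)) ≤ Real.exp 1 := by
    refine (exp_quadratic_le hδ0 hδ1 hz).trans (mul_le_of_le_one_right (by positivity) ?_)
    rw [Real.exp_le_one_iff]
    nlinarith [sq_nonneg z.im]
  calc _ ≤ Real.exp 1 * (2 * ‖Complex.sinh (ε * z)‖ * Real.exp 1) := by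
        gcongr
        exact norm_cosh_mul_le hκ0 hκ1 hz
    _ ≤ Real.exp 1 * (2 * ‖Complex.sinh (ε * z)‖ * Real.exp 1) * Real.exp 1 :=
        le_mul_of_one_le_right (by positivity) he
    _ = _ := by rw [exp_three_eq]; ring

lemma norm_testFn_le_mul (hδ0 : 0 < δ) (hδ1 : δ ≤ 1) (hε0 : 0 ≤ ε) (hε1 : ε ≤ 1 / 2)
    (hκ0 : 0 ≤ κ) (hκ1 : κ ≤ 1) {z : ℂ} (hz : |z.re| ≤ 1) (hz2 : |z.im| ≤ 1) :
    ‖testFn δ ε κ z‖ ≤ 8 * Real.exp 3 * ε := by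
  have h1 : ‖z‖ ≤ 2 := (norm_le_abs_re_add_abs_im z).trans (by linarith)
  have h2 : ‖(ε * z : ℂ)‖ = ε * ‖z‖ := by
    rw [norm_mul, norm_real, Real.norm_eq_abs, abs_of_nonneg hε0]
  have h3 := norm_sinh_le_two_mul (w := ε * z) (by rw [h2]; nlinarith [norm_nonneg z])
  rw [h2] at h3
  have h4 : ‖Complex.sinh (ε * z)‖ ≤ 4 * ε := h3.trans (by nlinarith)
  calc _ ≤ _ := norm_testFn_le_aux hδ0 hδ1 hκ0 hκ1 hz
    _ ≤ 2 * Real.exp 3 * (4 * ε) := by gcongr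
    _ = _ := by ring

lemma norm_testFn_le_sqrt (hδ0 : 0 < δ) (hδ1 : δ ≤ 1) (hε0 : 0 ≤ ε) (hε1 : ε ≤ 1)
    (hκ0 : 0 ≤ κ) (hκ1 : κ ≤ 1) {z : ℂ} (hz : |z.re| ≤ 1) (hz2 : 1 ≤ |z.im|) :
    ‖testFn δ ε κ z‖ ≤ 12 * Real.exp 3 * √ε * √|z.im| := by
  have h1 : ‖z‖ ≤ 4 * |z.im| := (norm_le_abs_re_add_abs_im z).trans (by linarith)
  have h2 : ‖(ε * z : ℂ)‖ = ε * ‖z‖ := by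
    rw [norm_mul, norm_real, Real.norm_eq_abs, abs_of_nonneg hε0]
  have h3 := norm_sinh_le_sqrt (w := ε * z) (by
    rw [re_ofReal_mul, abs_mul, abs_of_nonneg hε0]
    exact mul_le_one₀ hε1 (abs_nonneg _) hz)
  rw [h2, Real.sqrt_mul hε0] at h3
  have h4 : √‖z‖ ≤ 2 * √|z.im| := by
    refine (Real.sqrt_le_sqrt h1).trans_eq ?_
    rw [Real.sqrt_mul (by norm_num), show (4 : ℝ) = 2 ^ 2 by norm_num, Real.sqrt_sq (by norm_num)]
  calc _ ≤ _ := norm_testFn_le_aux hδ0 hδ1 hκ0 hκ1 hz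
    _ ≤ 2 * Real.exp 3 * (3 * (√ε * (2 * √|z.im|))) := by
        refine mul_le_mul_of_nonneg_left (h3.trans ?_) (by positivity)
        gcongr
    _ = _ := by ring

end TestFunction

section Smoothing

open ProbabilityTheory

/-- The mean of `h` against the Gaussian with mean `p` and variance `δ`. -/
def gaussMean (δ : NNReal) (p : ℝ) (h : ℝ → ℝ) : ℝ := ∫ t, h t * gaussianPDFReal p δ t

/-- A smoothed jump of `h` at `0`. -/
def smoothJump (δ : NNReal) (ε κ : ℝ) (h : ℝ → ℝ) : ℝ :=
  (1 / 2) * (gaussMean δ (ε + κ) h + gaussMean δ (ε - κ) h - gaussMean δ (-(ε + κ)) h -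
    gaussMean δ (-(ε - κ)) h)

lemma integral_lap_mul_testFn {h : ℝ → ℝ} (hm : Measurable h) {c : ℝ}
    (hi : Integrable fun t => h t * Real.exp (-c * t)) {δ : NNReal} (hδ : δ ≠ 0) (ε κ : ℝ) :
    Integrable (fun y : ℝ => lap h (c + y * I) * testFn δ ε κ (c + y * I)) ∧
    ∫ y : ℝ, lap h (c + y * I) * testFn δ ε κ (c + y * I) =
      2 * Real.pi * (smoothJump δ ε κ h : ℂ) := by
  obtain ⟨i1, e1⟩ := integral_lap_mul_gaussian hm hi hδ (ε + κ)
  obtain ⟨i2, e2⟩ := integral_lap_mul_gaussian hm hi hδ (ε - κ)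
  obtain ⟨i3, e3⟩ := integral_lap_mul_gaussian hm hi hδ (-(ε + κ))
  obtain ⟨i4, e4⟩ := integral_lap_mul_gaussian hm hi hδ (-(ε - κ))
  have e : (fun y : ℝ => lap h (c + y * I) * testFn δ ε κ (c + y * I)) = fun y : ℝ =>
      (1 / 2 : ℂ) * (lap h (c + y * I) * cexp ((δ / 2 : ℝ) * (c + y * I) ^ 2 + (ε + κ : ℝ) * (c + y * I)) +
        lap h (c + y * I) * cexp ((δ / 2 : ℝ) * (c + y * I) ^ 2 + (ε - κ : ℝ) * (c + y * I)) -
        lap h (c + y * I) * cexp ((δ / 2 : ℝ) * (c + y * I) ^ 2 + (-(ε + κ) : ℝ) * (c + y * I)) -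
        lap h (c + y * I) * cexp ((δ / 2 : ℝ) * (c + y * I) ^ 2 + (-(ε - κ) : ℝ) * (c + y * I))) := by
    funext y
    rw [testFn_eq]
    ring
  rw [e]
  refine ⟨(((i1.add i2).sub i3).sub i4).const_mul _, ?_⟩
  have s3 := integral_sub ((i1.add i2).sub i3) i4
  have s2 := integral_sub (i1.add i2) i3
  have s1 := integral_add i1 i2
  simp only [Pi.add_apply, Pi.sub_apply] at s1 s2 s3
  rw [integral_const_mul, s3, s2, s1, e1, e2, e3, e4]
  simp only [smoothJump, gaussMean]
  push_cast
  ring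

lemma integrable_mul_gaussianPDFReal {h : ℝ → ℝ} (hm : Measurable h) {C : ℝ} (hC : ∀ t, |h t| ≤ C)
    (δ : NNReal) (p : ℝ) : Integrable fun t => h t * gaussianPDFReal p δ t := by
  refine ((integrable_gaussianPDFReal p δ).const_mul C).mono'
    (hm.mul (measurable_gaussianPDFReal p δ)).aestronglyMeasurable (ae_of_all _ fun t => ?_)
  rw [norm_mul, Real.norm_eq_abs, Real.norm_eq_abs, abs_of_nonneg (gaussianPDFReal_nonneg p δ t)]
  exact mul_le_mul_of_nonneg_right (hC t) (gaussianPDFReal_nonneg p δ t)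

lemma gaussMean_sub {h k : ℝ → ℝ} (hm : Measurable h) {C : ℝ} (hC : ∀ t, |h t| ≤ C)
    (km : Measurable k) {D : ℝ} (kC : ∀ t, |k t| ≤ D) (δ : NNReal) (p : ℝ) :
    gaussMean δ p (fun t => h t - k t) = gaussMean δ p h - gaussMean δ p k := by
  unfold gaussMean
  rw [← integral_sub (integrable_mul_gaussianPDFReal hm hC δ p)
    (integrable_mul_gaussianPDFReal km kC δ p)]
  congr 1
  funext t
  ring

lemma smoothJump_sub {h k : ℝ → ℝ} (hm : Measurable h) {C : ℝ} (hC : ∀ t, |h t| ≤ C)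
    (km : Measurable k) {D : ℝ} (kC : ∀ t, |k t| ≤ D) (δ : NNReal) (ε κ : ℝ) :
    smoothJump δ ε κ (fun t => h t - k t) = smoothJump δ ε κ h - smoothJump δ ε κ k := by
  simp only [smoothJump, gaussMean_sub hm hC km kC]
  ring

lemma gaussMean_le {h : ℝ → ℝ} (hm : Measurable h) {C : ℝ} (hC : ∀ t, |h t| ≤ C) {δ : NNReal}
    (hδ : δ ≠ 0) {p r u : ℝ} (hr : 0 < r) (hu : |u| ≤ C) (hle : ∀ t, |t - p| < r → h t ≤ u) :
    gaussMean δ p h ≤ u + 2 * C * (δ / r ^ 2) := by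
  have hC0 : 0 ≤ C := (abs_nonneg u).trans hu
  set A : Set ℝ := {t | r ≤ |t - p|} with hA
  have hAm : MeasurableSet A := measurableSet_le measurable_const (by fun_prop)
  have h1 : gaussMean δ p h = ∫ t, h t ∂gaussianReal p δ := by
    rw [integral_gaussianReal_eq_integral_smul hδ, gaussMean]
    simp only [smul_eq_mul, mul_comm]
  have hint : Integrable h (gaussianReal p δ) :=
    Integrable.of_bound hm.aestronglyMeasurable C (ae_of_all _ hC)
  have h2 : (gaussianReal p δ).real A ≤ δ / r ^ 2 := by
    have h3 := meas_ge_le_variance_div_sq (memLp_id_gaussianReal (μ := p) (v := δ) 2) hr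
    rw [variance_id_gaussianReal] at h3
    simp only [id_eq, integral_id_gaussianReal] at h3
    exact ENNReal.toReal_le_of_le_ofReal (by positivity) h3
  have h3 : ∀ t, h t ≤ u + 2 * C * A.indicator 1 t := fun t => by
    by_cases ht : t ∈ A
    · rw [Set.indicator_of_mem ht, Pi.one_apply]
      linarith [le_abs_self (h t), hC t, neg_abs_le u]
    · rw [Set.indicator_of_notMem ht]
      linarith [hle t (not_le.1 ht)]
  rw [h1]
  have hAi : Integrable (A.indicator (1 : ℝ → ℝ)) (gaussianReal p δ) :=
    (integrable_indicator_iff hAm).2 (integrable_const (1 : ℝ)).integrableOn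
  calc ∫ t, h t ∂gaussianReal p δ ≤ ∫ t, (u + 2 * C * A.indicator 1 t) ∂gaussianReal p δ :=
        integral_mono hint ((integrable_const u).add (hAi.const_mul _)) h3
    _ = u + 2 * C * (gaussianReal p δ).real A := by
        rw [integral_add (integrable_const u) (hAi.const_mul _), integral_const_mul,
          integral_indicator_one hAm]
        simp
    _ ≤ _ := by gcongr

lemma le_gaussMean {h : ℝ → ℝ} (hm : Measurable h) {C : ℝ} (hC : ∀ t, |h t| ≤ C) {δ : NNReal}
    (hδ : δ ≠ 0) {p r u : ℝ} (hr : 0 < r) (hu : |u| ≤ C) (hle : ∀ t, |t - p| < r → u ≤ h t) :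
    u - 2 * C * (δ / r ^ 2) ≤ gaussMean δ p h := by
  have h1 := gaussMean_le (h := fun t => -h t) hm.neg (fun t => by rw [abs_neg]; exact hC t) hδ hr
    (u := -u) (by rwa [abs_neg]) (fun t ht => neg_le_neg (hle t ht))
  have h2 : gaussMean δ p (fun t => -h t) = -gaussMean δ p h := by
    simp only [gaussMean, neg_mul, integral_neg]
  linarith

end Smoothing

section LaplaceData

/-- A bounded function supported on the positive half-line whose Laplace transform is `R / E`, with
`E` entire and even and `R` of controlled asymmetry under `z ↦ -z`. -/
structure LaplaceData (f : ℝ → ℝ) (E R : ℂ → ℂ) (C A B c D : ℝ) : Prop where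
  meas : Measurable f
  bound : ∀ t, |f t| ≤ C
  zero : ∀ t ≤ 0, f t = 0
  diffE : Differentiable ℂ E
  even : ∀ z, E (-z) = E z
  diffR : ∀ z : ℂ, -(3 / 2) < z.re → z ≠ -(1 / 2) → DifferentiableAt ℂ R z
  R_ne : ∀ z : ℂ, 0 ≤ z.re → z ≠ 1 / 2 → R z ≠ 0
  lap_mul : ∀ z : ℂ, 0 < z.re → lap f z * E z = R z
  A_nonneg : 0 ≤ A
  B_nonneg : 0 ≤ B
  c_nonneg : 0 ≤ c
  ratio : ∀ z : ℂ, -1 ≤ z.re → z.re < 0 → 1 ≤ |z.im| →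
    ‖R z‖ ≤ A * Real.exp (B * |z.im|) * ‖R (-z)‖
  ratio_one : ∀ z : ℂ, z.re = -1 → 1 ≤ |z.im| → ‖R z‖ ≤ c / |z.im| * ‖R (-z)‖
  lap_one : ∀ z : ℂ, z.re = 1 → 1 ≤ |z.im| → ‖lap f z‖ ≤ D / |z.im|

namespace LaplaceData

variable {f : ℝ → ℝ} {E R : ℂ → ℂ} {C A B c D : ℝ} (L : LaplaceData f E R C A B c D)
include L

lemma C_nonneg : 0 ≤ C := (abs_nonneg _).trans (L.bound 0)

lemma E_ne_zero_of_pos {z : ℂ} (hz : 0 < z.re) (h1 : z ≠ 1 / 2) : E z ≠ 0 := fun h =>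
  L.R_ne z hz.le h1 (by rw [← L.lap_mul z hz, h, mul_zero])

lemma E_ne_zero {z : ℂ} (hz : z.re ≠ 0) (h1 : z ≠ 1 / 2) (h2 : z ≠ -(1 / 2)) : E z ≠ 0 := by
  rcases hz.lt_or_gt with h | h
  · rw [← L.even]
    exact L.E_ne_zero_of_pos (by simpa using h) fun h3 => h2 (by rw [← h3, neg_neg])
  · exact L.E_ne_zero_of_pos h h1

lemma lap_eq {z : ℂ} (hz : 0 < z.re) (h1 : z ≠ 1 / 2) : lap f z = R z / E z :=
  eq_div_of_mul_eq (L.E_ne_zero_of_pos hz h1) (L.lap_mul z hz)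

lemma norm_quot_le {z : ℂ} (hz : z.re < 0) (h1 : z ≠ -(1 / 2)) {M : ℝ}
    (hM : ‖R z‖ ≤ M * ‖R (-z)‖) : ‖R z / E z‖ ≤ M * ‖lap f (-z)‖ := by
  have h2 : -z ≠ 1 / 2 := fun h3 => h1 (by rw [← h3, neg_neg])
  have h3 : 0 < (-z).re := by simpa using hz
  have h4 := L.E_ne_zero_of_pos h3 h2
  rw [norm_div, ← L.even, div_le_iff₀ (norm_pos_iff.2 h4), mul_assoc, ← norm_mul, L.lap_mul _ h3]
  exact hM

lemma norm_quot_le_exp {z : ℂ} (h0 : -1 ≤ z.re) (hz : z.re < 0) (hz2 : 1 ≤ |z.im|) :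
    ‖R z / E z‖ ≤ A * Real.exp (B * |z.im|) * (C / -z.re) := by
  have h1 : z ≠ -(1 / 2) := by
    rintro rfl
    norm_num at hz2
  refine (L.norm_quot_le hz h1 (L.ratio z h0 hz hz2)).trans ?_
  have := L.A_nonneg
  have h2 := norm_lap_le_right L.meas L.bound L.zero (z := -z) (by simpa using hz)
  rw [neg_re] at h2
  gcongr

lemma norm_quot_le_sq {z : ℂ} (h0 : z.re = -1) (hz2 : 1 ≤ |z.im|) :
    ‖R z / E z‖ ≤ c * D / |z.im| ^ 2 := by
  have h1 : z ≠ -(1 / 2) := by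
    rintro rfl
    norm_num at hz2
  refine (L.norm_quot_le (by linarith) h1 (L.ratio_one z h0 hz2)).trans ?_
  have := L.c_nonneg
  have h2 := L.lap_one (-z) (by simp [h0]) (by simpa using hz2)
  rw [neg_im, abs_neg] at h2
  calc c / |z.im| * ‖lap f (-z)‖ ≤ c / |z.im| * (D / |z.im|) := by gcongr
    _ = _ := by rw [div_mul_div_comm, pow_two]

lemma deriv_ne_zero {γ : ℝ} (hγ : E (γ * I) = 0) : deriv E (γ * I) ≠ 0 := by
  intro h0
  have hR : R (γ * I) ≠ 0 := L.R_ne _ (by simp) fun h => by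
    have := congrArg re h
    norm_num at this
  have h1 : HasDerivAt (fun x : ℝ => E (γ * I + x)) 0 0 := by
    have h2 : HasDerivAt E 0 (γ * I + (0 : ℝ)) := by
      rw [← h0, ofReal_zero, add_zero]
      exact (L.diffE _).hasDerivAt
    have h3 : HasDerivAt (fun z : ℂ => γ * I + z) 1 ((0 : ℝ) : ℂ) := by
      simpa using (hasDerivAt_id ((0 : ℝ) : ℂ)).const_add (γ * I)
    simpa using (h2.comp _ h3).comp_ofReal
  have h2 := (hasDerivAt_iff_tendsto_slope_zero.1 h1).norm.const_mul C
  have h3 : Tendsto (fun x : ℝ => ‖R (γ * I + x)‖) (𝓝[≠] 0) (𝓝 ‖R (γ * I)‖) := by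
    have h4 : ContinuousAt R (γ * I + (0 : ℝ)) := by
      refine (L.diffR _ (by norm_num) fun h => ?_).continuousAt
      have := congrArg re h
      norm_num at this
    have h5 : ContinuousAt (fun x : ℝ => R (γ * I + x)) 0 :=
      ContinuousAt.comp (f := fun x : ℝ => (γ * I + x : ℂ)) h4 (by fun_prop)
    have := h5.norm.tendsto
    simp only [ofReal_zero, add_zero] at this
    exact this.mono_left nhdsWithin_le_nhds
  have hsub : 𝓝[>] (0 : ℝ) ≤ 𝓝[≠] 0 := nhdsWithin_mono _ fun x hx => hx.ne'
  have h6 := le_of_tendsto_of_tendsto (h3.mono_left hsub) (h2.mono_left hsub) (by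
    filter_upwards [self_mem_nhdsWithin] with x hx
    replace hx : 0 < x := hx
    have hre : ((γ * I + x : ℂ)).re = x := by simp
    rw [← L.lap_mul _ (by rw [hre]; exact hx), norm_mul]
    have h7 := norm_lap_le_right L.meas L.bound L.zero (z := γ * I + x) (by rw [hre]; exact hx)
    rw [hre] at h7
    rw [norm_smul, zero_add, ofReal_zero, add_zero, hγ, sub_zero, norm_inv, Real.norm_eq_abs,
      abs_of_pos hx, ← mul_assoc, ← div_eq_mul_inv]
    gcongr)
  simp only [norm_zero, mul_zero] at h6
  exact hR (norm_le_zero_iff.1 h6)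

lemma finite_zeros (Y : ℝ) : {y : ℝ | y ∈ Set.Icc (-Y) Y ∧ E (y * I) = 0}.Finite := by
  by_contra hinf
  obtain ⟨γ, -, hacc⟩ := Set.Infinite.exists_accPt_of_subset_isCompact hinf
    (isCompact_Icc (a := -Y) (b := Y)) fun y hy => hy.1
  have hfreq : ∃ᶠ y in 𝓝[≠] γ, E ((y : ℝ) * I) = 0 :=
    (accPt_iff_frequently_nhdsNE.1 hacc).mono fun y hy => hy.2
  have hd : HasDerivAt (fun y : ℝ => E (y * I)) (deriv E (γ * I) * I) γ := by
    have h3 : HasDerivAt (fun z : ℂ => z * I) I (γ : ℂ) := by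
      simpa using (hasDerivAt_id (γ : ℂ)).mul_const I
    exact ((L.diffE _).hasDerivAt.comp _ h3).comp_ofReal
  have hγ : E (γ * I) = 0 := by
    by_contra h
    have h1 := hd.continuousAt.eventually_ne h
    exact hfreq ((h1.filter_mono nhdsWithin_le_nhds).mono fun y hy => hy)
  exact hfreq (hd.eventually_ne (mul_ne_zero (L.deriv_ne_zero hγ) I_ne_zero))

lemma exists_large_ne_zero (Y₀ : ℝ) : ∃ Y, Y₀ ≤ Y ∧ E (Y * I) ≠ 0 ∧ E ((-Y : ℝ) * I) ≠ 0 := by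
  by_contra! h
  have h1 : Set.Icc (max Y₀ 0) (max Y₀ 0 + 1) ⊆
      {y : ℝ | y ∈ Set.Icc (-(max Y₀ 0 + 1)) (max Y₀ 0 + 1) ∧ E (y * I) = 0} := fun y hy => by
    have h0 : 0 ≤ max Y₀ 0 := le_max_right _ _
    refine ⟨⟨by linarith [hy.1], hy.2⟩, ?_⟩
    by_contra hne
    refine hne ?_
    have := h y ((le_max_left _ _).trans hy.1) hne
    rwa [ofReal_neg, neg_mul, L.even] at this
  exact (Set.Icc_infinite (by linarith)) ((L.finite_zeros _).subset h1)

end LaplaceData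

end LaplaceData

section Extension

/-- The Laplace transform of `f`, continued by `R / E` to the left of the imaginary axis. -/
def lapExt (f : ℝ → ℝ) (E R : ℂ → ℂ) (z : ℂ) : ℂ := if 0 < z.re then lap f z else R z / E z

/-- The Laplace transform of `shiftPos f T`, continued to the left of the imaginary axis. -/
def lapShift (f : ℝ → ℝ) (E R : ℂ → ℂ) (T : ℝ) (z : ℂ) : ℂ :=
  lapExt f E R z * (1 - cexp (z * T)) + lap (shiftNeg f T) z

namespace LaplaceData

variable {f : ℝ → ℝ} {E R : ℂ → ℂ} {C A B c D : ℝ} (L : LaplaceData f E R C A B c D)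
include L

lemma lapExt_eq {z : ℂ} (hz : z ≠ 1 / 2) : lapExt f E R z = R z / E z := by
  unfold lapExt
  split_ifs with h
  · exact L.lap_eq h hz
  · rfl

lemma differentiableAt_quot {z : ℂ} (h0 : -(3 / 2) < z.re) (h1 : z ≠ -(1 / 2)) (hE : E z ≠ 0) :
    DifferentiableAt ℂ (fun z => R z / E z) z :=
  (L.diffR z h0 h1).div (L.diffE z) hE

lemma differentiableAt_lapExt {z : ℂ} (h0 : -(1 / 2) < z.re) (hE : z.re = 0 → E z ≠ 0) :
    DifferentiableAt ℂ (lapExt f E R) z := by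
  by_cases hz : 0 < z.re
  · refine (differentiableAt_lap_right L.meas L.bound L.zero hz).congr_of_eventuallyEq ?_
    filter_upwards [(isOpen_lt continuous_const continuous_re).mem_nhds hz] with w hw
    exact if_pos hw
  · have h1 : z ≠ -(1 / 2) := by
      rintro rfl
      norm_num at h0
    have h2 : z ≠ 1 / 2 := by
      rintro rfl
      norm_num at hz
    have h3 : E z ≠ 0 := by
      by_cases h : z.re = 0
      · exact hE h
      · exact L.E_ne_zero h h2 h1
    refine (L.differentiableAt_quot (by linarith) h1 h3).congr_of_eventuallyEq ?_
    filter_upwards [isOpen_ne.mem_nhds h2] with w hw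
    exact L.lapExt_eq hw

lemma differentiable_shiftNeg (T : ℝ) : Differentiable ℂ (lap (shiftNeg f T)) :=
  differentiable_lap_of_support (measurable_shiftNeg L.meas T) (abs_shiftNeg_le L.bound T)
    fun _ ht => shiftNeg_of_notMem L.zero ht

lemma differentiableAt_lapShift (T : ℝ) {z : ℂ} (h0 : -(1 / 2) < z.re) (hE : z.re = 0 → E z ≠ 0) :
    DifferentiableAt ℂ (lapShift f E R T) z := by
  refine ((L.differentiableAt_lapExt h0 hE).mul ?_).add (L.differentiable_shiftNeg T z)
  fun_prop

lemma lapShift_of_pos (T : ℝ) {z : ℂ} (hz : 0 < z.re) :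
    lapShift f E R T z = lap (shiftPos f T) z := by
  rw [lap_shiftPos L.meas L.bound L.zero T hz, lapShift, lapExt, if_pos hz]

lemma lapShift_of_neg (T : ℝ) {z : ℂ} (hz : z.re < 0) :
    lapShift f E R T z = R z / E z * (1 - cexp (z * T)) + lap (shiftNeg f T) z := by
  rw [lapShift, lapExt, if_neg (not_lt.2 hz.le)]

lemma tendsto_residue (T : ℝ) {φ : ℂ → ℂ} (hφ : Differentiable ℂ φ) {γ : ℝ} (hγ : E (γ * I) = 0) :
    Tendsto (fun z => (z - γ * I) * (lapShift f E R T z * φ z)) (𝓝[≠] (γ * I))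
      (𝓝 (R (γ * I) / deriv E (γ * I) * φ (γ * I) * (1 - cexp (γ * I * T)))) := by
  have hp : (γ * I : ℂ) ≠ 1 / 2 := fun h => by
    have := congrArg re h
    norm_num at this
  have hp' : (γ * I : ℂ) ≠ -(1 / 2) := fun h => by
    have := congrArg re h
    norm_num at this
  have hRc : ContinuousAt R (γ * I) := (L.diffR _ (by norm_num) hp').continuousAt
  have h1 : Tendsto (fun z => (z - γ * I) / E z) (𝓝[≠] (γ * I)) (𝓝 (deriv E (γ * I))⁻¹) := by
    have h2 := (hasDerivAt_iff_tendsto_slope.1 (L.diffE (γ * I)).hasDerivAt).inv₀ (L.deriv_ne_zero hγ)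
    refine h2.congr fun z => ?_
    rw [slope_def_field, hγ, sub_zero, inv_div]
  have h3 : Tendsto (fun z => R z * (1 - cexp (z * T)) * φ z) (𝓝[≠] (γ * I))
      (𝓝 (R (γ * I) * (1 - cexp (γ * I * T)) * φ (γ * I))) := by
    have : ContinuousAt (fun z => R z * (1 - cexp (z * T)) * φ z) (γ * I) :=
      (hRc.mul (by fun_prop)).mul hφ.continuous.continuousAt
    exact this.tendsto.mono_left nhdsWithin_le_nhds
  have h4 : Tendsto (fun z => (z - γ * I) * (lap (shiftNeg f T) z * φ z)) (𝓝[≠] (γ * I)) (𝓝 0) := by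
    have : Continuous (fun z => (z - γ * I) * (lap (shiftNeg f T) z * φ z)) :=
      (continuous_id.sub continuous_const).mul
        ((L.differentiable_shiftNeg T).continuous.mul hφ.continuous)
    have := (this.tendsto (γ * I)).mono_left (nhdsWithin_le_nhds (s := {(γ * I : ℂ)}ᶜ))
    simpa using this
  have h5 := (h1.mul h3).add h4
  have e : (deriv E (γ * I))⁻¹ * (R (γ * I) * (1 - cexp (γ * I * T)) * φ (γ * I)) + 0 =
      R (γ * I) / deriv E (γ * I) * φ (γ * I) * (1 - cexp (γ * I * T)) := by ring
  rw [e] at h5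
  refine h5.congr' ?_
  filter_upwards [nhdsWithin_le_nhds (isOpen_ne.mem_nhds hp)] with z hz
  rw [lapShift, L.lapExt_eq hz]
  ring

end LaplaceData

end Extension

section ContourEstimates

lemma norm_one_sub_cexp_le {z : ℂ} {T : ℝ} (hz : z.re ≤ 0) (hT : 0 ≤ T) :
    ‖1 - cexp (z * T)‖ ≤ 2 := by
  have h1 : ‖cexp (z * T)‖ ≤ 1 := by
    rw [Complex.norm_exp, Real.exp_le_one_iff]
    simpa using mul_nonpos_of_nonpos_of_nonneg hz hT
  calc ‖1 - cexp (z * T)‖ ≤ ‖(1 : ℂ)‖ + ‖cexp (z * T)‖ := norm_sub_le _ _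
    _ ≤ 2 := by rw [norm_one]; linarith

lemma norm_integral_le_of_rpow {F : ℝ → ℂ} {Y W : ℝ} (hY : 1 ≤ Y) (hW : 0 ≤ W)
    (h : ∀ y ∈ Set.Icc 1 Y, ‖F y‖ ≤ W * y ^ (-(3 / 2) : ℝ)) : ‖∫ y in (1 : ℝ)..Y, F y‖ ≤ 2 * W := by
  have h0 : (0 : ℝ) ∉ Set.uIcc 1 Y := by
    rw [Set.uIcc_of_le hY]
    exact fun h => by linarith [h.1]
  have hi : IntervalIntegrable (fun y : ℝ => W * y ^ (-(3 / 2) : ℝ)) volume 1 Y :=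
    (intervalIntegral.intervalIntegrable_rpow (Or.inr h0)).const_mul W
  refine (intervalIntegral.norm_integral_le_of_norm_le hY
    (ae_of_all _ fun y hy => h y ⟨hy.1.le, hy.2⟩) hi).trans ?_
  rw [intervalIntegral.integral_const_mul, integral_rpow (Or.inr ⟨by norm_num, h0⟩)]
  have h1 : 0 ≤ Y ^ (-(3 / 2) + 1 : ℝ) := Real.rpow_nonneg (by linarith) _
  have h2 : (Y ^ (-(3 / 2) + 1 : ℝ) - 1 ^ (-(3 / 2) + 1 : ℝ)) / (-(3 / 2) + 1) ≤ 2 := by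
    rw [Real.one_rpow, div_le_iff_of_neg (by norm_num)]
    linarith
  nlinarith

lemma inv_sq_mul_sqrt {y : ℝ} (hy : 0 < y) : (y ^ 2)⁻¹ * √y = y ^ (-(3 / 2) : ℝ) := by
  rw [Real.sqrt_eq_rpow, ← Real.rpow_natCast, ← Real.rpow_neg hy.le, ← Real.rpow_add hy]
  norm_num

/-- Shifting a vertical segment across a rectangle on which the function is holomorphic. -/
lemma norm_integral_right_le {Q : ℂ → ℂ} {a b c d : ℝ} (hab : a ≤ b) (hcd : c ≤ d)
    (hQ : DifferentiableOn ℂ Q (Set.Icc a b ×ℂ Set.Icc c d)) :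
    ‖∫ y in c..d, Q (b + y * I)‖ ≤ ‖∫ x in a..b, Q (x + c * I)‖ + ‖∫ x in a..b, Q (x + d * I)‖ +
      ‖∫ y in c..d, Q (a + y * I)‖ := by
  have h := rectIntegral_eq_zero hab hcd hQ
  rw [rectIntegral] at h
  have e : I * (∫ y in c..d, Q (b + y * I)) = -(∫ x in a..b, Q (x + c * I)) +
      (∫ x in a..b, Q (x + d * I)) + I * ∫ y in c..d, Q (a + y * I) := by
    linear_combination h
  calc _ = ‖I * (∫ y in c..d, Q (b + y * I))‖ := by rw [norm_mul, norm_I, one_mul]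
    _ ≤ _ := by
      rw [e]
      refine (norm_add_le _ _).trans ?_
      rw [norm_mul, norm_I, one_mul]
      refine add_le_add_left ((norm_add_le _ _).trans ?_) _
      rw [norm_neg]

namespace LaplaceData

variable {f : ℝ → ℝ} {E R : ℂ → ℂ} {C A B c D : ℝ} (L : LaplaceData f E R C A B c D)
include L

/-- For a suitable large time shift the residues on the imaginary axis nearly vanish. -/
lemma exists_rectIntegral_le {φ : ℂ → ℂ} (hφ : Differentiable ℂ φ) {Y : ℝ} (hY : 0 < Y)
    (h1 : E (Y * I) ≠ 0) (h2 : E ((-Y : ℝ) * I) ≠ 0) {η : ℝ} (hη : 0 < η) (T₀ : ℝ) :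
    ∃ T, T₀ ≤ T ∧
      ‖rectIntegral (fun z => lapShift f E R T z * φ z) (-(1 / 4)) 1 (-Y) Y‖ ≤ η := by
  set S : Finset ℝ := (L.finite_zeros Y).toFinset with hS
  have hSmem : ∀ γ, γ ∈ S ↔ γ ∈ Set.Icc (-Y) Y ∧ E (γ * I) = 0 := fun γ => by
    rw [hS, Set.Finite.mem_toFinset, Set.mem_ofPred_eq]
  set V : ℂ → ℂ := fun p => R p / deriv E p * φ p *
    rectIntegral (fun z => (z - p)⁻¹) (-(1 / 4)) 1 (-Y) Y with hV
  set W : ℝ := ∑ γ ∈ S, ‖V (γ * I)‖ with hW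
  have hW0 : 0 ≤ W := Finset.sum_nonneg fun _ _ => norm_nonneg _
  obtain ⟨T, hT, hrec⟩ := exists_recurrence S (η := η / (W + 1)) (by positivity) T₀
  refine ⟨T, hT, ?_⟩
  have hinj : Function.Injective fun γ : ℝ => (γ * I : ℂ) := fun a b h => by
    simpa using h
  set U : Set ℂ := {z | -(3 / 8) < z.re} ∩ {z | z.re = 0 ∧ E z = 0 ∧ Y ≤ |z.im|}ᶜ with hU
  have hUo : IsOpen U := by
    refine (isOpen_lt continuous_const continuous_re).inter (IsClosed.isOpen_compl (self := ?_))
    exact (isClosed_eq continuous_re continuous_const).inter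
      ((isClosed_eq L.diffE.continuous continuous_const).inter
        (isClosed_le continuous_const (continuous_abs.comp continuous_im)))
  have hsub : Set.Icc (-(1 / 4) : ℝ) 1 ×ℂ Set.Icc (-Y) Y ⊆ U := by
    rintro z ⟨hz1, hz2⟩
    refine ⟨lt_of_lt_of_le (by norm_num) hz1.1, fun ⟨h3, h4, h5⟩ => ?_⟩
    have hz : z = z.im * I := by
      conv_lhs => rw [← re_add_im z, h3, ofReal_zero, zero_add]
    have h6 : |z.im| = Y := le_antisymm (abs_le.2 hz2) h5
    rw [hz] at h4
    rcases (abs_eq hY.le).1 h6 with h7 | h7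
    · exact h1 (by rw [← h7]; exact h4)
    · exact h2 (by rw [← h7]; exact h4)
  have hres := rectIntegral_eq_sum_residues (a := -(1 / 4)) (b := 1) (c := -Y) (d := Y) (by norm_num)
    (by linarith) hUo hsub
    (fun p => R p / deriv E p * φ p * (1 - cexp (p * T))) (S.image fun γ : ℝ => (γ * I : ℂ)) ?_
    (fun z => lapShift f E R T z * φ z) ?_ ?_
  · rw [hres, Finset.sum_image fun a _ b _ h => hinj h]
    refine (norm_sum_le _ _).trans ?_
    calc _ ≤ ∑ γ ∈ S, ‖V (γ * I)‖ * (η / (W + 1)) := by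
          refine Finset.sum_le_sum fun γ hγ => ?_
          have e : R (γ * I) / deriv E (γ * I) * φ (γ * I) * (1 - cexp (γ * I * T)) *
              rectIntegral (fun z => (z - γ * I)⁻¹) (-(1 / 4)) 1 (-Y) Y =
              V (γ * I) * (1 - cexp (γ * I * T)) := by
            simp only [hV]
            ring
          rw [e, norm_mul]
          exact mul_le_mul_of_nonneg_left (hrec γ hγ).le (norm_nonneg _)
      _ = W / (W + 1) * η := by rw [← Finset.sum_mul, ← hW]; ring
      _ ≤ 1 * η := by
          gcongr
          rw [div_le_one (by linarith)]
          linarith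
      _ = η := one_mul η
  · intro p hp
    obtain ⟨γ, hγ, rfl⟩ := Finset.mem_image.1 hp
    obtain ⟨⟨h3, h4⟩, h5⟩ := (hSmem γ).1 hγ
    have h6 : -Y ≠ γ := fun h => h2 (by rw [h]; exact h5)
    have h7 : γ ≠ Y := fun h => h1 (by rw [← h]; exact h5)
    refine ⟨?_, ?_⟩
    · norm_num
    · simpa using ⟨lt_of_le_of_ne h3 h6, lt_of_le_of_ne h4 h7⟩
  · rintro z ⟨⟨hz1, hz2⟩, hz3⟩
    replace hz1 : -(3 / 8) < z.re := hz1
    refine ((L.differentiableAt_lapShift T (by linarith) fun h0 hE => ?_).mul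
      (hφ z)).differentiableWithinAt
    have hz : z = z.im * I := by
      conv_lhs => rw [← re_add_im z, h0, ofReal_zero, zero_add]
    by_cases hYz : Y ≤ |z.im|
    · exact hz2 ⟨h0, hE, hYz⟩
    · refine hz3 ?_
      rw [Finset.mem_coe, Finset.mem_image]
      refine ⟨z.im, (hSmem _).2 ⟨abs_le.1 (not_le.1 hYz).le, ?_⟩, hz.symm⟩
      rw [← hz]
      exact hE
  · intro p hp
    obtain ⟨γ, hγ, rfl⟩ := Finset.mem_image.1 hp
    exact L.tendsto_residue T hφ ((hSmem γ).1 hγ).2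

variable {δ ε κ T : ℝ}

lemma norm_quot_mul_testFn_le (hδ0 : 0 < δ) (hδ1 : δ ≤ 1) (hε0 : 0 ≤ ε) (hε1 : ε ≤ 1)
    (hκ0 : 0 ≤ κ) (hκ1 : κ ≤ 1 / 2) (hT : 0 ≤ T) {z : ℂ} (hz1 : -1 ≤ z.re) (hz0 : z.re < 0)
    (hz2 : 1 ≤ |z.im|) (hcos : Real.cos (κ * z.im) = 0) :
    ‖R z / E z * (1 - cexp (z * T)) * testFn δ ε κ z‖ ≤
      2 * A * Real.exp (B * |z.im|) * C * (2 * Real.exp 3 * Real.exp (-(δ / 2) * z.im ^ 2)) := by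
  have hA := L.A_nonneg
  have hC := L.C_nonneg
  have hre : |z.re| = -z.re := abs_of_neg hz0
  have h1 := L.norm_quot_le_exp hz1 hz0 hz2
  have h2 := norm_one_sub_cexp_le hz0.le hT
  have h3 := norm_testFn_le_of_cos_eq_zero hδ0 hδ1 hε0 hε1 hκ0 hκ1 (z := z)
    (by rw [hre]; linarith) hcos
  rw [hre] at h3
  have h4 : 0 ≤ C / -z.re := div_nonneg hC (by linarith)
  rw [norm_mul, norm_mul]
  calc _ ≤ A * Real.exp (B * |z.im|) * (C / -z.re) * 2 *
        (2 * Real.exp 3 * Real.exp (-(δ / 2) * z.im ^ 2) * -z.re) := by gcongr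
    _ = _ := by
      have : z.re ≠ 0 := hz0.ne
      field_simp

lemma norm_lapShift_mul_testFn_le (hδ0 : 0 < δ) (hδ1 : δ ≤ 1) (hε0 : 0 ≤ ε) (hε1 : ε ≤ 1)
    (hκ0 : 0 ≤ κ) (hκ1 : κ ≤ 1 / 2) (hT : 0 ≤ T) {z : ℂ} (hz1 : |z.re| ≤ 1) (hz2 : 1 ≤ |z.im|)
    (hcos : Real.cos (κ * z.im) = 0) :
    ‖lapShift f E R T z * testFn δ ε κ z‖ ≤
      (2 * A * Real.exp (B * |z.im|) + 2) * C *
        (2 * Real.exp 3 * Real.exp (-(δ / 2) * z.im ^ 2)) := by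
  have hA := L.A_nonneg
  have hC := L.C_nonneg
  have h3 := norm_testFn_le_of_cos_eq_zero hδ0 hδ1 hε0 hε1 hκ0 hκ1 hz1 hcos
  set g := 2 * Real.exp 3 * Real.exp (-(δ / 2) * z.im ^ 2) with hg
  have hg0 : 0 ≤ g := by positivity
  have hAB : 0 ≤ 2 * A * Real.exp (B * |z.im|) := by positivity
  rcases lt_trichotomy z.re 0 with h0 | h0 | h0
  · have h1 := L.norm_quot_mul_testFn_le hδ0 hδ1 hε0 hε1 hκ0 hκ1 hT
      (by linarith [(abs_le.1 hz1).1]) h0 hz2 hcos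
    have h4 := norm_lap_le_left (measurable_shiftNeg L.meas T) (abs_shiftNeg_le L.bound T)
      (fun t => shiftNeg_of_pos T) h0
    rw [abs_of_neg h0] at h3
    have h5 : 0 ≤ C / -z.re := div_nonneg hC (by linarith)
    have h6 : ‖lap (shiftNeg f T) z * testFn δ ε κ z‖ ≤ C * g := by
      rw [norm_mul]
      calc _ ≤ C / -z.re * (g * -z.re) := by gcongr
        _ = C * g := by
          have : z.re ≠ 0 := h0.ne
          field_simp
    rw [L.lapShift_of_neg T h0, add_mul]
    refine (norm_add_le _ _).trans ((add_le_add h1 h6).trans ?_)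
    rw [← hg]
    nlinarith [mul_nonneg hC hg0]
  · have h4 : testFn δ ε κ z = 0 := by
      rw [h0, abs_zero, mul_zero] at h3
      exact norm_le_zero_iff.1 h3
    rw [h4, mul_zero, norm_zero]
    positivity
  · have h4 := norm_lap_le_right (measurable_shiftPos L.meas T) (abs_shiftPos_le L.bound T)
      (fun t => shiftPos_of_nonpos T) h0
    rw [abs_of_pos h0] at h3
    rw [L.lapShift_of_pos T h0, norm_mul]
    have h5 : 0 ≤ 2 * C / z.re := by positivity
    calc _ ≤ 2 * C / z.re * (g * z.re) := by gcongr
      _ = 2 * C * g := by field_simp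
      _ ≤ _ := by nlinarith [mul_nonneg hC hg0, mul_nonneg hAB (mul_nonneg hC hg0)]

end LaplaceData

end ContourEstimates

section JumpComparison

namespace LaplaceData

variable {f : ℝ → ℝ} {E R : ℂ → ℂ} {C A B c D : ℝ} (L : LaplaceData f E R C A B c D)
include L

lemma differentiableOn_quot_mul {φ : ℂ → ℂ} (hφ : Differentiable ℂ φ) {S : Set ℂ}
    (hS : ∀ z ∈ S, -1 ≤ z.re ∧ z.re < 0 ∧ z ≠ -(1 / 2)) (T : ℝ) :
    DifferentiableOn ℂ (fun z => R z / E z * (1 - cexp (z * T)) * φ z) S := fun z hz => by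
  obtain ⟨h1, h2, h3⟩ := hS z hz
  have hE : E z ≠ 0 := L.E_ne_zero h2.ne (fun h => by
    rw [h] at h2
    norm_num at h2) h3
  have hd := L.differentiableAt_quot (by linarith) h3 hE
  exact ((hd.mul (by fun_prop)).mul (hφ z)).differentiableWithinAt

variable {δ ε κ T : ℝ}

lemma norm_integral_unit_edge_le (hδ0 : 0 < δ) (hδ1 : δ ≤ 1) (hε0 : 0 ≤ ε) (hε1 : ε ≤ 1 / 2)
    (hκ0 : 0 ≤ κ) (hκ1 : κ ≤ 1 / 2) (hT : 0 ≤ T) {s : ℝ} (hs : |s| = 1) :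
    ‖∫ x in (-1 : ℝ)..(-(1 / 4) : ℝ), R (x + s * I) / E (x + s * I) *
      (1 - cexp ((x + s * I) * T)) * testFn δ ε κ (x + s * I)‖ ≤
      A * Real.exp B * (4 * C) * 2 * (8 * Real.exp 3 * ε) := by
  have hA := L.A_nonneg
  have hC := L.C_nonneg
  refine (intervalIntegral.norm_integral_le_of_norm_le_const
    (C := A * Real.exp B * (4 * C) * 2 * (8 * Real.exp 3 * ε)) fun x hx => ?_).trans ?_
  · rw [Set.uIoc_of_le (by norm_num)] at hx
    have hre : (x + s * I : ℂ).re = x := by simp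
    have him : (x + s * I : ℂ).im = s := by simp
    have h1 := L.norm_quot_le_exp (z := x + s * I) (by rw [hre]; linarith [hx.1])
      (by rw [hre]; linarith [hx.2]) (by rw [him, hs])
    rw [hre, him, hs, mul_one] at h1
    have h2 := norm_one_sub_cexp_le (z := x + s * I) (by rw [hre]; linarith [hx.2]) hT
    have h3 := norm_testFn_le_mul hδ0 hδ1 hε0 hε1 hκ0 (by linarith) (z := x + s * I)
      (by rw [hre, abs_le]; constructor <;> linarith [hx.1, hx.2]) (by rw [him, hs])
    have h4 : C / -x ≤ 4 * C := by
      rw [div_le_iff₀ (by linarith [hx.2])]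
      nlinarith [hx.2]
    have h5 := h1.trans (mul_le_mul_of_nonneg_left h4 (by positivity : 0 ≤ A * Real.exp B))
    rw [norm_mul, norm_mul]
    gcongr
  · refine mul_le_of_le_one_right (by positivity) ?_
    rw [abs_le]
    constructor <;> norm_num

lemma norm_integral_far_edge_le (hδ0 : 0 < δ) (hδ1 : δ ≤ 1) (hε0 : 0 ≤ ε) (hε1 : ε ≤ 1)
    (hκ0 : 0 ≤ κ) (hκ1 : κ ≤ 1 / 2) (hT : 0 ≤ T) {Y s : ℝ} (hY : 1 ≤ Y) (hs : |s| = Y)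
    (hcos : Real.cos (κ * s) = 0) :
    ‖∫ x in (-1 : ℝ)..(-(1 / 4) : ℝ), R (x + s * I) / E (x + s * I) *
      (1 - cexp ((x + s * I) * T)) * testFn δ ε κ (x + s * I)‖ ≤
      2 * A * Real.exp (B * Y) * C * (2 * Real.exp 3 * Real.exp (-(δ / 2) * Y ^ 2)) := by
  have hA := L.A_nonneg
  have hC := L.C_nonneg
  refine (intervalIntegral.norm_integral_le_of_norm_le_const
    (C := 2 * A * Real.exp (B * Y) * C * (2 * Real.exp 3 * Real.exp (-(δ / 2) * Y ^ 2)))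
    fun x hx => ?_).trans ?_
  · rw [Set.uIoc_of_le (by norm_num)] at hx
    have hre : (x + s * I : ℂ).re = x := by simp
    have him : (x + s * I : ℂ).im = s := by simp
    have h1 := L.norm_quot_mul_testFn_le hδ0 hδ1 hε0 hε1 hκ0 hκ1 hT (z := x + s * I)
      (by rw [hre]; linarith [hx.1]) (by rw [hre]; linarith [hx.2]) (by rw [him, hs]; exact hY)
      (by rw [him]; exact hcos)
    rwa [him, hs, ← sq_abs s, hs] at h1
  · refine mul_le_of_le_one_right (by positivity) ?_
    rw [abs_le]
    constructor <;> norm_num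

lemma norm_integral_left_edge_le (hδ0 : 0 < δ) (hδ1 : δ ≤ 1) (hε0 : 0 ≤ ε) (hε1 : ε ≤ 1)
    (hκ0 : 0 ≤ κ) (hκ1 : κ ≤ 1 / 2) (hT : 0 ≤ T) {Y s : ℝ} (hY : 1 ≤ Y) (hs : |s| = 1)
    (hcD : 0 ≤ c * D) :
    ‖∫ y in (1 : ℝ)..Y, R ((-1 : ℝ) + (s * y : ℝ) * I) / E ((-1 : ℝ) + (s * y : ℝ) * I) *
      (1 - cexp (((-1 : ℝ) + (s * y : ℝ) * I) * T)) *
        testFn δ ε κ ((-1 : ℝ) + (s * y : ℝ) * I)‖ ≤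
      2 * (c * D * 2 * (12 * Real.exp 3 * √ε)) := by
  refine norm_integral_le_of_rpow hY (by positivity) fun y hy => ?_
  have hy0 : 0 < y := by linarith [hy.1]
  set z : ℂ := (-1 : ℝ) + (s * y : ℝ) * I with hz
  have hre : z.re = -1 := by simp [hz]
  have him : |z.im| = y := by
    have : z.im = s * y := by simp [hz]
    rw [this, abs_mul, hs, one_mul, abs_of_pos hy0]
  have h1 := L.norm_quot_le_sq hre (by rw [him]; exact hy.1)
  have h2 := norm_one_sub_cexp_le (z := z) (by rw [hre]; norm_num) hT
  have h3 := norm_testFn_le_sqrt hδ0 hδ1 hε0 hε1 hκ0 (by linarith) (z := z)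
    (by rw [hre]; norm_num) (by rw [him]; exact hy.1)
  rw [him] at h1 h3
  rw [norm_mul, norm_mul]
  calc _ ≤ c * D / y ^ 2 * 2 * (12 * Real.exp 3 * √ε * √y) := by gcongr
    _ = c * D * 2 * (12 * Real.exp 3 * √ε) * ((y ^ 2)⁻¹ * √y) := by ring
    _ = _ := by rw [inv_sq_mul_sqrt hy0]

lemma mul_nonneg_of_lap_one : 0 ≤ c * D := by
  have h := (norm_nonneg _).trans (L.lap_one (1 + I) (by simp) (by simp))
  refine mul_nonneg L.c_nonneg ?_
  simpa using h

/-- The contribution of the quotient `R / E` along `re z = -1/4` is `O(√ε)` up to the edges. -/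
lemma exists_norm_integral_quot_le : ∃ K : ℝ, 0 ≤ K ∧ ∀ {δ ε κ T Y : ℝ}, 0 < δ → δ ≤ 1 → 0 ≤ ε →
    ε ≤ 1 / 2 → 0 ≤ κ → κ ≤ 1 / 2 → 0 ≤ T → 1 ≤ Y → Real.cos (κ * Y) = 0 →
    ‖∫ y in (-Y)..Y, R ((-(1 / 4) : ℝ) + y * I) / E ((-(1 / 4) : ℝ) + y * I) *
      (1 - cexp (((-(1 / 4) : ℝ) + y * I) * T)) * testFn δ ε κ ((-(1 / 4) : ℝ) + y * I)‖ ≤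
      K * √ε +
        2 * (2 * A * Real.exp (B * Y) * C * (2 * Real.exp 3 * Real.exp (-(δ / 2) * Y ^ 2))) := by
  have hA := L.A_nonneg
  have hC := L.C_nonneg
  have hcD := L.mul_nonneg_of_lap_one
  have hcont : Continuous fun y : ℝ => R ((-(1 / 4) : ℝ) + y * I) / E ((-(1 / 4) : ℝ) + y * I) := by
    refine continuous_iff_continuousAt.2 fun y => ?_
    have hre : (((-(1 / 4) : ℝ) : ℂ) + y * I).re = -(1 / 4) := by simp
    have h1 : ((-(1 / 4) : ℝ) : ℂ) + y * I ≠ -(1 / 2) := fun h => by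
      rw [h] at hre
      norm_num at hre
    have h2 : ((-(1 / 4) : ℝ) : ℂ) + y * I ≠ 1 / 2 := fun h => by
      rw [h] at hre
      norm_num at hre
    have h3 := L.differentiableAt_quot (by rw [hre]; norm_num) h1
      (L.E_ne_zero (by rw [hre]; norm_num) h2 h1)
    exact ContinuousAt.comp (f := fun y : ℝ => ((-(1 / 4) : ℝ) : ℂ) + y * I) h3.continuousAt
      (by fun_prop)
  obtain ⟨M, hM⟩ := (isCompact_Icc (a := (-1 : ℝ)) (b := 1)).exists_bound_of_continuousOn
    hcont.continuousOn
  have hM0 : 0 ≤ M := (norm_nonneg _).trans (hM 0 (by norm_num))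
  refine ⟨2 * (A * Real.exp B * (4 * C) * 2 * (8 * Real.exp 3)) +
    2 * (2 * (c * D * 2 * (12 * Real.exp 3))) + M * 2 * (8 * Real.exp 3) * 2, by positivity, ?_⟩
  intro δ ε κ T Y hδ0 hδ1 hε0 hε1 hκ0 hκ1 hT hY hcos
  set Q : ℂ → ℂ := fun z => R z / E z * (1 - cexp (z * T)) * testFn δ ε κ z with hQ
  have hε2 : ε ≤ √ε := Real.le_sqrt_of_sq_le (by nlinarith)
  have hQd : ∀ {S : Set ℂ}, (∀ z ∈ S, -1 ≤ z.re ∧ z.re < 0 ∧ z ≠ -(1 / 2)) →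
      DifferentiableOn ℂ Q S := fun hS =>
    L.differentiableOn_quot_mul (differentiable_testFn δ ε κ) hS T
  have hQc : Continuous fun y : ℝ => Q ((-(1 / 4) : ℝ) + y * I) := by
    have h1 := (differentiable_testFn δ ε κ).continuous
    have h2 : Continuous fun y : ℝ => testFn δ ε κ ((-(1 / 4) : ℝ) + y * I) :=
      h1.comp (by fun_prop)
    exact (hcont.mul (by fun_prop)).mul h2
  have hup : ‖∫ y in (1 : ℝ)..Y, Q ((-(1 / 4) : ℝ) + y * I)‖ ≤
      A * Real.exp B * (4 * C) * 2 * (8 * Real.exp 3 * ε) +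
      2 * A * Real.exp (B * Y) * C * (2 * Real.exp 3 * Real.exp (-(δ / 2) * Y ^ 2)) +
      2 * (c * D * 2 * (12 * Real.exp 3 * √ε)) := by
    refine (norm_integral_right_le (a := -1) (by norm_num) hY (hQd fun z hz => ?_)).trans
      (add_le_add (add_le_add ?_ ?_) ?_)
    · obtain ⟨⟨h1, h2⟩, h3, -⟩ := hz
      refine ⟨h1, by linarith, ?_⟩
      rintro rfl
      norm_num at h3
    · exact L.norm_integral_unit_edge_le hδ0 hδ1 hε0 hε1 hκ0 hκ1 hT (by simp)
    · exact L.norm_integral_far_edge_le hδ0 hδ1 hε0 (by linarith) hκ0 hκ1 hT hY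
        (abs_of_pos (by linarith)) hcos
    · have := L.norm_integral_left_edge_le hδ0 hδ1 hε0 (by linarith) hκ0 hκ1 hT hY (s := 1)
        (by simp) hcD
      simpa only [one_mul] using this
  have hlow : ‖∫ y in (-Y)..(-1 : ℝ), Q ((-(1 / 4) : ℝ) + y * I)‖ ≤
      2 * A * Real.exp (B * Y) * C * (2 * Real.exp 3 * Real.exp (-(δ / 2) * Y ^ 2)) +
      A * Real.exp B * (4 * C) * 2 * (8 * Real.exp 3 * ε) +
      2 * (c * D * 2 * (12 * Real.exp 3 * √ε)) := by
    refine (norm_integral_right_le (a := -1) (by norm_num) (by linarith)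
      (hQd fun z hz => ?_)).trans (add_le_add (add_le_add ?_ ?_) ?_)
    · obtain ⟨⟨h1, h2⟩, -, h3⟩ := hz
      refine ⟨h1, by linarith, ?_⟩
      rintro rfl
      norm_num at h3
    · exact L.norm_integral_far_edge_le hδ0 hδ1 hε0 (by linarith) hκ0 hκ1 hT hY
        (by rw [abs_neg, abs_of_pos (by linarith)]) (by rw [mul_neg, Real.cos_neg, hcos])
    · exact L.norm_integral_unit_edge_le hδ0 hδ1 hε0 hε1 hκ0 hκ1 hT (by simp)
    · have := L.norm_integral_left_edge_le hδ0 hδ1 hε0 (by linarith) hκ0 hκ1 hT hY (s := -1)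
        (by simp) hcD
      rw [← intervalIntegral.integral_comp_neg (fun y : ℝ => Q ((-1 : ℝ) + y * I))]
      simpa only [neg_one_mul] using this
  have hmid : ‖∫ y in (-1 : ℝ)..1, Q ((-(1 / 4) : ℝ) + y * I)‖ ≤
      M * 2 * (8 * Real.exp 3 * ε) * 2 := by
    refine (intervalIntegral.norm_integral_le_of_norm_le_const
      (C := M * 2 * (8 * Real.exp 3 * ε)) fun y hy => ?_).trans_eq ?_
    · rw [Set.uIoc_of_le (by norm_num)] at hy
      have hre : (((-(1 / 4) : ℝ) : ℂ) + y * I).re = -(1 / 4) := by simp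
      have him : (((-(1 / 4) : ℝ) : ℂ) + y * I).im = y := by simp
      have h1 := hM y ⟨hy.1.le, hy.2⟩
      have h2 := norm_one_sub_cexp_le (z := (-(1 / 4) : ℝ) + y * I)
        (by rw [hre]; norm_num) hT
      have h3 := norm_testFn_le_mul hδ0 hδ1 hε0 hε1 hκ0 (by linarith)
        (z := (-(1 / 4) : ℝ) + y * I) (by rw [hre, abs_le]; norm_num)
        (by rw [him]; exact abs_le.2 ⟨hy.1.le, hy.2⟩)
      rw [hQ]
      simp only
      rw [norm_mul, norm_mul]
      gcongr
    · norm_num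
  have hint : ∀ a b : ℝ, IntervalIntegrable (fun y : ℝ => Q ((-(1 / 4) : ℝ) + y * I)) volume a b :=
    fun a b => hQc.intervalIntegrable a b
  have hsplit : (∫ y in (-Y)..Y, Q ((-(1 / 4) : ℝ) + y * I)) =
      (∫ y in (-Y)..(-1 : ℝ), Q ((-(1 / 4) : ℝ) + y * I)) +
      (∫ y in (-1 : ℝ)..1, Q ((-(1 / 4) : ℝ) + y * I)) +
      ∫ y in (1 : ℝ)..Y, Q ((-(1 / 4) : ℝ) + y * I) := by
    rw [intervalIntegral.integral_add_adjacent_intervals (hint _ _) (hint _ _),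
      intervalIntegral.integral_add_adjacent_intervals (hint _ _) (hint _ _)]
  have h3 : A * Real.exp B * (4 * C) * 2 * (8 * Real.exp 3 * ε) ≤
      A * Real.exp B * (4 * C) * 2 * (8 * Real.exp 3 * √ε) := by gcongr
  have h4 : M * 2 * (8 * Real.exp 3 * ε) * 2 ≤ M * 2 * (8 * Real.exp 3 * √ε) * 2 := by gcongr
  change ‖∫ y in (-Y)..Y, Q ((-(1 / 4) : ℝ) + y * I)‖ ≤ _
  rw [hsplit]
  refine ((norm_add_le _ _).trans (add_le_add ((norm_add_le _ _).trans
    (add_le_add hlow hmid)) hup)).trans ?_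
  linarith

end LaplaceData

end JumpComparison

section JumpTheorem

lemma norm_integral_sub_intervalIntegral_le {F : ℝ → ℂ} {g : ℝ → ℝ} (hF : Integrable F)
    (hg : Integrable g) (h : ∀ y, ‖F y‖ ≤ g y) {Y : ℝ} (hY : 0 ≤ Y) :
    ‖(∫ y, F y) - ∫ y in (-Y)..Y, F y‖ ≤ (∫ y, g y) - ∫ y in (-Y)..Y, g y := by
  have hm : MeasurableSet (Set.Ioc (-Y) Y) := measurableSet_Ioc
  rw [intervalIntegral.integral_of_le (by linarith), intervalIntegral.integral_of_le (by linarith),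
    ← integral_add_compl hm hF, ← integral_add_compl hm hg, add_sub_cancel_left, add_sub_cancel_left]
  exact (norm_integral_le_integral_norm _).trans
    (integral_mono hF.norm.integrableOn hg.integrableOn h)

lemma tendsto_exp_mul_exp_neg_sq (B : ℝ) {δ : ℝ} (hδ : 0 < δ) :
    Tendsto (fun Y : ℝ => Real.exp (B * Y) * Real.exp (-(δ / 2) * Y ^ 2)) atTop (𝓝 0) := by
  have h1 : Tendsto (fun Y : ℝ => Y * (δ / 2 * Y - B)) atTop atTop :=
    tendsto_id.atTop_mul_atTop₀ (tendsto_atTop_add_const_right _ _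
      (tendsto_id.const_mul_atTop (by positivity)))
  refine (Real.tendsto_exp_neg_atTop_nhds_zero.comp h1).congr fun Y => ?_
  rw [Function.comp, ← Real.exp_add]
  ring_nf

namespace LaplaceData

variable {f : ℝ → ℝ} {E R : ℂ → ℂ} {C A B c D : ℝ} (L : LaplaceData f E R C A B c D)
include L

lemma exists_norm_integral_sub_le : ∃ K : ℝ, 0 ≤ K ∧ ∀ {δ ε κ Y η T₀ : ℝ}, 0 < δ → δ ≤ 1 → 0 ≤ ε →
    ε ≤ 1 / 2 → 0 ≤ κ → κ ≤ 1 / 2 → 1 ≤ Y → Real.cos (κ * Y) = 0 → E (Y * I) ≠ 0 →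
    E ((-Y : ℝ) * I) ≠ 0 → 0 < η → 0 ≤ T₀ → ∃ T, T₀ ≤ T ∧
    ‖(∫ y in (-Y)..Y, lap (shiftPos f T) ((1 : ℝ) + y * I) * testFn δ ε κ ((1 : ℝ) + y * I)) -
      ∫ y in (-Y)..Y, lap (shiftNeg f T) ((-(1 / 4) : ℝ) + y * I) *
        testFn δ ε κ ((-(1 / 4) : ℝ) + y * I)‖ ≤
      K * √ε + η + 6 * ((2 * A * Real.exp (B * Y) + 2) * C *
        (2 * Real.exp 3 * Real.exp (-(δ / 2) * Y ^ 2))) := by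
  have hA := L.A_nonneg
  have hC := L.C_nonneg
  obtain ⟨K, hK, hQ⟩ := L.exists_norm_integral_quot_le
  refine ⟨K, hK, ?_⟩
  intro δ ε κ Y η T₀ hδ0 hδ1 hε0 hε1 hκ0 hκ1 hY hcos hE1 hE2 hη hT₀
  obtain ⟨T, hT, hrect⟩ := L.exists_rectIntegral_le (differentiable_testFn δ ε κ)
    (by linarith : 0 < Y) hE1 hE2 hη T₀
  refine ⟨T, hT, ?_⟩
  have hT0 : 0 ≤ T := hT₀.trans hT
  replace hQ := hQ hδ0 hδ1 hε0 hε1 hκ0 hκ1 hT0 hY hcos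
  set N := (2 * A * Real.exp (B * Y) + 2) * C *
    (2 * Real.exp 3 * Real.exp (-(δ / 2) * Y ^ 2)) with hN
  have hN0 : 0 ≤ N := by positivity
  have hNle : 2 * A * Real.exp (B * Y) * C * (2 * Real.exp 3 * Real.exp (-(δ / 2) * Y ^ 2)) ≤ N := by
    rw [hN]
    gcongr
    linarith
  set G : ℂ → ℂ := fun z => lapShift f E R T z * testFn δ ε κ z with hG
  have hH : ∀ s : ℝ, |s| = Y → Real.cos (κ * s) = 0 →
      ‖∫ x in (-(1 / 4) : ℝ)..1, G (x + s * I)‖ ≤ 2 * N := fun s hs hcs => by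
    refine (intervalIntegral.norm_integral_le_of_norm_le_const (C := N) fun x hx => ?_).trans ?_
    · rw [Set.uIoc_of_le (by norm_num)] at hx
      have hre : (x + s * I : ℂ).re = x := by simp
      have him : (x + s * I : ℂ).im = s := by simp
      have h1 := L.norm_lapShift_mul_testFn_le hδ0 hδ1 hε0 (by linarith) hκ0 hκ1 hT0
        (z := x + s * I) (by rw [hre, abs_le]; constructor <;> linarith [hx.1, hx.2])
        (by rw [him, hs]; exact hY) (by rw [him]; exact hcs)
      rwa [him, hs, ← sq_abs s, hs] at h1
    · rw [mul_comm]
      refine mul_le_mul_of_nonneg_right ?_ hN0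
      rw [abs_le]
      constructor <;> norm_num
  have hH1 := hH (-Y) (by rw [abs_neg, abs_of_pos (by linarith)]) (by rw [mul_neg, Real.cos_neg, hcos])
  have hH2 := hH Y (abs_of_pos (by linarith)) hcos
  have hV1 : (∫ y in (-Y)..Y, G ((1 : ℝ) + y * I)) =
      ∫ y in (-Y)..Y, lap (shiftPos f T) ((1 : ℝ) + y * I) * testFn δ ε κ ((1 : ℝ) + y * I) := by
    refine intervalIntegral.integral_congr fun y _ => ?_
    simp only [hG]
    rw [L.lapShift_of_pos T (by simp)]
  set F : ℂ → ℂ := fun z => lap (shiftNeg f T) z * testFn δ ε κ z with hF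
  set Q : ℂ → ℂ := fun z => R z / E z * (1 - cexp (z * T)) * testFn δ ε κ z with hQdef
  have hGQ : ∀ y : ℝ, G ((-(1 / 4) : ℝ) + y * I) =
      Q ((-(1 / 4) : ℝ) + y * I) + F ((-(1 / 4) : ℝ) + y * I) := fun y => by
    simp only [hG, hQdef, hF]
    rw [L.lapShift_of_neg T (by simp)]
    ring
  have hFd : Differentiable ℂ F := (L.differentiable_shiftNeg T).mul (differentiable_testFn δ ε κ)
  have hFc : Continuous fun y : ℝ => F ((-(1 / 4) : ℝ) + y * I) := hFd.continuous.comp (by fun_prop)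
  have hGc : Continuous fun y : ℝ => G ((-(1 / 4) : ℝ) + y * I) := by
    refine continuous_iff_continuousAt.2 fun y => ?_
    have hre : (((-(1 / 4) : ℝ) : ℂ) + y * I).re = -(1 / 4) := by simp
    have h1 : DifferentiableAt ℂ G ((-(1 / 4) : ℝ) + y * I) :=
      (L.differentiableAt_lapShift T (by rw [hre]; norm_num)
        fun h => by rw [hre] at h; norm_num at h).mul (differentiable_testFn δ ε κ _)
    exact ContinuousAt.comp (f := fun y : ℝ => ((-(1 / 4) : ℝ) : ℂ) + y * I) h1.continuousAt
      (by fun_prop)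
  have hV2 : (∫ y in (-Y)..Y, G ((-(1 / 4) : ℝ) + y * I)) -
      (∫ y in (-Y)..Y, F ((-(1 / 4) : ℝ) + y * I)) =
      ∫ y in (-Y)..Y, Q ((-(1 / 4) : ℝ) + y * I) := by
    rw [← intervalIntegral.integral_sub (hGc.intervalIntegrable _ _) (hFc.intervalIntegrable _ _)]
    refine intervalIntegral.integral_congr fun y _ => ?_
    rw [hGQ y, add_sub_cancel_right]
  rw [← hV1]
  change ‖_ - ∫ y in (-Y)..Y, F ((-(1 / 4) : ℝ) + y * I)‖ ≤ _
  change ‖rectIntegral G (-(1 / 4)) 1 (-Y) Y‖ ≤ η at hrect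
  set W := rectIntegral G (-(1 / 4)) 1 (-Y) Y with hW
  have e : I * ((∫ y in (-Y)..Y, G ((1 : ℝ) + y * I)) -
      ∫ y in (-Y)..Y, F ((-(1 / 4) : ℝ) + y * I)) =
      W - (∫ x in (-(1 / 4) : ℝ)..1, G (x + (-Y : ℝ) * I)) +
      (∫ x in (-(1 / 4) : ℝ)..1, G (x + Y * I)) +
      I * ∫ y in (-Y)..Y, Q ((-(1 / 4) : ℝ) + y * I) := by
    rw [← hV2, hW, rectIntegral]
    ring
  rw [show ∀ w : ℂ, ‖w‖ = ‖I * w‖ from fun w => by rw [norm_mul, norm_I, one_mul], e]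
  have n1 := norm_add_le (W - (∫ x in (-(1 / 4) : ℝ)..1, G (x + (-Y : ℝ) * I)) +
      (∫ x in (-(1 / 4) : ℝ)..1, G (x + Y * I)))
      (I * ∫ y in (-Y)..Y, Q ((-(1 / 4) : ℝ) + y * I))
  have n2 := norm_add_le (W - (∫ x in (-(1 / 4) : ℝ)..1, G (x + (-Y : ℝ) * I)))
      (∫ x in (-(1 / 4) : ℝ)..1, G (x + Y * I))
  have n3 := norm_sub_le W (∫ x in (-(1 / 4) : ℝ)..1, G (x + (-Y : ℝ) * I))
  rw [norm_mul I, norm_I, one_mul] at n1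
  have hQ' : ‖∫ y in (-Y)..Y, Q ((-(1 / 4) : ℝ) + y * I)‖ ≤ K * √ε + 2 * N :=
    hQ.trans (by linarith)
  linarith

/-- Smoothed jumps of `f` at the origin recur at arbitrarily large times, up to `O(√ε)`. -/
theorem exists_smoothJump_sub_le : ∃ K : ℝ, 0 ≤ K ∧ ∀ {δ : NNReal} {ε η T₀ : ℝ}, δ ≠ 0 → δ ≤ 1 →
    0 < ε → ε ≤ 1 / 2 → 0 < η → ∃ κ T : ℝ, 0 ≤ κ ∧ κ ≤ ε / 2 ∧ T₀ ≤ T ∧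
    |smoothJump δ ε κ f - smoothJump δ ε κ fun t => f (t + T)| ≤ K * √ε + η := by
  have hA := L.A_nonneg
  have hC := L.C_nonneg
  obtain ⟨K, hK, hmain⟩ := L.exists_norm_integral_sub_le
  refine ⟨K, hK, ?_⟩
  intro δ ε η T₀ hδ hδ1 hε0 hε1 hη
  have hδ0 : (0 : ℝ) < δ := by positivity
  have hδ1' : (δ : ℝ) ≤ 1 := by exact_mod_cast hδ1
  set g : ℝ → ℝ := fun y => 4 * C * (2 * Real.exp 3) * Real.exp (-(δ / 2 : ℝ) * y ^ 2) with hg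
  have hgi : Integrable g := (integrable_exp_neg_mul_sq (by positivity)).const_mul _
  have htail : Tendsto (fun Y : ℝ => (∫ y, g y) - ∫ y in (-Y)..Y, g y) atTop (𝓝 0) := by
    rw [← sub_self (∫ y, g y)]
    exact tendsto_const_nhds.sub
      (intervalIntegral_tendsto_integral hgi tendsto_neg_atTop_atBot tendsto_id)
  have hNt : Tendsto (fun Y : ℝ => 6 * ((2 * A * Real.exp (B * Y) + 2) * C *
      (2 * Real.exp 3 * Real.exp (-(δ / 2 : ℝ) * Y ^ 2)))) atTop (𝓝 0) := by
    have h1 := (tendsto_exp_mul_exp_neg_sq B hδ0).const_mul (24 * A * C * Real.exp 3)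
    have h2 := (tendsto_exp_mul_exp_neg_sq 0 hδ0).const_mul (24 * C * Real.exp 3)
    have h3 := h1.add h2
    rw [mul_zero, mul_zero, add_zero] at h3
    refine h3.congr fun Y => ?_
    rw [zero_mul, Real.exp_zero]
    ring
  have hev := ((htail.eventually (gt_mem_nhds (by positivity : (0 : ℝ) < η / 4))).and
    (hNt.eventually (gt_mem_nhds (by positivity : (0 : ℝ) < η / 4)))).and
    (eventually_ge_atTop (max 1 (Real.pi / ε)))
  obtain ⟨Y₀, hY₀⟩ := eventually_atTop.1 hev
  obtain ⟨Y, hYY, hE1, hE2⟩ := L.exists_large_ne_zero Y₀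
  obtain ⟨⟨ht, hN⟩, hYge⟩ := hY₀ Y hYY
  have hY1 : 1 ≤ Y := (le_max_left _ _).trans hYge
  have hY0 : 0 < Y := by linarith
  have hYε : Real.pi / ε ≤ Y := (le_max_right _ _).trans hYge
  set κ : ℝ := Real.pi / (2 * Y) with hκ
  have hκ0 : 0 ≤ κ := by positivity
  have hκε : κ ≤ ε / 2 := by
    rw [div_le_iff₀ hε0] at hYε
    rw [hκ, div_le_iff₀ (by positivity)]
    linarith
  have hcos : Real.cos (κ * Y) = 0 := by
    rw [hκ, show Real.pi / (2 * Y) * Y = Real.pi / 2 by field_simp, Real.cos_pi_div_two]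
  obtain ⟨T, hT, hle⟩ := hmain hδ0 hδ1' hε0.le hε1 hκ0 (by linarith) hY1 hcos hE1 hE2
    (by positivity : 0 < η / 4) (le_max_right T₀ 0)
  refine ⟨κ, T, hκ0, hκε, (le_max_left _ _).trans hT, ?_⟩
  have mp := measurable_shiftPos L.meas T
  have mn := measurable_shiftNeg L.meas T
  obtain ⟨ip, ep⟩ := integral_lap_mul_testFn mp (laplace_integrable_right mp
    (abs_shiftPos_le L.bound T) (fun t => shiftPos_of_nonpos T) one_pos).1 hδ ε κ
  obtain ⟨im, em⟩ := integral_lap_mul_testFn mn (laplace_integrable_left mn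
    (abs_shiftNeg_le L.bound T) (fun t => shiftNeg_of_pos T)
    (by norm_num : -(1 / 4 : ℝ) < 0)).1 hδ ε κ
  have hgb : ∀ {z : ℂ} {u : ℂ}, |z.re| ≤ 1 → ‖u‖ ≤ 4 * C → ‖u * testFn δ ε κ z‖ ≤ g z.im :=
    fun {z u} hz hu => by
      have h3 := norm_testFn_le hδ0 hδ1' hε0.le (by linarith) hκ0 (by linarith : κ ≤ 1) hz
      rw [norm_mul, hg]
      simp only
      rw [mul_assoc (4 * C)]
      gcongr
  have tp := norm_integral_sub_intervalIntegral_le ip hgi (fun y => by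
    have h1 := norm_lap_le_right mp (abs_shiftPos_le L.bound T) (fun t => shiftPos_of_nonpos T)
      (z := (1 : ℝ) + y * I) (by simp)
    have h2 := hgb (z := (1 : ℝ) + y * I) (u := lap (shiftPos f T) ((1 : ℝ) + y * I)) (by simp)
      (h1.trans (by simp; linarith))
    simpa using h2) hY0.le
  have tm := norm_integral_sub_intervalIntegral_le im hgi (fun y => by
    have h1 := norm_lap_le_left mn (abs_shiftNeg_le L.bound T) (fun t => shiftNeg_of_pos T)
      (z := (-(1 / 4) : ℝ) + y * I) (by simp)
    have h2 := hgb (z := (-(1 / 4) : ℝ) + y * I)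
      (u := lap (shiftNeg f T) ((-(1 / 4) : ℝ) + y * I))
      (by
        have : (((-(1 / 4) : ℝ) : ℂ) + y * I).re = -(1 / 4) := by simp
        rw [this, abs_le]
        norm_num)
      (h1.trans_eq (by
        have : (((-(1 / 4) : ℝ) : ℂ) + y * I).re = -(1 / 4) := by simp
        rw [this]
        ring))
    simpa using h2) hY0.le
  rw [ep] at tp
  rw [em] at tm
  have mf : Measurable fun t => f (t + T) := L.meas.comp (by fun_prop)
  have hs : smoothJump δ ε κ f - smoothJump δ ε κ (fun t => f (t + T)) =
      smoothJump δ ε κ (shiftPos f T) - smoothJump δ ε κ (shiftNeg f T) := by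
    rw [← smoothJump_sub L.meas L.bound mf (fun t => L.bound _),
      ← smoothJump_sub mp (abs_shiftPos_le L.bound T) mn (abs_shiftNeg_le L.bound T)]
    congr 1
    funext t
    exact (shiftPos_sub_shiftNeg L.zero T t).symm
  rw [hs]
  set P := smoothJump δ ε κ (shiftPos f T)
  set M := smoothJump δ ε κ (shiftNeg f T)
  have h5 : ‖(2 * Real.pi * (P : ℂ) - 2 * Real.pi * (M : ℂ))‖ ≤ K * √ε + η := by
    set a : ℂ := ∫ y in (-Y)..Y, lap (shiftPos f T) ((1 : ℝ) + y * I) *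
      testFn δ ε κ ((1 : ℝ) + y * I)
    set b : ℂ := ∫ y in (-Y)..Y, lap (shiftNeg f T) ((-(1 / 4) : ℝ) + y * I) *
      testFn δ ε κ ((-(1 / 4) : ℝ) + y * I)
    have e : (2 * Real.pi * (P : ℂ) - 2 * Real.pi * (M : ℂ)) =
        (2 * Real.pi * (P : ℂ) - a) - (2 * Real.pi * (M : ℂ) - b) + (a - b) := by ring
    rw [e]
    have n1 := norm_add_le ((2 * Real.pi * (P : ℂ) - a) - (2 * Real.pi * (M : ℂ) - b)) (a - b)
    have n2 := norm_sub_le (2 * Real.pi * (P : ℂ) - a) (2 * Real.pi * (M : ℂ) - b)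
    linarith
  have h6 : ‖(2 * Real.pi * (P : ℂ) - 2 * Real.pi * (M : ℂ))‖ = 2 * Real.pi * |P - M| := by
    rw [← mul_sub, ← ofReal_sub, ← ofReal_ofNat, ← ofReal_mul, ← ofReal_mul, norm_real,
      Real.norm_eq_abs, abs_mul, abs_of_pos (by positivity)]
  rw [h6] at h5
  nlinarith [Real.pi_gt_three, abs_nonneg (P - M)]

/-- The oscillation of `f` at infinity is at least the size of its jump at the origin. -/
theorem one_le_sub_of_eventually {ℓ : ℝ} (hℓ : 0 < ℓ)
    (hf : ∀ t, 0 < t → t < ℓ → f t = Real.exp (-(t / 2))) {a b t₁ : ℝ}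
    (ha : ∀ t, t₁ ≤ t → f t ≤ a) (hb : ∀ t, t₁ ≤ t → b ≤ f t) : 1 ≤ a - b := by
  obtain ⟨K, hK, hmain⟩ := L.exists_smoothJump_sub_le
  set C' : ℝ := C + |a| + |b| + 1 with hC'
  have hC := L.C_nonneg
  have hC'0 : 0 ≤ C' := by positivity
  have hfC' : ∀ t, |f t| ≤ C' := fun t => (L.bound t).trans (by
    linarith [abs_nonneg a, abs_nonneg b])
  have key : ∀ ε : ℝ, 0 < ε → ε ≤ 1 / 2 → 2 * ε < ℓ → Real.exp (-ε) ≤ a - b + K * √ε + 5 * ε := by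
    intro ε hε0 hε1 hεℓ
    set r : ℝ := ε ^ 3 / (16 * (C' + 1)) with hr
    have hr0 : 0 < r := by positivity
    have hr1 : r ≤ 1 := by
      rw [hr, div_le_one (by positivity)]
      nlinarith [pow_le_one₀ hε0.le (by linarith : ε ≤ 1) (n := 3)]
    set δ : NNReal := ⟨r, hr0.le⟩ with hδ
    have hδ0 : δ ≠ 0 := by
      rw [← NNReal.coe_ne_zero]
      exact hr0.ne'
    have hδr : (δ : ℝ) = r := rfl
    obtain ⟨κ, T, hκ0, hκ1, hT, hle⟩ := hmain (T₀ := t₁ + 2) hδ0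
      (by rw [← NNReal.coe_le_coe]; exact hr1) hε0 hε1 hε0
    have hbd1 : 2 * C' * (δ / (ε / 2) ^ 2) ≤ ε := by
      rw [hδr, hr]
      have : 2 * C' * (ε ^ 3 / (16 * (C' + 1)) / (ε / 2) ^ 2) = ε * (C' / (C' + 1) / 2) := by
        field_simp
        ring
      rw [this]
      have h1 : C' / (C' + 1) ≤ 1 := by
        rw [div_le_one (by linarith)]
        linarith
      nlinarith
    have hbd2 : 2 * C' * (δ / 1 ^ 2) ≤ ε := by
      refine le_trans ?_ hbd1
      rw [one_pow]
      have h1 : (ε / 2) ^ 2 ≤ 1 := by nlinarith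
      gcongr
    have hexp1 : |Real.exp (-ε)| ≤ C' := by
      rw [Real.abs_exp]
      have : Real.exp (-ε) ≤ 1 := Real.exp_le_one_iff.2 (by linarith)
      linarith [abs_nonneg a, abs_nonneg b]
    have hε2 : 0 < ε / 2 := by positivity
    have lowpos : ∀ p : ℝ, ε / 2 ≤ p → p ≤ 3 * ε / 2 → Real.exp (-ε) - ε ≤ gaussMean δ p f := by
      intro p hp1 hp2
      have := le_gaussMean L.meas hfC' hδ0 (p := p) hε2 hexp1 (fun t ht => by
        rw [abs_lt] at ht
        rw [hf t (by linarith) (by linarith)]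
        exact Real.exp_le_exp.2 (by linarith))
      linarith
    have upneg : ∀ p : ℝ, p ≤ -(ε / 2) → gaussMean δ p f ≤ ε := by
      intro p hp
      have := gaussMean_le L.meas hfC' hδ0 (p := p) hε2 (u := 0) (by simpa using hC'0)
        (fun t ht => by
          rw [abs_lt] at ht
          rw [L.zero t (by linarith)])
      linarith
    have mf : Measurable fun t => f (t + T) := L.meas.comp (by fun_prop)
    have haC : |a| ≤ C' := by linarith [abs_nonneg a, abs_nonneg b]
    have hbC : |b| ≤ C' := by linarith [abs_nonneg a, abs_nonneg b]
    have shiftle : ∀ p : ℝ, |p| ≤ 1 → gaussMean δ p (fun t => f (t + T)) ≤ a + ε := by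
      intro p hp
      have := gaussMean_le mf (fun t => hfC' _) hδ0 (p := p) one_pos haC (fun t ht => by
        rw [abs_lt] at ht
        rw [abs_le] at hp
        exact ha _ (by linarith))
      linarith
    have leshift : ∀ p : ℝ, |p| ≤ 1 → b - ε ≤ gaussMean δ p (fun t => f (t + T)) := by
      intro p hp
      have := le_gaussMean mf (fun t => hfC' _) hδ0 (p := p) one_pos hbC (fun t ht => by
        rw [abs_lt] at ht
        rw [abs_le] at hp
        exact hb _ (by linarith))
      linarith
    have j1 : Real.exp (-ε) - 2 * ε ≤ smoothJump δ ε κ f := by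
      rw [smoothJump]
      linarith [lowpos (ε + κ) (by linarith) (by linarith), lowpos (ε - κ) (by linarith) (by linarith),
        upneg (-(ε + κ)) (by linarith), upneg (-(ε - κ)) (by linarith)]
    have hab : ∀ p : ℝ, -1 ≤ p → p ≤ 1 → |p| ≤ 1 := fun p h1 h2 => abs_le.2 ⟨h1, h2⟩
    have j2 : (smoothJump δ ε κ fun t => f (t + T)) ≤ a - b + 2 * ε := by
      rw [smoothJump]
      linarith [shiftle (ε + κ) (hab _ (by linarith) (by linarith)),
        shiftle (ε - κ) (hab _ (by linarith) (by linarith)),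
        leshift (-(ε + κ)) (hab _ (by linarith) (by linarith)),
        leshift (-(ε - κ)) (hab _ (by linarith) (by linarith))]
    linarith [(abs_le.1 hle).2]
  have hlim1 : Tendsto (fun ε : ℝ => Real.exp (-ε)) (𝓝[>] 0) (𝓝 1) := by
    have : Tendsto (fun ε : ℝ => Real.exp (-ε)) (𝓝 0) (𝓝 (Real.exp (-0))) :=
      (Continuous.tendsto (by fun_prop) 0)
    rw [neg_zero, Real.exp_zero] at this
    exact this.mono_left nhdsWithin_le_nhds
  have hlim2 : Tendsto (fun ε : ℝ => a - b + K * √ε + 5 * ε) (𝓝[>] 0) (𝓝 (a - b)) := by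
    have : Tendsto (fun ε : ℝ => a - b + K * √ε + 5 * ε) (𝓝 0) (𝓝 (a - b + K * √0 + 5 * 0)) :=
      (Continuous.tendsto (by fun_prop) 0)
    rw [Real.sqrt_zero, mul_zero, mul_zero, add_zero, add_zero] at this
    exact this.mono_left nhdsWithin_le_nhds
  refine le_of_tendsto_of_tendsto hlim1 hlim2 ?_
  have hmem : Set.Ioo (0 : ℝ) (min (1 / 2) (ℓ / 2)) ∈ 𝓝[>] (0 : ℝ) :=
    Ioo_mem_nhdsGT (by positivity)
  filter_upwards [hmem] with ε hε
  have h1 := hε.2.trans_le (min_le_left _ _)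
  have h2 := hε.2.trans_le (min_le_right _ _)
  exact key ε hε.1 h1.le (by linarith)

end LaplaceData

end JumpTheorem

section MoebiusInversion

variable {K : Type} [Field K] [NumberField K]

open scoped nonZeroDivisors

lemma moebiusK_one : moebiusK K 1 = 1 := by
  rw [moebiusK, if_pos squarefree_one, UniqueFactorizationMonoid.factors_one]
  simp

lemma abs_moebiusK_le (I : Ideal (𝓞 K)) : |(moebiusK K I : ℝ)| ≤ 1 := by
  unfold moebiusK
  split_ifs
  · simp
  · simp

lemma moebiusK_prime_mul {P I : Ideal (𝓞 K)} (hP : Prime P) (hI : I ≠ 0) (h : ¬ P ∣ I) :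
    moebiusK K (P * I) = -moebiusK K I := by
  have hsq : Squarefree (P * I) ↔ Squarefree I := by
    rw [squarefree_mul_iff, hP.irreducible.isRelPrime_iff_not_dvd]
    exact ⟨fun h1 => h1.2.2, fun h1 => ⟨h, hP.irreducible.squarefree, h1⟩⟩
  have hcard : (UniqueFactorizationMonoid.factors (P * I)).card =
      1 + (UniqueFactorizationMonoid.factors I).card := by
    rw [Multiset.card_eq_card_of_rel (UniqueFactorizationMonoid.factors_mul hP.ne_zero hI),
      Multiset.card_add]
    obtain ⟨q, -, hq⟩ := prime_factors_irreducible hP.irreducible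
      ⟨fun b hb => UniqueFactorizationMonoid.prime_of_factor b hb,
        UniqueFactorizationMonoid.factors_prod hP.ne_zero⟩
    rw [hq, Multiset.card_singleton]
  unfold moebiusK
  rw [hcard]
  simp only [hsq]
  split_ifs
  · ring
  · simp

lemma moebiusK_eq_zero {P I : Ideal (𝓞 K)} (hP : Prime P) (h : P ∣ I) : moebiusK K (P * I) = 0 := by
  refine if_neg fun hsq => hP.not_isUnit (hsq P (mul_dvd_mul_left P h))

lemma sum_moebiusK_divisors {J : Ideal (𝓞 K)} (hJ : J ≠ 0) (hJ1 : J ≠ 1)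
    [Fintype {I : Ideal (𝓞 K) // I ∣ J}] : ∑ I : {I : Ideal (𝓞 K) // I ∣ J}, moebiusK K I.1 = 0 := by
  obtain ⟨P, hPi, hPJ⟩ := WfDvdMonoid.exists_irreducible_factor
    (fun h => hJ1 (by rwa [isUnit_iff_eq_one] at h)) hJ
  have hP : Prime P := hPi.prime
  have hne : ∀ I : {I : Ideal (𝓞 K) // I ∣ J}, I.1 ≠ 0 := fun I h => by
    have := I.2
    rw [h, zero_dvd_iff] at this
    exact hJ this
  have hmul : ∀ {I : Ideal (𝓞 K)}, I ∣ J → ¬ P ∣ I → P * I ∣ J := fun {I} hI h => by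
    obtain ⟨L, rfl⟩ := hI
    rcases hP.dvd_or_dvd hPJ with h1 | h1
    · exact absurd h1 h
    · rw [mul_comm]
      exact mul_dvd_mul_left I h1
  rw [← Finset.sum_filter_add_sum_filter_not Finset.univ
    (fun I : {I : Ideal (𝓞 K) // I ∣ J} => P ∣ I.1)]
  have h1 : ∑ I ∈ Finset.univ.filter (fun I : {I : Ideal (𝓞 K) // I ∣ J} => P ∣ I.1),
      moebiusK K I.1 = ∑ I ∈ Finset.univ.filter (fun I : {I : Ideal (𝓞 K) // I ∣ J} => ¬ P ∣ I.1),
      -moebiusK K I.1 := by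
    symm
    refine Finset.sum_bij_ne_zero
      (fun I hI _ => ⟨P * I.1, hmul I.2 (Finset.mem_filter.1 hI).2⟩) ?_ ?_ ?_ ?_
    · intro I hI _
      exact Finset.mem_filter.2 ⟨Finset.mem_univ _, dvd_mul_right _ _⟩
    · intro I hI _ I' hI' _ h
      exact Subtype.ext (mul_left_cancel₀ hP.ne_zero (Subtype.ext_iff.1 h))
    · rintro ⟨I, hI⟩ hI' h
      obtain ⟨L, rfl⟩ := (Finset.mem_filter.1 hI').2
      have hL : ¬ P ∣ L := fun hL => h (moebiusK_eq_zero hP hL)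
      have hL0 : L ≠ 0 := by
        rintro rfl
        exact hL (dvd_zero P)
      refine ⟨⟨L, (dvd_mul_left L P).trans hI⟩, Finset.mem_filter.2 ⟨Finset.mem_univ _, hL⟩, ?_, rfl⟩
      rw [← moebiusK_prime_mul hP hL0 hL]
      exact h
    · intro I hI _
      exact (moebiusK_prime_mul hP (hne I) (Finset.mem_filter.1 hI).2).symm
  rw [h1, ← Finset.sum_add_distrib]
  simp

/-- The Dirichlet series of the Möbius function inverts the zeta function. -/
theorem tsum_moebiusK_mul_idealZeta {s : ℝ} (hs : 1 < s) :
    (∑' 𝔞 : (Ideal (𝓞 K))⁰, (moebiusK K 𝔞.1 : ℝ) * (Ideal.absNorm 𝔞.1 : ℝ) ^ (-s)) *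
      idealZeta K s = 1 := by
  have hz := summable_absNorm_rpow (K := K) hs
  have hnn : ∀ 𝔞 : (Ideal (𝓞 K))⁰, 0 ≤ (Ideal.absNorm 𝔞.1 : ℝ) ^ (-s) := fun 𝔞 => by positivity
  have hz' : Summable fun 𝔞 : (Ideal (𝓞 K))⁰ => ‖(Ideal.absNorm 𝔞.1 : ℝ) ^ (-s)‖ := hz.norm
  have hm : Summable fun 𝔞 : (Ideal (𝓞 K))⁰ =>
      ‖(moebiusK K 𝔞.1 : ℝ) * (Ideal.absNorm 𝔞.1 : ℝ) ^ (-s)‖ := by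
    refine Summable.of_nonneg_of_le (fun _ => norm_nonneg _) (fun 𝔞 => ?_) hz
    rw [norm_mul, Real.norm_eq_abs, Real.norm_eq_abs, abs_of_nonneg (hnn 𝔞)]
    exact mul_le_of_le_one_left (hnn 𝔞) (abs_moebiusK_le _)
  rw [idealZeta, tsum_mul_tsum_of_summable_norm hm hz']
  have hsum := summable_mul_of_summable_norm hm hz'
  set e := Equiv.sigmaFiberEquiv fun p : (Ideal (𝓞 K))⁰ × (Ideal (𝓞 K))⁰ => p.1 * p.2 with he
  have hsum' := (e.summable_iff).2 hsum
  rw [← e.tsum_eq]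
  refine (hsum'.tsum_sigma).trans ?_
  simp only [Function.comp_apply]
  have hterm : ∀ (J : (Ideal (𝓞 K))⁰)
      (p : {p : (Ideal (𝓞 K))⁰ × (Ideal (𝓞 K))⁰ // p.1 * p.2 = J}),
      (moebiusK K (e ⟨J, p⟩).1.1 : ℝ) * (Ideal.absNorm (e ⟨J, p⟩).1.1 : ℝ) ^ (-s) *
        (Ideal.absNorm (e ⟨J, p⟩).2.1 : ℝ) ^ (-s) =
      (moebiusK K p.1.1.1 : ℝ) * (Ideal.absNorm J.1 : ℝ) ^ (-s) := by
    rintro _ ⟨⟨I, L⟩, rfl⟩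
    change (moebiusK K I.1 : ℝ) * (Ideal.absNorm I.1 : ℝ) ^ (-s) * (Ideal.absNorm L.1 : ℝ) ^ (-s) =
      (moebiusK K I.1 : ℝ) * (Ideal.absNorm (I.1 * L.1) : ℝ) ^ (-s)
    rw [map_mul, Nat.cast_mul, Real.mul_rpow (by positivity) (by positivity), mul_assoc]
  have hfib : ∀ J : (Ideal (𝓞 K))⁰,
      ∑' p : {p : (Ideal (𝓞 K))⁰ × (Ideal (𝓞 K))⁰ // p.1 * p.2 = J}, (moebiusK K p.1.1.1 : ℝ) =
      if J = 1 then 1 else 0 := by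
    intro J
    have hJ : J.1 ≠ 0 := nonZeroDivisors.ne_zero J.2
    let _ := UniqueFactorizationMonoid.fintypeSubtypeDvd J.1 hJ
    let ψ : {p : (Ideal (𝓞 K))⁰ × (Ideal (𝓞 K))⁰ // p.1 * p.2 = J} ≃ {I : Ideal (𝓞 K) // I ∣ J.1} :=
      Equiv.ofBijective (fun p => ⟨p.1.1.1, ⟨p.1.2.1, (congrArg Subtype.val p.2).symm⟩⟩) (by
        constructor
        · rintro ⟨⟨I, L⟩, h⟩ ⟨⟨I', L'⟩, h'⟩ hp
          have h1 : I.1 = I'.1 := congrArg (fun x : {I : Ideal (𝓞 K) // I ∣ J.1} => x.1) hp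
          have h2 : I = I' := Subtype.ext h1
          subst h2
          have h3 : I.1 * L.1 = I.1 * L'.1 := Subtype.ext_iff.1 (h.trans h'.symm)
          have h4 : L = L' := Subtype.ext (mul_left_cancel₀ (nonZeroDivisors.ne_zero I.2) h3)
          subst h4
          rfl
        · rintro ⟨I, L, hL⟩
          have h1 : I ≠ 0 := fun h => hJ (by rw [hL, h, zero_mul])
          have h2 : L ≠ 0 := fun h => hJ (by rw [hL, h, mul_zero])
          exact ⟨⟨⟨⟨I, mem_nonZeroDivisors_of_ne_zero h1⟩, ⟨L, mem_nonZeroDivisors_of_ne_zero h2⟩⟩,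
            Subtype.ext hL.symm⟩, rfl⟩)
    refine (ψ.tsum_eq fun I : {I : Ideal (𝓞 K) // I ∣ J.1} => (moebiusK K I.1 : ℝ)).trans ?_
    rw [tsum_fintype]
    split_ifs with h1
    · subst h1
      have huniq : ∀ I : {I : Ideal (𝓞 K) // I ∣ (1 : (Ideal (𝓞 K))⁰).1}, I = ⟨1, one_dvd _⟩ :=
        fun I => Subtype.ext (isUnit_iff_eq_one.1 (isUnit_of_dvd_one I.2))
      rw [Fintype.sum_eq_single ⟨1, one_dvd _⟩ fun I hI => absurd (huniq I) hI]
      simp only [moebiusK_one, Int.cast_one]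
    · exact_mod_cast sum_moebiusK_divisors hJ fun h => h1 (Subtype.ext h)
  simp only [hterm, tsum_mul_right, hfib]
  rw [tsum_eq_single 1 fun J hJ => by rw [if_neg hJ, zero_mul]]
  simp

end MoebiusInversion

section GammaRatios

lemma norm_Gamma_le_Gamma_re {s : ℂ} (hs : 0 < s.re) : ‖Complex.Gamma s‖ ≤ Real.Gamma s.re := by
  rw [Complex.Gamma_eq_integral hs, Complex.GammaIntegral, Real.Gamma_eq_integral hs]
  refine (norm_integral_le_integral_norm _).trans_eq (setIntegral_congr_fun measurableSet_Ioi ?_)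
  intro x hx
  change ‖((Real.exp (-x) : ℝ) : ℂ) * (x : ℂ) ^ (s - 1)‖ = Real.exp (-x) * x ^ (s.re - 1)
  rw [norm_mul, norm_real, Real.norm_of_nonneg (Real.exp_pos _).le,
    Complex.norm_cpow_eq_rpow_re_of_pos hx, sub_re, one_re]

lemma exists_norm_Gamma_le : ∃ M : ℝ, 1 ≤ M ∧ ∀ w : ℂ, 1 / 4 ≤ w.re → w.re ≤ 3 / 2 →
    ‖Complex.Gamma w‖ ≤ M := by
  have hc : ContinuousOn Real.Gamma (Set.Icc (1 / 4) (3 / 2)) := fun x hx =>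
    (Real.differentiableAt_Gamma fun m h => by
      have h1 := hx.1
      have h2 : (0 : ℝ) ≤ m := m.cast_nonneg
      linarith).continuousAt.continuousWithinAt
  obtain ⟨M, hM⟩ := isCompact_Icc.exists_bound_of_continuousOn hc
  refine ⟨max M 1, le_max_right _ _, fun w h1 h2 => ?_⟩
  refine (norm_Gamma_le_Gamma_re ?_).trans ?_
  · linarith
  · exact ((le_abs_self _).trans (hM _ ⟨h1, h2⟩)).trans (le_max_left _ _)

lemma norm_sin_le_exp (w : ℂ) : ‖Complex.sin w‖ ≤ Real.exp |w.im| := by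
  have h1 : Real.exp w.im ≤ Real.exp |w.im| := Real.exp_le_exp.2 (le_abs_self _)
  have h2 : Real.exp (-w.im) ≤ Real.exp |w.im| := Real.exp_le_exp.2 (neg_le_abs _)
  have h3 := norm_sub_le (cexp (-w * I)) (cexp (w * I))
  have e1 : (-w * I).re = w.im := by simp
  have e2 : (w * I).re = -w.im := by simp
  rw [Complex.norm_exp, Complex.norm_exp, e1, e2] at h3
  rw [Complex.sin, norm_div, norm_mul, norm_I, mul_one, Complex.norm_ofNat]
  linarith

/-- A lower bound for the Gamma function through the reflection formula. -/
lemma one_le_norm_Gamma_mul (w : ℂ) (hw : 0 < w.re) (hw1 : w.im ≠ 0) :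
    1 ≤ ‖Complex.Gamma w‖ * (‖Complex.Gamma (1 - w)‖ * Real.exp (Real.pi * |w.im|)) := by
  have hsin : Complex.sin (Real.pi * w) ≠ 0 := fun h => by
    obtain ⟨k, hk⟩ := Complex.sin_eq_zero_iff.1 h
    have := congrArg im hk
    simp [Real.pi_ne_zero] at this
    exact hw1 this
  have h := Complex.Gamma_mul_Gamma_one_sub w
  rw [eq_div_iff hsin] at h
  have h2 := congrArg norm h
  rw [norm_mul, norm_mul, norm_real, Real.norm_eq_abs, abs_of_pos Real.pi_pos] at h2
  have h3 := norm_sin_le_exp (Real.pi * w)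
  have e : ((Real.pi : ℂ) * w).im = Real.pi * w.im := by simp
  rw [e, abs_mul, abs_of_pos Real.pi_pos] at h3
  rw [← mul_assoc]
  calc (1 : ℝ) ≤ Real.pi := by linarith [Real.pi_gt_three]
    _ = ‖Complex.Gamma w‖ * ‖Complex.Gamma (1 - w)‖ * ‖Complex.sin (Real.pi * w)‖ := h2.symm
    _ ≤ _ := by gcongr

lemma norm_Gamma_le_norm_Gamma_add_one {s : ℂ} (h : 1 ≤ |s.im|) :
    ‖Complex.Gamma s‖ ≤ 1 / |s.im| * ‖Complex.Gamma (s + 1)‖ := by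
  have h0 : s ≠ 0 := by
    rintro rfl
    norm_num at h
  rw [Complex.Gamma_add_one s h0, norm_mul, ← mul_assoc]
  refine le_mul_of_one_le_left (norm_nonneg _) ?_
  rw [div_mul_eq_mul_div, one_mul, one_le_div (by linarith)]
  exact abs_im_le_norm s

lemma norm_Gamma_half_le {s : ℂ} (h : 1 ≤ |s.im|) :
    ‖Complex.Gamma (s / 2)‖ ≤ 2 / |s.im| * ‖Complex.Gamma (s / 2 + 1)‖ := by
  have h0 : s / 2 ≠ 0 := by
    intro h1
    rw [div_eq_zero_iff] at h1
    rcases h1 with rfl | h1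
    · norm_num at h
    · norm_num at h1
  rw [Complex.Gamma_add_one _ h0, norm_mul, ← mul_assoc]
  refine le_mul_of_one_le_left (norm_nonneg _) ?_
  have h1 : 0 < |s.im| := by linarith
  rw [norm_div, Complex.norm_ofNat, div_mul_div_comm, one_le_div (mul_pos h1 two_pos), mul_comm]
  exact mul_le_mul_of_nonneg_left (abs_im_le_norm s) zero_le_two

lemma exists_norm_Gamma_ratio_le : ∃ M : ℝ, 1 ≤ M ∧ ∀ s : ℂ, -(1 / 2) ≤ s.re → s.re ≤ 1 / 2 →
    1 ≤ |s.im| → ‖Complex.Gamma s‖ ≤ M * Real.exp (Real.pi * |s.im|) * ‖Complex.Gamma (1 - s)‖ ∧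
      ‖Complex.Gamma (s / 2)‖ ≤ M * Real.exp (Real.pi * |s.im|) * ‖Complex.Gamma ((1 - s) / 2)‖ := by
  obtain ⟨M, hM1, hM⟩ := exists_norm_Gamma_le
  refine ⟨2 * M * M, by nlinarith, fun s h1 h2 h3 => ?_⟩
  have hinv : 1 / |s.im| ≤ 1 := by rw [div_le_one (by linarith)]; exact h3
  have hinv2 : 2 / |s.im| ≤ 2 := by rw [div_le_iff₀ (by linarith)]; linarith
  have him : s.im ≠ 0 := fun h => by norm_num [h] at h3
  have g1 : ‖Complex.Gamma s‖ ≤ 1 * M := (norm_Gamma_le_norm_Gamma_add_one h3).trans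
    (mul_le_mul hinv (hM _ (by simp; linarith) (by simp; linarith)) (norm_nonneg _) zero_le_one)
  have e2 : (s / 2).re = s.re / 2 := by simp
  have e3 : ((1 - s) / 2).re = (1 - s.re) / 2 := by simp
  have e4 : ((1 - s) / 2).im = -(s.im / 2) := by simp; ring
  have g2 : ‖Complex.Gamma (s / 2)‖ ≤ 2 * M := (norm_Gamma_half_le h3).trans
    (mul_le_mul hinv2 (hM _ (by rw [add_re, e2, one_re]; linarith)
      (by rw [add_re, e2, one_re]; linarith)) (norm_nonneg _) zero_le_two)
  constructor
  · have h4 := one_le_norm_Gamma_mul (1 - s) (by simp; linarith) (by simpa using him)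
    rw [sub_sub_cancel, show (1 - s).im = -s.im by simp, abs_neg] at h4
    calc ‖Complex.Gamma s‖ ≤ 2 * M := by linarith
      _ ≤ 2 * M * (‖Complex.Gamma (1 - s)‖ *
          (‖Complex.Gamma s‖ * Real.exp (Real.pi * |s.im|))) :=
        le_mul_of_one_le_right (by linarith) h4
      _ ≤ 2 * M * (‖Complex.Gamma (1 - s)‖ * (M * Real.exp (Real.pi * |s.im|))) := by
        rw [one_mul] at g1
        gcongr
      _ = _ := by ring
  · have h4 := one_le_norm_Gamma_mul ((1 - s) / 2) (by rw [e3]; linarith)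
      (by rw [e4]; exact neg_ne_zero.2 (by positivity))
    have h5 := hM (1 - (1 - s) / 2) (by rw [sub_re, e3, one_re]; linarith)
      (by rw [sub_re, e3, one_re]; linarith)
    have h6 : Real.exp (Real.pi * |((1 - s) / 2).im|) ≤ Real.exp (Real.pi * |s.im|) := by
      rw [e4, abs_neg, abs_div, abs_two]
      gcongr
      linarith [abs_nonneg s.im]
    calc ‖Complex.Gamma (s / 2)‖ ≤ 2 * M := g2
      _ ≤ 2 * M * (‖Complex.Gamma ((1 - s) / 2)‖ *
          (‖Complex.Gamma (1 - (1 - s) / 2)‖ * Real.exp (Real.pi * |((1 - s) / 2).im|))) :=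
        le_mul_of_one_le_right (by linarith) h4
      _ ≤ 2 * M * (‖Complex.Gamma ((1 - s) / 2)‖ * (M * Real.exp (Real.pi * |s.im|))) := by
        gcongr
      _ = _ := by ring

lemma norm_Gamma_conj (s : ℂ) : ‖Complex.Gamma ((starRingEnd ℂ) s)‖ = ‖Complex.Gamma s‖ := by
  rw [Complex.Gamma_conj, Complex.norm_conj]

/-- On the line `re s = -1/2` the Gamma factors gain powers of the imaginary part. -/
lemma norm_Gamma_le_of_re_eq {s : ℂ} (hs : s.re = -(1 / 2)) (h : 1 ≤ |s.im|) :
    ‖Complex.Gamma s‖ ≤ 1 / |s.im| * ‖Complex.Gamma (1 - s)‖ ∧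
      ‖Complex.Gamma (s / 2)‖ ≤ 2 / |s.im| * ‖Complex.Gamma ((1 - s) / 2)‖ := by
  constructor
  · refine (norm_Gamma_le_norm_Gamma_add_one h).trans (mul_le_mul_of_nonneg_left ?_ (by positivity))
    have h1 := norm_Gamma_le_norm_Gamma_add_one (s := s + 1) (by simpa using h)
    have h2 : 1 - s = (starRingEnd ℂ) (s + 1 + 1) := by
      apply Complex.ext
      · simp [hs]; norm_num
      · simp
    rw [h2, norm_Gamma_conj]
    refine h1.trans (mul_le_of_le_one_left (norm_nonneg _) ?_)
    have e : (s + 1).im = s.im := by simp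
    rw [e, div_le_one (by linarith)]
    exact h
  · have h2 : (1 - s) / 2 = (starRingEnd ℂ) (s / 2 + 1) := by
      rw [map_add, map_div₀, Complex.conj_ofNat, map_one, div_add_one two_ne_zero]
      congr 1
      apply Complex.ext
      · simp [hs]; norm_num
      · simp
    rw [h2, norm_Gamma_conj]
    exact norm_Gamma_half_le h

end GammaRatios

section MertensFunction

variable {K : Type} [Field K] [NumberField K]

open scoped nonZeroDivisors

/-- The weight with which an ideal of norm `n` counts in the Mertens function at `x`. -/
def mertensWeight (n x : ℝ) : ℝ := if n < x then 1 else if n = x then 1 / 2 else 0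

lemma mertensWeight_nonneg (n x : ℝ) : 0 ≤ mertensWeight n x := by
  unfold mertensWeight
  split_ifs <;> norm_num

lemma mertensWeight_of_lt {n x : ℝ} (h : x < n) : mertensWeight n x = 0 := by
  rw [mertensWeight, if_neg h.le.not_gt, if_neg h.ne']

lemma mertensWeight_le {n x : ℝ} (hn : 1 ≤ n) (hx : 0 < x) :
    mertensWeight n x ≤ x ^ (2 : ℝ) * n ^ (-2 : ℝ) := by
  have hn0 : 0 < n := by linarith
  rcases lt_or_ge x n with h | h
  · rw [mertensWeight_of_lt h]
    positivity
  · have h1 : mertensWeight n x ≤ 1 := by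
      unfold mertensWeight
      split_ifs <;> norm_num
    refine h1.trans ?_
    rw [Real.rpow_neg hn0.le, ← div_eq_mul_inv, one_le_div (by positivity)]
    gcongr

lemma measurable_mertensWeight (n : ℝ) : Measurable (mertensWeight n) :=
  Measurable.ite (measurableSet_lt measurable_const measurable_id) measurable_const
    (Measurable.ite (measurableSet_eq_fun measurable_const measurable_id) measurable_const
      measurable_const)

lemma mertensK_eq_tsum (x : ℝ) : mertensK K x =
    ∑' 𝔞 : (Ideal (𝓞 K))⁰, (moebiusK K 𝔞.1 : ℝ) * mertensWeight (Ideal.absNorm 𝔞.1) x := by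
  unfold mertensK
  rw [← tsum_subtype_eq_of_support_subset (s := ((Ideal (𝓞 K))⁰ : Set (Ideal (𝓞 K))))]
  · refine tsum_congr fun 𝔞 => ?_
    have h0 : (𝔞 : Ideal (𝓞 K)) ≠ ⊥ := nonZeroDivisors.ne_zero 𝔞.2
    simp only [ne_eq, h0, not_false_eq_true, true_and, mertensWeight]
    split_ifs <;> ring
  · intro I hI
    refine mem_nonZeroDivisors_of_ne_zero fun h => hI ?_
    have h0 : I = ⊥ := h
    simp [h0]

lemma norm_mertens_term_le (𝔞 : (Ideal (𝓞 K))⁰) {x : ℝ} (hx : 0 < x) :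
    ‖(moebiusK K 𝔞.1 : ℝ) * mertensWeight (Ideal.absNorm 𝔞.1) x‖ ≤
      x ^ (2 : ℝ) * (Ideal.absNorm 𝔞.1 : ℝ) ^ (-2 : ℝ) := by
  rw [norm_mul, Real.norm_eq_abs, Real.norm_of_nonneg (mertensWeight_nonneg _ _)]
  exact (mul_le_of_le_one_left (mertensWeight_nonneg _ _) (abs_moebiusK_le _)).trans
    (mertensWeight_le (absNorm_pos_real 𝔞) hx)

lemma summable_mertens {x : ℝ} (hx : 0 < x) : Summable fun 𝔞 : (Ideal (𝓞 K))⁰ =>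
    (moebiusK K 𝔞.1 : ℝ) * mertensWeight (Ideal.absNorm 𝔞.1) x :=
  Summable.of_norm_bounded ((summable_absNorm_rpow (K := K) one_lt_two).mul_left _)
    fun 𝔞 => norm_mertens_term_le 𝔞 hx

lemma abs_mertensK_le {x : ℝ} (hx : 0 < x) : |mertensK K x| ≤ x ^ (2 : ℝ) * idealZeta K 2 := by
  rw [mertensK_eq_tsum, idealZeta, ← tsum_mul_left, ← Real.norm_eq_abs]
  exact tsum_of_norm_bounded
    ((summable_absNorm_rpow (K := K) one_lt_two).mul_left _).hasSum
    fun 𝔞 => norm_mertens_term_le 𝔞 hx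

lemma measurable_mertensK_exp : Measurable fun t : ℝ => mertensK K (Real.exp t) := by
  have : Countable (Ideal (𝓞 K))⁰ := countable_ideals
  refine measurable_of_tendsto_metrizable' (atTop : Filter (Finset (Ideal (𝓞 K))⁰))
    (f := fun S t => ∑ 𝔞 ∈ S, (moebiusK K 𝔞.1 : ℝ) *
      mertensWeight (Ideal.absNorm 𝔞.1) (Real.exp t)) (fun S => ?_) ?_
  · exact Finset.measurable_sum _ fun 𝔞 _ =>
      ((measurable_mertensWeight _).comp Real.measurable_exp).const_mul _
  · rw [tendsto_pi_nhds]
    intro t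
    rw [mertensK_eq_tsum]
    exact (summable_mertens (Real.exp_pos t)).hasSum

lemma mertensK_eq_one {x : ℝ} (h1 : 1 < x) (h2 : x < 2) : mertensK K x = 1 := by
  rw [mertensK_eq_tsum, tsum_eq_single 1 fun 𝔞 h𝔞 => ?_]
  · rw [OneMemClass.coe_one, moebiusK_one, map_one, mertensWeight, Nat.cast_one, if_pos h1]
    simp
  · have h3 : 2 ≤ Ideal.absNorm 𝔞.1 := by
      have h4 : Ideal.absNorm 𝔞.1 ≠ 1 := fun h =>
        h𝔞 (Subtype.ext ((Ideal.absNorm_eq_one_iff.1 h).trans Ideal.one_eq_top.symm))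
      have h5 : 1 ≤ Ideal.absNorm 𝔞.1 := by exact_mod_cast absNorm_pos_real 𝔞
      omega
    have h6 : (2 : ℝ) ≤ Ideal.absNorm 𝔞.1 := by exact_mod_cast h3
    rw [mertensWeight_of_lt (by linarith), mul_zero]

/-- The Mertens function on a logarithmic scale, normalised by the square root. -/
def mertensLog (K : Type) [Field K] [NumberField K] (t : ℝ) : ℝ :=
  if 0 < t then mertensK K (Real.exp t) * Real.exp (-(t / 2)) else 0

lemma measurable_mertensLog : Measurable (mertensLog K) :=
  Measurable.ite (measurableSet_lt measurable_const measurable_id)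
    (measurable_mertensK_exp.mul (by fun_prop)) measurable_const

lemma mertensLog_eq_exp {t : ℝ} (h0 : 0 < t) (h1 : t < Real.log 2) :
    mertensLog K t = Real.exp (-(t / 2)) := by
  rw [mertensLog, if_pos h0, mertensK_eq_one, one_mul]
  · exact Real.one_lt_exp_iff.2 h0
  · rw [← Real.exp_log two_pos]
    exact Real.exp_lt_exp.2 h1

lemma exp_neg_mul_log {n : ℝ} (hn : 0 < n) (s : ℂ) :
    ‖cexp (-s * (Real.log n : ℝ))‖ = n ^ (-s.re) := by
  rw [Complex.norm_exp, Real.rpow_def_of_pos hn]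
  simp
  ring

/-- The Laplace transform of the normalised Mertens function is a Dirichlet series. -/
lemma lap_mertensLog {z : ℂ} (hz : 1 / 2 < z.re) : lap (mertensLog K) z =
    ∑' 𝔞 : (Ideal (𝓞 K))⁰, (moebiusK K 𝔞.1 : ℂ) *
      (cexp (-(1 / 2 + z) * (Real.log (Ideal.absNorm 𝔞.1) : ℝ)) / (1 / 2 + z)) := by
  have hre : (-(1 / 2 + z)).re < 0 := by
    simp
    linarith
  have hcount : Countable (Ideal (𝓞 K))⁰ := countable_ideals
  set F : (Ideal (𝓞 K))⁰ → ℝ → ℂ := fun 𝔞 => (Set.Ioi (Real.log (Ideal.absNorm 𝔞.1))).indicator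
    fun t => (moebiusK K 𝔞.1 : ℂ) * cexp (-(1 / 2 + z) * t) with hF
  have hint : ∀ 𝔞, Integrable (F 𝔞) := fun 𝔞 => by
    rw [hF, integrable_indicator_iff measurableSet_Ioi]
    exact (integrableOn_exp_mul_complex_Ioi hre _).const_mul _
  have hval : ∀ 𝔞, ∫ t, F 𝔞 t = (moebiusK K 𝔞.1 : ℂ) *
      (cexp (-(1 / 2 + z) * (Real.log (Ideal.absNorm 𝔞.1) : ℝ)) / (1 / 2 + z)) := fun 𝔞 => by
    rw [hF, integral_indicator measurableSet_Ioi, integral_const_mul,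
      integral_exp_mul_complex_Ioi hre, neg_div_neg_eq]
  have hnorm : ∀ 𝔞, ∫ t, ‖F 𝔞 t‖ ≤
      (Ideal.absNorm 𝔞.1 : ℝ) ^ (-(1 / 2 + z.re)) / (1 / 2 + z.re) := fun 𝔞 => by
    have hp : (0 : ℝ) < Ideal.absNorm 𝔞.1 := by linarith [absNorm_pos_real 𝔞]
    have e : ∀ t, ‖F 𝔞 t‖ ≤ (Set.Ioi (Real.log (Ideal.absNorm 𝔞.1))).indicator
        (fun t => Real.exp (-(1 / 2 + z.re) * t)) t := fun t => by
      rw [hF, norm_indicator_eq_indicator_norm]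
      refine Set.indicator_le_indicator ?_
      rw [norm_mul, Complex.norm_exp, norm_intCast]
      refine (mul_le_of_le_one_left (Real.exp_pos _).le ?_).trans_eq ?_
      · exact_mod_cast abs_moebiusK_le 𝔞.1
      · simp
    refine (integral_mono (hint 𝔞).norm ?_ e).trans_eq ?_
    · rw [integrable_indicator_iff measurableSet_Ioi]
      exact integrableOn_exp_mul_Ioi (by linarith) _
    · rw [integral_indicator measurableSet_Ioi, integral_exp_mul_Ioi (by linarith), neg_div_neg_eq,
        Real.rpow_def_of_pos hp, mul_comm (Real.log _)]
  have hsum : Summable fun 𝔞 => ∫ t, ‖F 𝔞 t‖ :=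
    Summable.of_nonneg_of_le (fun 𝔞 => integral_nonneg fun _ => norm_nonneg _) hnorm
      ((summable_absNorm_rpow (K := K) (by linarith)).div_const _)
  have h := (hasSum_integral_of_summable_integral_norm hint hsum).tsum_eq
  simp only [hval] at h
  rw [h, lap]
  refine integral_congr_ae ?_
  have hae : ∀ᵐ t : ℝ, ∀ 𝔞 : (Ideal (𝓞 K))⁰, t ≠ Real.log (Ideal.absNorm 𝔞.1) :=
    ae_all_iff.2 fun 𝔞 => Measure.ae_ne volume _
  filter_upwards [hae] with t ht
  have ht0 : t ≠ 0 := by simpa using ht 1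
  have hFt : ∀ 𝔞 : (Ideal (𝓞 K))⁰, F 𝔞 t = (((moebiusK K 𝔞.1 : ℝ) *
      mertensWeight (Ideal.absNorm 𝔞.1) (Real.exp t) : ℝ) : ℂ) * cexp (-(1 / 2 + z) * t) :=
    fun 𝔞 => by
    have hp : (0 : ℝ) < Ideal.absNorm 𝔞.1 := by linarith [absNorm_pos_real 𝔞]
    rcases lt_or_gt_of_ne (ht 𝔞) with h1 | h1
    · rw [mertensWeight_of_lt ((Real.lt_log_iff_exp_lt hp).1 h1), hF]
      simp [h1.le]
    · rw [mertensWeight, if_pos ((Real.log_lt_iff_lt_exp hp).1 h1), hF]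
      simp [h1]
  simp only [hFt]
  rw [tsum_mul_right, ← ofReal_tsum, ← mertensK_eq_tsum, mertensLog]
  split_ifs with h0
  · rw [show -(1 / 2 + z) * (t : ℂ) = ((-(t / 2) : ℝ) : ℂ) + -z * t by push_cast; ring,
      Complex.exp_add]
    push_cast
    ring
  · have h1 : mertensK K (Real.exp t) = 0 := by
      rw [mertensK_eq_tsum]
      convert tsum_zero with 𝔞
      rw [mertensWeight_of_lt, mul_zero]
      refine lt_of_lt_of_le ?_ (absNorm_pos_real 𝔞)
      rw [← Real.exp_zero]
      exact Real.exp_lt_exp.2 (lt_of_le_of_ne (not_lt.1 h0) ht0)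
    simp [h1]

lemma norm_lap_mertensLog_le {z : ℂ} (hz : 1 / 2 < z.re) :
    ‖lap (mertensLog K) z‖ ≤ idealZeta K (1 / 2 + z.re) / ‖1 / 2 + z‖ := by
  rw [lap_mertensLog hz, idealZeta, ← tsum_div_const]
  refine tsum_of_norm_bounded
    ((summable_absNorm_rpow (K := K) (by linarith)).div_const _).hasSum fun 𝔞 => ?_
  have hp : (0 : ℝ) < Ideal.absNorm 𝔞.1 := by linarith [absNorm_pos_real 𝔞]
  rw [norm_mul, norm_div, exp_neg_mul_log hp, norm_intCast]
  refine (mul_le_of_le_one_left (by positivity) ?_).trans_eq ?_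
  · exact_mod_cast abs_moebiusK_le 𝔞.1
  · simp

lemma lap_mertensLog_mul_idealZeta {x : ℝ} (hx : 1 / 2 < x) :
    lap (mertensLog K) x * ((1 / 2 + x : ℝ) * idealZeta K (1 / 2 + x) : ℝ) = 1 := by
  have h := tsum_moebiusK_mul_idealZeta (K := K) (s := 1 / 2 + x) (by linarith)
  have h1 : lap (mertensLog K) x = (((∑' 𝔞 : (Ideal (𝓞 K))⁰, (moebiusK K 𝔞.1 : ℝ) *
      (Ideal.absNorm 𝔞.1 : ℝ) ^ (-(1 / 2 + x))) / (1 / 2 + x) : ℝ) : ℂ) := by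
    rw [lap_mertensLog (by simpa using hx), ← tsum_div_const, ofReal_tsum]
    refine tsum_congr fun 𝔞 => ?_
    have hp : (0 : ℝ) < Ideal.absNorm 𝔞.1 := by linarith [absNorm_pos_real 𝔞]
    rw [Real.rpow_def_of_pos hp]
    push_cast
    ring_nf
  have h2 : (1 / 2 + x) ≠ 0 := by linarith
  rw [h1, ← ofReal_mul, ← mul_assoc, div_mul_cancel₀ _ h2, h, ofReal_one]

end MertensFunction

section LaplaceDataOfMertens

/-- The archimedean factor of the completed zeta function, without its trivial zero at `s = 0`. -/
def completingFactor (c A : ℝ) (m n : ℕ) (z : ℂ) : ℂ :=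
  c * (z - 1 / 2) * (A : ℂ) ^ (1 / 2 + z) *
    (Complex.Gamma ((1 / 2 + z) / 2) ^ m * Complex.Gamma (1 / 2 + z) ^ n)

variable {c A : ℝ} {m n : ℕ}

lemma differentiableAt_completingFactor (hA : 0 < A) {z : ℂ} (h : -(3 / 2) < z.re)
    (h0 : z ≠ -(1 / 2)) : DifferentiableAt ℂ (completingFactor c A m n) z := by
  have hs : ∀ k : ℕ, 1 / 2 + z ≠ -k := fun k hk => by
    have h1 := congrArg re hk
    simp at h1
    rcases Nat.eq_zero_or_pos k with rfl | hk'
    · exact h0 (by linear_combination hk)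
    · have h2 : (1 : ℝ) ≤ k := by exact_mod_cast hk'
      linarith
  have hs2 : ∀ k : ℕ, (1 / 2 + z) / 2 ≠ -k := fun k hk => hs (2 * k) (by
    push_cast
    linear_combination 2 * hk)
  have g1 : DifferentiableAt ℂ (fun z => Complex.Gamma ((1 / 2 + z) / 2)) z :=
    DifferentiableAt.comp z (g := Complex.Gamma) (f := fun z => (1 / 2 + z) / 2)
      (Complex.differentiableAt_Gamma _ hs2) (by fun_prop)
  have g2 : DifferentiableAt ℂ (fun z => Complex.Gamma (1 / 2 + z)) z :=
    DifferentiableAt.comp z (g := Complex.Gamma) (f := fun z => 1 / 2 + z)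
      (Complex.differentiableAt_Gamma _ hs) (by fun_prop)
  have g3 : DifferentiableAt ℂ (fun z : ℂ => (A : ℂ) ^ (1 / 2 + z)) z :=
    DifferentiableAt.const_cpow (by fun_prop) (Or.inl (by exact_mod_cast hA.ne'))
  have g4 : DifferentiableAt ℂ (fun z : ℂ => (c : ℂ) * (z - 1 / 2)) z := by fun_prop
  exact (g4.mul g3).mul ((g1.pow m).mul (g2.pow n))

lemma completingFactor_ne_zero (hc : 0 < c) (hA : 0 < A) {z : ℂ} (h : 0 ≤ z.re) (h0 : z ≠ 1 / 2) :
    completingFactor c A m n z ≠ 0 := by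
  have e : (1 / 2 + z).re = 1 / 2 + z.re := by simp
  refine mul_ne_zero (mul_ne_zero (mul_ne_zero ?_ (sub_ne_zero.2 h0)) ?_)
    (mul_ne_zero (pow_ne_zero _ ?_) (pow_ne_zero _ ?_))
  · exact_mod_cast hc.ne'
  · rw [Complex.cpow_def_of_ne_zero (by exact_mod_cast hA.ne')]
    exact Complex.exp_ne_zero _
  · refine Complex.Gamma_ne_zero_of_re_pos ?_
    rw [div_ofNat_re, e]
    linarith
  · refine Complex.Gamma_ne_zero_of_re_pos ?_
    rw [e]
    linarith

lemma norm_completingFactor (hc : 0 < c) (hA : 0 < A) (z : ℂ) : ‖completingFactor c A m n z‖ =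
    c * ‖z - 1 / 2‖ * A ^ (1 / 2 + z.re) *
      (‖Complex.Gamma ((1 / 2 + z) / 2)‖ ^ m * ‖Complex.Gamma (1 / 2 + z)‖ ^ n) := by
  have e : (1 / 2 + z).re = 1 / 2 + z.re := by simp
  rw [completingFactor, norm_mul, norm_mul, norm_mul, norm_mul, norm_pow, norm_pow, norm_real,
    Real.norm_of_nonneg hc.le, Complex.norm_cpow_eq_rpow_re_of_pos hA, e]

lemma rpow_le_one_add (hA : 0 < A) {u : ℝ} (h1 : -2 ≤ u) (h2 : u ≤ 0) :
    A ^ u ≤ 1 + A ^ (-2 : ℝ) := by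
  rcases le_total 1 A with h | h
  · have h3 := Real.rpow_le_one_of_one_le_of_nonpos h h2
    have h4 : 0 < A ^ (-2 : ℝ) := by positivity
    linarith
  · have h3 := Real.rpow_le_rpow_of_exponent_ge hA h h1
    linarith

lemma norm_completingFactor_le (hc : 0 < c) (hA : 0 < A) {z : ℂ} {Q : ℝ} (hQ : 0 ≤ Q) (h1 : -1 ≤ z.re)
    (h2 : z.re ≤ 0) (h3 : 1 ≤ |z.im|)
    (hG1 : ‖Complex.Gamma (1 / 2 + z)‖ ≤ Q * ‖Complex.Gamma (1 - (1 / 2 + z))‖)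
    (hG2 : ‖Complex.Gamma ((1 / 2 + z) / 2)‖ ≤ Q * ‖Complex.Gamma ((1 - (1 / 2 + z)) / 2)‖) :
    ‖completingFactor c A m n z‖ ≤
      2 * (1 + A ^ (-2 : ℝ)) * Q ^ (m + n) * ‖completingFactor c A m n (-z)‖ := by
  rw [norm_completingFactor hc hA, norm_completingFactor hc hA]
  have e : 1 - (1 / 2 + z) = 1 / 2 + -z := by ring
  rw [e] at hG1 hG2
  have hz : ‖z - 1 / 2‖ ≤ 2 * ‖-z - 1 / 2‖ := by
    have h4 : 1 ≤ ‖-z - 1 / 2‖ := h3.trans (by simpa using abs_im_le_norm (-z - 1 / 2))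
    have h5 := norm_add_le (-(-z - 1 / 2)) (-1)
    rw [norm_neg, norm_neg, norm_one, show -(-z - 1 / 2) + -1 = z - 1 / 2 by ring] at h5
    linarith
  have hp : A ^ (1 / 2 + z.re) ≤ (1 + A ^ (-2 : ℝ)) * A ^ (1 / 2 + (-z).re) := by
    have h4 := rpow_le_one_add hA (u := 2 * z.re) (by linarith) (by linarith)
    calc A ^ (1 / 2 + z.re) = A ^ (2 * z.re) * A ^ (1 / 2 + (-z).re) := by
          rw [← Real.rpow_add hA, neg_re]
          ring_nf
      _ ≤ _ := by gcongr
  calc c * ‖z - 1 / 2‖ * A ^ (1 / 2 + z.re) *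
      (‖Complex.Gamma ((1 / 2 + z) / 2)‖ ^ m * ‖Complex.Gamma (1 / 2 + z)‖ ^ n)
      ≤ c * (2 * ‖-z - 1 / 2‖) * ((1 + A ^ (-2 : ℝ)) * A ^ (1 / 2 + (-z).re)) *
        ((Q * ‖Complex.Gamma ((1 / 2 + -z) / 2)‖) ^ m * (Q * ‖Complex.Gamma (1 / 2 + -z)‖) ^ n) := by
        gcongr
    _ = _ := by rw [mul_pow, mul_pow, pow_add]; ring

variable {K : Type} [Field K] [NumberField K]

lemma lap_mul_eq_of_real {f : ℝ → ℝ} (hm : Measurable f) {C : ℝ} (hC : ∀ t, |f t| ≤ C)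
    (h0 : ∀ t ≤ 0, f t = 0) {E R : ℂ → ℂ} (hE : Differentiable ℂ E)
    (hR : ∀ z : ℂ, 0 < z.re → DifferentiableAt ℂ R z)
    (h : ∀ x : ℝ, 1 / 2 < x → lap f x * E x = R x) {z : ℂ} (hz : 0 < z.re) :
    lap f z * E z = R z := by
  have ho : IsOpen {z : ℂ | 0 < z.re} := isOpen_lt continuous_const continuous_re
  have a1 : AnalyticOnNhd ℂ (fun z => lap f z * E z) {z : ℂ | 0 < z.re} :=
    DifferentiableOn.analyticOnNhd (fun z hz =>
      ((differentiableAt_lap_right hm hC h0 hz).mul (hE z)).differentiableWithinAt) ho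
  have a2 : AnalyticOnNhd ℂ R {z : ℂ | 0 < z.re} :=
    DifferentiableOn.analyticOnNhd (fun z hz => (hR z hz).differentiableWithinAt) ho
  have ht : Tendsto (fun x : ℝ => (x : ℂ)) (𝓝[≠] 1) (𝓝[≠] 1) := by
    refine tendsto_nhdsWithin_iff.2 ⟨?_, ?_⟩
    · exact (Complex.continuous_ofReal.tendsto' 1 1 ofReal_one).mono_left nhdsWithin_le_nhds
    · filter_upwards [self_mem_nhdsWithin] with x hx
      exact fun h => hx (Complex.ofReal_injective (h.trans ofReal_one.symm))
  have hev : ∀ᶠ x : ℝ in 𝓝[≠] 1, lap f x * E x = R x := by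
    filter_upwards [nhdsWithin_le_nhds (lt_mem_nhds (by norm_num : (1 / 2 : ℝ) < 1))] with x hx
    exact h x hx
  exact a1.eqOn_of_preconnected_of_frequently_eq a2 (convex_halfSpace_re_gt 0).isPreconnected
    (by simp : (1 : ℂ) ∈ {z : ℂ | 0 < z.re}) (ht.frequently hev.frequently) hz

theorem exists_laplaceData {C : ℝ} (hC : ∀ t, |mertensLog K t| ≤ C) :
    ∃ (E R : ℂ → ℂ) (A B c D : ℝ), LaplaceData (mertensLog K) E R C A B c D := by
  obtain ⟨c, A, hc, hA, hxi⟩ := exists_completed_zeta (K := K)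
  obtain ⟨M, hM1, hM⟩ := exists_norm_Gamma_ratio_le
  set m := InfinitePlace.nrRealPlaces K with hm
  set n := InfinitePlace.nrComplexPlaces K with hn
  have hmn : m + n ≠ 0 := by
    rw [hm, hn, ← InfinitePlace.card_eq_nrRealPlaces_add_nrComplexPlaces]
    exact Fintype.card_ne_zero
  have h0 : ∀ t ≤ 0, mertensLog K t = 0 := fun t ht => if_neg ht.not_gt
  have hR : ∀ z : ℂ, -(3 / 2) < z.re → z ≠ -(1 / 2) → DifferentiableAt ℂ (completingFactor c A m n) z :=
    fun z => differentiableAt_completingFactor hA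
  have him : ∀ z : ℂ, (1 / 2 + z).im = z.im := fun z => by simp
  have hre : ∀ z : ℂ, (1 / 2 + z).re = 1 / 2 + z.re := fun z => by simp
  refine ⟨fun z => xiK K (1 / 2 + z), completingFactor c A m n, 2 * (1 + A ^ (-2 : ℝ)) * M ^ (m + n),
    (m + n : ℕ) * Real.pi, 2 * (1 + A ^ (-2 : ℝ)) * 2 ^ (m + n), idealZeta K (1 / 2 + 1), ?_⟩
  have hE : Differentiable ℂ fun z => xiK K (1 / 2 + z) :=
    differentiable_xiK.comp (differentiable_const _ |>.add differentiable_id)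
  constructor
  · exact measurable_mertensLog
  · exact hC
  · exact h0
  · exact hE
  · intro z
    rw [← xiK_one_sub]
    congr 1
    ring
  · exact hR
  · exact fun z => completingFactor_ne_zero hc hA
  · refine fun z => lap_mul_eq_of_real measurable_mertensLog hC h0 hE
      (fun z hz => hR z (by linarith) ?_) fun x hx => ?_
    · rintro rfl
      norm_num at hz
    · have h1 := lap_mertensLog_mul_idealZeta (K := K) hx
      have h2 := hxi (1 / 2 + x) (by linarith)
      have h3 : (A : ℂ) ^ (1 / 2 + x : ℂ) = ((A ^ (1 / 2 + x) : ℝ) : ℂ) := by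
        rw [Complex.ofReal_cpow hA.le]
        push_cast
        rfl
      have h4 : Complex.Gamma ((1 / 2 + x) / 2) = ((Real.Gamma ((1 / 2 + x) / 2) : ℝ) : ℂ) := by
        rw [← Complex.Gamma_ofReal]
        push_cast
        rfl
      have h5 : Complex.Gamma (1 / 2 + x) = ((Real.Gamma (1 / 2 + x) : ℝ) : ℂ) := by
        rw [← Complex.Gamma_ofReal]
        push_cast
        rfl
      have h6 : (1 / 2 + x : ℂ) = ((1 / 2 + x : ℝ) : ℂ) := by push_cast; rfl
      rw [completingFactor, h3, h4, h5, h6, h2]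
      push_cast at h1 ⊢
      linear_combination (c * (x - 1 / 2) * ((A ^ (1 / 2 + x) : ℝ) : ℂ) *
        (((Real.Gamma ((1 / 2 + x) / 2) : ℝ) : ℂ) ^ m * ((Real.Gamma (1 / 2 + x) : ℝ) : ℂ) ^ n)) * h1
  · positivity
  · positivity
  · positivity
  · intro z h1 h2 h3
    obtain ⟨g1, g2⟩ := hM (1 / 2 + z) (by rw [hre]; linarith) (by rw [hre]; linarith)
      (by rwa [him])
    rw [him] at g1 g2
    refine (norm_completingFactor_le hc hA (by positivity) h1 h2.le h3 g1 g2).trans_eq ?_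
    rw [mul_pow, ← Real.exp_nat_mul]
    ring_nf
  · intro z h1 h3
    obtain ⟨g1, g2⟩ := norm_Gamma_le_of_re_eq (s := 1 / 2 + z) (by rw [hre, h1]; norm_num)
      (by rwa [him])
    rw [him] at g1 g2
    have h4 : 0 < |z.im| := by linarith
    have g3 : 1 / |z.im| * ‖Complex.Gamma (1 - (1 / 2 + z))‖ ≤
        2 / |z.im| * ‖Complex.Gamma (1 - (1 / 2 + z))‖ := by
      gcongr
      norm_num
    refine (norm_completingFactor_le hc hA (by positivity) h1.ge (by linarith) h3 (g1.trans g3) g2).trans ?_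
    refine mul_le_mul_of_nonneg_right ?_ (norm_nonneg _)
    rw [div_pow, mul_div_assoc]
    gcongr
    exact le_self_pow₀ h3 hmn
  · intro z h1 h3
    have h5 := norm_lap_mertensLog_le (K := K) (z := z) (by rw [h1]; norm_num)
    rw [h1] at h5
    have h6 : 0 ≤ idealZeta K (1 / 2 + 1) := tsum_nonneg fun _ => by positivity
    have h7 : |z.im| ≤ ‖1 / 2 + z‖ := by
      rw [← him z]
      exact abs_im_le_norm _
    exact h5.trans (div_le_div_of_nonneg_left h6 (by linarith) h7)

end LaplaceDataOfMertens

section MertensBounds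

variable {K : Type} [Field K] [NumberField K]

lemma mertensLog_eq_div_sqrt {t : ℝ} (ht : 0 < t) :
    mertensLog K t = mertensK K (Real.exp t) / Real.sqrt (Real.exp t) := by
  rw [mertensLog, if_pos ht, Real.exp_neg, Real.exp_half, div_eq_mul_inv]

lemma eventually_mertensLog {p : ℝ → Prop}
    (h : ∀ᶠ x : ℝ in atTop, p (mertensK K x / Real.sqrt x)) :
    ∃ t₁ : ℝ, ∀ t, t₁ ≤ t → p (mertensLog K t) := by
  obtain ⟨t₁, ht₁⟩ := eventually_atTop.1
    ((Real.tendsto_exp_atTop.eventually h).and (eventually_gt_atTop 0))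
  refine ⟨t₁, fun t ht => ?_⟩
  rw [mertensLog_eq_div_sqrt (ht₁ t ht).2]
  exact (ht₁ t ht).1

lemma exists_abs_mertensLog_le {a b t₁ : ℝ} (ha : ∀ t, t₁ ≤ t → mertensLog K t < a)
    (hb : ∀ t, t₁ ≤ t → b < mertensLog K t) : ∃ C, ∀ t, |mertensLog K t| ≤ C := by
  have h0 : 0 ≤ idealZeta K 2 := tsum_nonneg fun _ => by positivity
  refine ⟨max (max a (-b)) (Real.exp t₁ ^ (2 : ℝ) * idealZeta K 2), fun t => ?_⟩
  rcases le_or_gt t₁ t with h | h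
  · refine le_trans (abs_le'.2 ⟨?_, ?_⟩) (le_max_left _ _)
    · exact (ha t h).le.trans (le_max_left _ _)
    · exact (neg_le_neg (hb t h).le).trans (le_max_right _ _)
  · refine le_trans ?_ (le_max_right _ _)
    rw [mertensLog]
    split_ifs with ht
    · rw [abs_mul, abs_of_pos (Real.exp_pos _)]
      refine (mul_le_of_le_one_right (abs_nonneg _) ?_).trans
        ((abs_mertensK_le (Real.exp_pos t)).trans ?_)
      · rw [Real.exp_le_one_iff]
        linarith
      · gcongr
    · rw [abs_zero]
      positivity

lemma one_le_sub_of_eventually_mertensK {a b : ℝ}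
    (ha : ∀ᶠ x : ℝ in atTop, mertensK K x / Real.sqrt x < a)
    (hb : ∀ᶠ x : ℝ in atTop, b < mertensK K x / Real.sqrt x) : 1 ≤ a - b := by
  obtain ⟨t₁, ht₁⟩ := eventually_mertensLog (p := fun y => y < a ∧ b < y) (ha.and hb)
  obtain ⟨C, hC⟩ := exists_abs_mertensLog_le (fun t ht => (ht₁ t ht).1) (fun t ht => (ht₁ t ht).2)
  obtain ⟨E, R, A, B, c, D, L⟩ := exists_laplaceData hC
  exact L.one_le_sub_of_eventually (Real.log_pos one_lt_two) (fun t => mertensLog_eq_exp)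
    (fun t ht => (ht₁ t ht).1.le) (fun t ht => (ht₁ t ht).2.le)

end MertensBounds

/-- Unconditionally, `M_K^+ - M_K^- ≥ 1`: either `M_K^+ = +∞`, or `M_K^- = -∞`, or both
are finite real numbers whose difference is at least `1`. -/
theorem mkplus_sub_mkminus_ge_one (K : Type) [Field K] [NumberField K] :
    MKplus K = ⊤ ∨ MKminus K = ⊥ ∨
      ∃ a b : ℝ, MKplus K = (a : EReal) ∧ MKminus K = (b : EReal) ∧ 1 ≤ a - b := by
  by_cases hp : MKplus K = ⊤
  · exact Or.inl hp
  by_cases hm : MKminus K = ⊥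
  · exact Or.inr (Or.inl hm)
  have hle : MKminus K ≤ MKplus K := liminf_le_limsup
  have hp' : MKplus K ≠ ⊥ := fun h => hm (le_bot_iff.1 (h ▸ hle))
  have hm' : MKminus K ≠ ⊤ := fun h => hp (top_le_iff.1 (h ▸ hle))
  have ea : MKplus K = ((MKplus K).toReal : EReal) := (EReal.coe_toReal hp hp').symm
  have eb : MKminus K = ((MKminus K).toReal : EReal) := (EReal.coe_toReal hm' hm).symm
  refine Or.inr (Or.inr ⟨(MKplus K).toReal, (MKminus K).toReal, ea, eb, ?_⟩)
  refine le_of_forall_pos_le_add fun ε hε => ?_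
  have h1 : MKplus K < (((MKplus K).toReal + ε / 2 : ℝ) : EReal) := by
    nth_rewrite 1 [ea]
    exact EReal.coe_lt_coe_iff.2 (by linarith)
  have h2 : (((MKminus K).toReal - ε / 2 : ℝ) : EReal) < MKminus K := by
    nth_rewrite 2 [eb]
    exact EReal.coe_lt_coe_iff.2 (by linarith)
  have h3 := one_le_sub_of_eventually_mertensK (K := K)
    ((eventually_lt_of_limsup_lt h1).mono fun x hx => EReal.coe_lt_coe_iff.1 hx)
    ((eventually_lt_of_lt_liminf h2).mono fun x hx => EReal.coe_lt_coe_iff.1 hx)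
  linarith
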